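/- For every integer n ≥ 3, ω(n) ≤ (log n / log log n)·(1 + 1/(log log n) + 2.8973/(log log n)^2), where ω(n) is the number of distinct prime divisors of n. -/

import Mathlib

open Complex Filter Topology Metric Set

/-- A zero-free function with controlled growth has small logarithmic derivative. -/
theorem norm_logDeriv_le_of_forall_ne_zero {G : ℂ → ℂ} (hG : Differentiable ℂ G) {R B : ℝ}
    (hR : 0 < R) (hB : 0 < B) (hne : ∀ w ∈ ball (0 : ℂ) R, G w ≠ 0)
    (hbd : ∀ w ∈ ball (0 : ℂ) R, ‖G w‖ ≤ Real.exp B * ‖G 0‖) (h0 : logDeriv G 0 = 0)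
    {z : ℂ} (hz : ‖z‖ < R / 4) : ‖logDeriv G z‖ ≤ 32 * B * ‖z‖ / R ^ 2 := by
  have h0R : (0 : ℂ) ∈ ball (0 : ℂ) R := mem_ball_self hR
  have hdiff : DifferentiableOn ℂ (logDeriv G) (ball 0 R) := by
    intro w hw
    have : DifferentiableAt ℂ (deriv G) w := (hG.analyticAt w).deriv.differentiableAt
    exact (this.div (hG w) (hne w hw)).differentiableWithinAt
  obtain ⟨h, hh0, hh⟩ := (hdiff.isExactOn_ball).with_val_at 0 0
  have hexp : ∀ w ∈ ball (0 : ℂ) R, G w * exp (-h w) = G 0 := by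
    intro w hw
    have hd : ∀ x ∈ ball (0 : ℂ) R, HasDerivAt (fun x => G x * exp (-h x)) 0 x := by
      intro x hx
      have h1 := (hG x).hasDerivAt.mul ((hh x hx).neg.cexp)
      refine h1.congr_deriv ?_
      have := hne x hx
      simp only [Pi.neg_apply, logDeriv_apply]
      field_simp
      ring
    have := (convex_ball (0 : ℂ) R).is_const_of_fderivWithin_eq_zero (𝕜 := ℂ)
      (f := fun x => G x * exp (-h x)) (fun x hx => (hd x hx).differentiableAt.differentiableWithinAt)
      (fun x hx => by
        rw [fderivWithin_of_isOpen isOpen_ball hx]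
        ext
        simpa using (hd x hx).deriv) hw h0R
    simpa [hh0] using this
  have hre : ∀ w ∈ ball (0 : ℂ) R, (h w).re ≤ B := by
    intro w hw
    have h1 : G w = G 0 * exp (h w) := by
      rw [← hexp w hw, mul_assoc, ← Complex.exp_add]; simp
    have h2 := hbd w hw
    rw [h1, norm_mul, Complex.norm_exp, mul_comm] at h2
    exact Real.exp_le_exp.1 (le_of_mul_le_mul_right h2 (norm_pos_iff.2 (hne 0 h0R)))
  have hdh : DifferentiableOn ℂ h (ball 0 R) :=
    fun w hw => (hh w hw).differentiableAt.differentiableWithinAt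
  have hbc : ∀ w : ℂ, ‖w‖ ≤ R / 2 → ‖h w‖ ≤ 2 * B := by
    intro w hw
    have hw' : w ∈ ball (0 : ℂ) R := mem_ball_zero_iff.2 (by linarith)
    have h1 := borelCaratheodory_zero hB hdh (fun x hx => hre x hx) hR hw' hh0
    refine h1.trans ?_
    rw [div_le_iff₀ (by linarith)]
    nlinarith
  have hder : ∀ w : ℂ, ‖w‖ < R / 4 → ‖logDeriv G w‖ ≤ 8 * B / R := by
    intro w hw
    have hsub : closedBall w (R / 4) ⊆ ball (0 : ℂ) R := by
      intro x hx
      rw [mem_closedBall, dist_eq_norm] at hx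
      rw [mem_ball_zero_iff]
      have := norm_add_le (x - w) w
      rw [sub_add_cancel] at this
      linarith
    have h1 := Complex.norm_deriv_le_of_forall_mem_sphere_norm_le (c := w) (R := R / 4)
      (C := 2 * B) (f := h) (by linarith)
      ((hdh.mono hsub).diffContOnCl_ball subset_rfl) (by
        intro x hx
        apply hbc
        rw [mem_sphere, dist_eq_norm] at hx
        have := norm_add_le (x - w) w
        rw [sub_add_cancel] at this
        linarith)
    rw [(hh w (mem_ball_zero_iff.2 (by linarith))).deriv] at h1
    refine h1.trans (le_of_eq ?_)
    field_simp
    norm_num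
  have h4 := Complex.dist_le_div_mul_dist_of_mapsTo_ball (f := logDeriv G) (c := 0) (R₁ := R / 4)
    (R₂ := 8 * B / R) (z := z) (hdiff.mono (ball_subset_ball (by linarith)))
    (fun w hw => by
      rw [h0, mem_closedBall, dist_zero_right]
      exact hder w (mem_ball_zero_iff.1 hw)) (mem_ball_zero_iff.2 hz)
  rw [h0, dist_zero_right, dist_zero_right] at h4
  refine h4.trans (le_of_eq ?_)
  field_simp
  ring

theorem Differentiable.exists_eq_pow_mul {g : ℂ → ℂ} (hg : Differentiable ℂ g) (a : ℂ) (k : ℕ)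
    (hk : analyticOrderAt g a = k) :
    ∃ h : ℂ → ℂ, Differentiable ℂ h ∧ h a ≠ 0 ∧ ∀ z, g z = (z - a) ^ k * h z := by
  induction k generalizing g with
  | zero =>
    refine ⟨g, hg, ?_, by simp⟩
    exact (hg.analyticAt a).analyticOrderAt_eq_zero.1 (by simpa using hk)
  | succ k ih =>
    have hga : g a = 0 := apply_eq_zero_of_analyticOrderAt_ne_zero (by rw [hk]; simp)
    have hd : Differentiable ℂ (dslope g a) := by
      rw [← differentiableOn_univ]
      exact (Complex.differentiableOn_dslope univ_mem).2 hg.differentiableOn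
    have heq : g = (fun z => (z - a)) * dslope g a := by
      funext z
      simpa [hga] using (sub_smul_dslope g a z).symm
    have hord : analyticOrderAt (dslope g a) a = k := by
      have h1 : analyticOrderAt g a = analyticOrderAt (fun z : ℂ => z - a) a
          + analyticOrderAt (dslope g a) a := by
        conv_lhs => rw [heq]
        exact analyticOrderAt_mul (by fun_prop) (hd.analyticAt a)
      have h2 : analyticOrderAt (fun z : ℂ => z - a) a = 1 := analyticOrderAt_id_sub_const_self
      rw [hk, h2, add_comm] at h1
      push_cast at h1
      exact (ENat.add_right_injective_of_ne_top ENat.one_ne_top h1).symm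
    obtain ⟨h, h1, h2, h3⟩ := ih hd hord
    refine ⟨h, h1, h2, fun z => ?_⟩
    have := congrFun heq z
    simp only [Pi.mul_apply] at this
    rw [this, h3 z]
    ring

/-- Dividing an entire function by its zeros in a finite set. -/
theorem Differentiable.exists_eq_prod_mul {f : ℂ → ℂ} (hf : Differentiable ℂ f)
    (hord : ∀ a, analyticOrderAt f a ≠ ⊤) (S : Finset ℂ) :
    ∃ g : ℂ → ℂ, Differentiable ℂ g ∧ (∀ a ∈ S, g a ≠ 0) ∧
      ∀ z, f z = (∏ a ∈ S, (z - a) ^ analyticOrderNatAt f a) * g z := by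
  classical
  induction S using Finset.induction_on with
  | empty => exact ⟨f, hf, by simp, by simp⟩
  | insert a S ha ih =>
    obtain ⟨g, hg, hgS, hfg⟩ := ih
    have hP : Differentiable ℂ (fun z => ∏ b ∈ S, (z - b) ^ analyticOrderNatAt f b) := by
      fun_prop
    have hPa : (∏ b ∈ S, (a - b) ^ analyticOrderNatAt f b) ≠ 0 :=
      Finset.prod_ne_zero_iff.2 fun b hb => pow_ne_zero _ (sub_ne_zero.2 fun h => ha (h ▸ hb))
    have h1 : analyticOrderAt f a = analyticOrderAt g a := by
      have : f = (fun z => ∏ b ∈ S, (z - b) ^ analyticOrderNatAt f b) * g := funext hfg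
      conv_lhs => rw [this]
      rw [analyticOrderAt_mul (hP.analyticAt a) (hg.analyticAt a),
        (hP.analyticAt a).analyticOrderAt_eq_zero.2 hPa, zero_add]
    have h2 : analyticOrderAt g a = (analyticOrderNatAt f a : ℕ∞) := by
      rw [← h1, Nat.cast_analyticOrderNatAt (hord a)]
    obtain ⟨h, hh, hha, hgh⟩ := hg.exists_eq_pow_mul a _ h2
    refine ⟨h, hh, fun b hb => ?_, fun z => ?_⟩
    · rcases Finset.mem_insert.1 hb with rfl | hb
      · exact hha
      · intro h0
        exact hgS b hb (by rw [hgh, h0, mul_zero])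
    · rw [hfg z, hgh z, Finset.prod_insert ha]
      ring

theorem Differentiable.finite_zeros_closedBall {f : ℂ → ℂ} (hf : Differentiable ℂ f)
    (hf0 : f 0 ≠ 0) (R : ℝ) : (closedBall (0 : ℂ) R ∩ {a | f a = 0}).Finite := by
  have h : f ⁻¹' {0}ᶜ ∈ codiscrete ℂ :=
    AnalyticOnNhd.preimage_zero_mem_codiscrete (fun z _ => hf.analyticAt z) hf0
  have h2 := mem_codiscrete'.mp h
  have heq : {a | f a = 0} = (f ⁻¹' {0}ᶜ)ᶜ := by ext; simp
  rw [heq]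
  have hcl : IsClosed (f ⁻¹' {0}ᶜ)ᶜ := by simpa using h2.1
  exact ((isCompact_closedBall _ _).inter_right hcl).finite (h2.2.mono Set.inter_subset_right)

theorem Differentiable.analyticOrderAt_ne_top {f : ℂ → ℂ} (hf : Differentiable ℂ f)
    (hf0 : f 0 ≠ 0) (a : ℂ) : analyticOrderAt f a ≠ ⊤ := by
  intro h
  rw [AnalyticOnNhd.analyticOrderAt_eq_top_iff_eq_zero a fun z => hf.analyticAt z] at h
  exact hf0 (by simp [h])

theorem analyticOrderNatAt_neg_of_even {f : ℂ → ℂ} (heven : ∀ z, f (-z) = f z) (a : ℂ) :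
    analyticOrderNatAt f (-a) = analyticOrderNatAt f a := by
  have h : f = f ∘ (fun z => -z) := by funext z; simp [heven]
  unfold analyticOrderNatAt
  conv_rhs => rw [h]
  rw [analyticOrderAt_comp_of_deriv_ne_zero (by fun_prop) (by simp)]

theorem norm_logDeriv_sub_sum_le {f : ℂ → ℂ} (hf : Differentiable ℂ f)
    (heven : ∀ z, f (-z) = f z) (hf0 : f 0 ≠ 0) {R B : ℝ} (hR : 0 < R) (hB : 0 < B)
    {S : Finset ℂ} (hS : ∀ a, a ∈ S ↔ ‖a‖ ≤ R ∧ f a = 0)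
    (hbd : ∀ w ∈ sphere (0 : ℂ) (2 * R), ‖f w‖ ≤ Real.exp B * ‖f 0‖)
    {z : ℂ} (hz : ‖z‖ < R / 4) (hfz : f z ≠ 0) :
    ‖logDeriv f z - ∑ a ∈ S, (analyticOrderNatAt f a : ℂ) / (z - a)‖ ≤ 32 * B * ‖z‖ / R ^ 2 := by
  obtain ⟨g, hg, hgS, hfg⟩ := hf.exists_eq_prod_mul (hf.analyticOrderAt_ne_top hf0) S
  set m := analyticOrderNatAt f with hm
  have hne : ∀ w : ℂ, ‖w‖ ≤ R → g w ≠ 0 := by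
    intro w hw h0
    have : f w = 0 := by rw [hfg, h0, mul_zero]
    exact hgS w ((hS w).2 ⟨hw, this⟩) h0
  have hlog : ∀ w : ℂ, f w ≠ 0 → logDeriv f w = ∑ a ∈ S, (m a : ℂ) / (w - a) + logDeriv g w := by
    intro w hw
    have h1 : ∏ a ∈ S, (w - a) ^ m a ≠ 0 := fun h => hw (by rw [hfg, h, zero_mul])
    have h2 : g w ≠ 0 := fun h => hw (by rw [hfg, h, mul_zero])
    have h3 : f = fun w => (∏ a ∈ S, (w - a) ^ m a) * g w := funext hfg
    have h4 := logDeriv_mul (f := fun w => ∏ a ∈ S, (w - a) ^ m a) (g := g) w h1 h2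
      (by fun_prop) (hg w)
    rw [← h3] at h4
    rw [h4, logDeriv_prod (fun a ha => (Finset.prod_ne_zero_iff.1 h1) a ha) (by fun_prop)]
    congr 1
    refine Finset.sum_congr rfl fun a _ => ?_
    rw [logDeriv_fun_pow (by fun_prop), logDeriv_apply]
    simp [div_eq_mul_inv]
  have hneg : ∑ a ∈ S, (m a : ℂ) / (0 - a) = 0 := by
    have h1 : ∑ a ∈ S, (m a : ℂ) / (0 - a) = ∑ a ∈ S, (m a : ℂ) / (0 - -a) := by
      refine Finset.sum_nbij' (fun a => -a) (fun a => -a) ?_ ?_ ?_ ?_ ?_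
      · intro a ha; rw [hS] at ha ⊢; simpa [heven] using ha
      · intro a ha; rw [hS] at ha ⊢; simpa [heven] using ha
      · simp
      · simp
      · intro a _
        simp [hm, analyticOrderNatAt_neg_of_even heven]
    have h2 : ∑ a ∈ S, (m a : ℂ) / (0 - -a) = -∑ a ∈ S, (m a : ℂ) / (0 - a) := by
      rw [← Finset.sum_neg_distrib]
      refine Finset.sum_congr rfl fun a _ => ?_
      rw [← div_neg]; ring
    have h3 := h1.trans h2
    linear_combination h3 / 2
  have hder0 : deriv f 0 = 0 := by
    have h1 : deriv (fun z => f (-z)) 0 = -deriv f (-0) := deriv_comp_neg f 0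
    rw [show (fun z => f (-z)) = f from funext heven, neg_zero] at h1
    linear_combination h1 / 2
  have hg0 : logDeriv g 0 = 0 := by
    have := hlog 0 hf0
    rw [hneg, zero_add] at this
    rw [← this, logDeriv_apply, hder0, zero_div]
  have hP0 : f 0 = (∏ a ∈ S, (0 - a) ^ m a) * g 0 := hfg 0
  have hP0ne : ∏ a ∈ S, (0 - a) ^ m a ≠ 0 := fun h => hf0 (by rw [hP0, h, zero_mul])
  have hsph : ∀ w ∈ sphere (0 : ℂ) (2 * R), ‖g w‖ ≤ Real.exp B * ‖g 0‖ := by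
    intro w hw
    have hw' : ‖w‖ = 2 * R := by simpa using hw
    have h1 := hbd w hw
    rw [hfg w, hP0, norm_mul, norm_mul] at h1
    have h2 : ‖∏ a ∈ S, (0 - a) ^ m a‖ ≤ ‖∏ a ∈ S, (w - a) ^ m a‖ := by
      rw [norm_prod, norm_prod]
      refine Finset.prod_le_prod (fun _ _ => norm_nonneg _) fun a ha => ?_
      rw [norm_pow, norm_pow]
      refine pow_le_pow_left₀ (norm_nonneg _) ?_ _
      have h3 := ((hS a).1 ha).1
      have h4 := norm_sub_norm_le w a
      simp only [zero_sub, norm_neg]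
      linarith
    have h3 : 0 < ‖∏ a ∈ S, (0 - a) ^ m a‖ := norm_pos_iff.2 hP0ne
    refine le_of_mul_le_mul_left ?_ h3
    calc _ ≤ ‖∏ a ∈ S, (w - a) ^ m a‖ * ‖g w‖ := by gcongr
      _ ≤ _ := h1
      _ = _ := by ring
  have hball : ∀ w ∈ ball (0 : ℂ) R, ‖g w‖ ≤ Real.exp B * ‖g 0‖ := by
    intro w hw
    refine Complex.norm_le_of_forall_mem_frontier_norm_le (U := ball (0 : ℂ) (2 * R))
      isBounded_ball hg.diffContOnCl (fun x hx => hsph x ?_) (subset_closure ?_)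
    · rwa [frontier_ball _ (by positivity)] at hx
    · exact ball_subset_ball (by linarith) hw
  have := norm_logDeriv_le_of_forall_ne_zero hg hR hB
    (fun w hw => hne w (mem_ball_zero_iff.1 hw).le) hball hg0 hz
  rw [hlog z hfz, add_sub_cancel_left]
  exact this

/-- The even entire functions of order at most `3/2` whose zeros lie in the open strip
`|re a| < 1/2`. -/
structure IsXiLike (f : ℂ → ℂ) : Prop where
  diff : Differentiable ℂ f
  even : ∀ z, f (-z) = f z
  zero_ne : f 0 ≠ 0
  growth : ∃ C, ∀ z, ‖f z‖ ≤ Real.exp (C * (1 + ‖z‖) ^ (3 / 2 : ℝ))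
  strip : ∀ a, f a = 0 → |a.re| < 1 / 2

namespace IsXiLike

variable {f : ℂ → ℂ}

/-- The zeros of norm at most `R`, as a finset of the type of zeros. -/
noncomputable def zerosUpTo (h : IsXiLike f) (R : ℝ) : Finset {a : ℂ // f a = 0} :=
  (Set.Finite.preimage (f := Subtype.val) (Subtype.val_injective.injOn)
    (h.diff.finite_zeros_closedBall h.zero_ne R) : {a : {a : ℂ // f a = 0} |
      a.1 ∈ closedBall (0 : ℂ) R ∩ {a | f a = 0}}.Finite).toFinset

theorem mem_zerosUpTo (h : IsXiLike f) {R : ℝ} {a : {a : ℂ // f a = 0}} :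
    a ∈ h.zerosUpTo R ↔ ‖a.1‖ ≤ R := by
  simp [zerosUpTo, a.2]

theorem tendsto_zerosUpTo (h : IsXiLike f) :
    Tendsto (fun n : ℕ => h.zerosUpTo n) atTop atTop := by
  refine tendsto_atTop_finset_of_monotone (fun m n hmn a ha => ?_) fun a => ?_
  · rw [mem_zerosUpTo] at *
    exact ha.trans (by exact_mod_cast hmn)
  · obtain ⟨n, hn⟩ := exists_nat_ge ‖a.1‖
    exact ⟨n, h.mem_zerosUpTo.2 hn⟩

theorem tendsto_growth (C D : ℝ) (x : ℝ) :
    Tendsto (fun n : ℕ => 32 * (C * (1 + 2 * (n : ℝ)) ^ (3 / 2 : ℝ) + D) * x / (n : ℝ) ^ 2)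
      atTop (𝓝 0) := by
  have h1 : Tendsto (fun n : ℕ => ((n : ℝ)) ^ (-(1 / 2) : ℝ)) atTop (𝓝 0) :=
    (tendsto_rpow_neg_atTop (by norm_num)).comp tendsto_natCast_atTop_atTop
  have h2 : Tendsto (fun n : ℕ => ((n : ℝ)) ^ (-2 : ℝ)) atTop (𝓝 0) :=
    (tendsto_rpow_neg_atTop (by norm_num)).comp tendsto_natCast_atTop_atTop
  have h3 : Tendsto (fun n : ℕ => 1 / (n : ℝ)) atTop (𝓝 0) := tendsto_one_div_atTop_nhds_zero_nat
  have h4 : Tendsto (fun n : ℕ => (1 / (n : ℝ) + 2) ^ (3 / 2 : ℝ)) atTop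
      (𝓝 ((0 + 2) ^ (3 / 2 : ℝ))) :=
    (h3.add_const 2).rpow_const (Or.inr (by norm_num))
  have h5 := (((h4.mul h1).const_mul C).add (h2.const_mul D)).const_mul (32 * x)
  simp only [mul_zero, add_zero] at h5
  refine h5.congr' ?_
  filter_upwards [eventually_gt_atTop 0] with n hn
  have hn' : (0 : ℝ) < n := by exact_mod_cast hn
  have e1 : (1 + 2 * (n : ℝ)) = n * (1 / n + 2) := by field_simp
  have e2 : (n : ℝ) ^ (3 / 2 : ℝ) = n ^ (-(1 / 2) : ℝ) * n ^ 2 := by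
    rw [← Real.rpow_natCast, ← Real.rpow_add hn']; norm_num
  have e3 : (n : ℝ) ^ (-2 : ℝ) = ((n : ℝ) ^ 2)⁻¹ := by
    rw [Real.rpow_neg hn'.le]; norm_cast
  rw [e1, Real.mul_rpow hn'.le (by positivity), e2, e3]
  field_simp

theorem tendsto_sum (h : IsXiLike f) {z : ℂ} (hz : f z ≠ 0) :
    Tendsto (fun n : ℕ => ∑ a ∈ h.zerosUpTo n, (analyticOrderNatAt f a : ℂ) / (z - a)) atTop
      (𝓝 (logDeriv f z)) := by
  obtain ⟨C, hC⟩ := h.growth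
  have hev : ∀ᶠ n : ℕ in atTop,
      ‖(∑ a ∈ h.zerosUpTo n, (analyticOrderNatAt f a : ℂ) / (z - a)) - logDeriv f z‖ ≤
        32 * (|C| * (1 + 2 * (n : ℝ)) ^ (3 / 2 : ℝ) + (|Real.log ‖f 0‖| + 1)) * ‖z‖
          / (n : ℝ) ^ 2 := by
    obtain ⟨N, hN⟩ := exists_nat_gt (4 * ‖z‖)
    filter_upwards [eventually_ge_atTop N, eventually_gt_atTop 0] with n hn hn0
    have hnR : (0 : ℝ) < n := by exact_mod_cast hn0
    have hnN : (N : ℝ) ≤ n := by exact_mod_cast hn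
    have hf0 : 0 < ‖f 0‖ := norm_pos_iff.2 h.zero_ne
    have := norm_logDeriv_sub_sum_le h.diff h.even h.zero_ne (R := n)
      (B := |C| * (1 + 2 * (n : ℝ)) ^ (3 / 2 : ℝ) + (|Real.log ‖f 0‖| + 1)) hnR
      (by positivity) (S := (h.zerosUpTo n).map ⟨Subtype.val, Subtype.val_injective⟩)
      (fun a => by
        simp only [Finset.mem_map, mem_zerosUpTo, Function.Embedding.coeFn_mk, Subtype.exists,
          exists_and_left, exists_prop, exists_eq_right_right])
      (fun w hw => by
        have hw' : ‖w‖ = 2 * n := by simpa using hw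
        refine (hC w).trans ?_
        rw [hw']
        have h1 : ‖f 0‖ = Real.exp (Real.log ‖f 0‖) := (Real.exp_log hf0).symm
        rw [h1, ← Real.exp_add, Real.log_exp]
        apply Real.exp_le_exp.2
        have h2 : C * (1 + 2 * (n : ℝ)) ^ (3 / 2 : ℝ) ≤ |C| * (1 + 2 * (n : ℝ)) ^ (3 / 2 : ℝ) := by
          gcongr; exact le_abs_self C
        linarith [neg_abs_le (Real.log ‖f 0‖)])
      (z := z) (by linarith) hz
    rw [Finset.sum_map] at this
    rw [norm_sub_rev]
    exact this
  rw [tendsto_iff_norm_sub_tendsto_zero]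
  exact squeeze_zero' (Eventually.of_forall fun _ => norm_nonneg _) hev (tendsto_growth _ _ _)

theorem re_one_div_sub_nonneg (h : IsXiLike f) {z : ℂ} (hz : 1 / 2 ≤ z.re)
    (a : {a : ℂ // f a = 0}) : 0 ≤ (1 / (z - a)).re := by
  have := abs_lt.1 (h.strip a a.2)
  rw [one_div, Complex.inv_re]
  refine div_nonneg ?_ (Complex.normSq_nonneg _)
  rw [Complex.sub_re]; linarith

theorem sum_le_re_logDeriv (h : IsXiLike f) {z : ℂ} (hz : 1 / 2 ≤ z.re)
    (T : Finset {a : ℂ // f a = 0}) :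
    ∑ a ∈ T, (analyticOrderNatAt f a : ℝ) * (1 / (z - a)).re ≤ (logDeriv f z).re := by
  have hfz : f z ≠ 0 := fun h0 => by
    have := abs_lt.1 (h.strip z h0); linarith
  have h1 := (Complex.continuous_re.tendsto _).comp (h.tendsto_sum hfz)
  refine ge_of_tendsto h1 ?_
  filter_upwards [h.tendsto_zerosUpTo.eventually (eventually_ge_atTop T)] with n hn
  simp only [Function.comp_apply, Complex.re_sum]
  refine (Finset.sum_le_sum_of_subset_of_nonneg hn fun a _ _ => ?_).trans (le_of_eq ?_)
  · exact mul_nonneg (Nat.cast_nonneg _) (h.re_one_div_sub_nonneg hz a)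
  · refine Finset.sum_congr rfl fun a _ => ?_
    rw [div_eq_mul_one_div (analyticOrderNatAt f a : ℂ), ← Complex.ofReal_natCast,
      Complex.re_ofReal_mul]

/-- The involution `a ↦ -a` on zeros. -/
def negZero (h : IsXiLike f) : {a : ℂ // f a = 0} ≃ {a : ℂ // f a = 0} where
  toFun a := ⟨-a.1, by rw [h.even, a.2]⟩
  invFun a := ⟨-a.1, by rw [h.even, a.2]⟩
  left_inv a := by simp
  right_inv a := by simp

theorem sum_zerosUpTo_eq (h : IsXiLike f) {z : ℂ} (hz : f z ≠ 0) (R : ℝ) :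
    ∑ a ∈ h.zerosUpTo R, (analyticOrderNatAt f a : ℂ) / (z - a) =
      ∑ a ∈ h.zerosUpTo R, (analyticOrderNatAt f a : ℂ) * (z / (z ^ 2 - a ^ 2)) := by
  have h1 : ∑ a ∈ h.zerosUpTo R, (analyticOrderNatAt f a : ℂ) / (z - a) =
      ∑ a ∈ h.zerosUpTo R, (analyticOrderNatAt f a : ℂ) / (z + a) := by
    refine Finset.sum_equiv h.negZero (fun a => ?_) fun a _ => ?_
    · simp [mem_zerosUpTo, negZero]
    · simp [negZero, analyticOrderNatAt_neg_of_even h.even, sub_eq_add_neg]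
  have h2 : ∑ a ∈ h.zerosUpTo R, (analyticOrderNatAt f a : ℂ) / (z - a) =
      (∑ a ∈ h.zerosUpTo R, (analyticOrderNatAt f a : ℂ) / (z - a) +
      ∑ a ∈ h.zerosUpTo R, (analyticOrderNatAt f a : ℂ) / (z + a)) / 2 := by
    rw [← h1]; ring
  rw [h2, ← Finset.sum_add_distrib, Finset.sum_div]
  refine Finset.sum_congr rfl fun a _ => ?_
  have e1 : z - a ≠ 0 := fun e => hz (by rw [sub_eq_zero.1 e, a.2])
  have e2 : z + a ≠ 0 := fun e => hz (by rw [eq_neg_of_add_eq_zero_left e, h.even, a.2])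
  have e3 : z ^ 2 - (a : ℂ) ^ 2 ≠ 0 := by
    rw [sq_sub_sq]; exact mul_ne_zero e2 e1
  field_simp
  ring

/-- A lower bound for the symmetrised contribution of a zero at real points. -/
theorem div_le_re {v : ℝ} (hv : 1 / 2 ≤ v) {a : ℂ} (ha : |a.re| < 1 / 2) :
    v / (v ^ 2 + a.im ^ 2 + 3 / 4) ≤ ((v : ℂ) / ((v : ℂ) ^ 2 - a ^ 2)).re := by
  have hb := abs_lt.1 ha
  set b := a.re
  set g := a.im
  have hb2 : b ^ 2 ≤ 1 / 4 := by nlinarith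
  have hv2 : 1 / 4 ≤ v ^ 2 := by nlinarith
  have hre : ((v : ℂ) ^ 2 - a ^ 2).re = v ^ 2 - b ^ 2 + g ^ 2 := by
    simp [pow_two, b, g]; ring
  have him : ((v : ℂ) ^ 2 - a ^ 2).im = -(2 * b * g) := by
    simp [pow_two, b, g]; ring
  rw [div_eq_mul_inv v, div_eq_mul_inv (v : ℂ), Complex.re_ofReal_mul, Complex.inv_re]
  refine mul_le_mul_of_nonneg_left ?_ (by linarith)
  rw [Complex.normSq_apply, hre, him]
  have hvb : b ^ 2 < v ^ 2 := by nlinarith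
  have hpos : 0 < v ^ 2 - b ^ 2 + g ^ 2 := by nlinarith [sq_nonneg g]
  rw [inv_eq_one_div, div_le_div_iff₀ (by positivity) (by nlinarith [sq_nonneg (2 * b * g)])]
  nlinarith [mul_nonneg (sub_nonneg.2 hb2) (sq_nonneg g),
    mul_nonneg (sub_pos.2 hvb).le (by positivity : (0 : ℝ) ≤ 3 / 4 + b ^ 2)]

theorem sum_div_le (h : IsXiLike f) {v : ℝ} (hv : 1 / 2 ≤ v) (T : Finset {a : ℂ // f a = 0}) :
    ∑ a ∈ T, (analyticOrderNatAt f a : ℝ) * (v / (v ^ 2 + a.1.im ^ 2 + 3 / 4)) ≤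
      (logDeriv f v).re := by
  have hfz : f v ≠ 0 := fun h0 => by
    have := abs_lt.1 (h.strip v h0); simp at this; linarith
  have h1 := (Complex.continuous_re.tendsto _).comp (h.tendsto_sum hfz)
  simp_rw [h.sum_zerosUpTo_eq hfz] at h1
  refine ge_of_tendsto h1 ?_
  filter_upwards [h.tendsto_zerosUpTo.eventually (eventually_ge_atTop T)] with n hn
  simp only [Function.comp_apply, Complex.re_sum]
  refine (Finset.sum_le_sum_of_subset_of_nonneg hn fun a _ _ => by positivity).trans
    (Finset.sum_le_sum fun a _ => ?_)
  rw [← Complex.ofReal_natCast, Complex.re_ofReal_mul]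
  exact mul_le_mul_of_nonneg_left (div_le_re hv (h.strip a a.2)) (Nat.cast_nonneg _)

theorem summable_order_div (h : IsXiLike f) :
    Summable fun a : {a : ℂ // f a = 0} => (analyticOrderNatAt f a : ℝ) / (a.1.im ^ 2 + 1) := by
  refine summable_of_sum_le (c := 2 * (logDeriv f (1 / 2 : ℝ)).re) (fun a => by positivity)
    fun T => ?_
  have := h.sum_div_le (v := 1 / 2) le_rfl T
  have h2 : ∑ a ∈ T, (analyticOrderNatAt f a : ℝ) / (a.1.im ^ 2 + 1) =
      2 * ∑ a ∈ T, (analyticOrderNatAt f a : ℝ) * ((1 / 2) / ((1 / 2) ^ 2 + a.1.im ^ 2 + 3 / 4)) := by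
    rw [Finset.mul_sum]
    refine Finset.sum_congr rfl fun a _ => ?_
    rw [show (1 / 2 : ℝ) ^ 2 + a.1.im ^ 2 + 3 / 4 = a.1.im ^ 2 + 1 by ring]
    ring
  rw [h2]
  linarith

theorem summable_norm_logDeriv (h : IsXiLike f) (z : ℂ) :
    Summable fun a : {a : ℂ // f a = 0} =>
      ‖(analyticOrderNatAt f a : ℂ) * (z / (z ^ 2 - a ^ 2))‖ := by
  refine Summable.of_norm_bounded_eventually (h.summable_order_div.mul_left (4 * ‖z‖)) ?_
  refine Set.Finite.subset (h.zerosUpTo (2 * ‖z‖ + 2)).finite_toSet fun a ha => ?_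
  rw [Finset.mem_coe, mem_zerosUpTo]
  by_contra! hlt
  refine ha ?_
  have hb := abs_lt.1 (h.strip a a.2)
  have h1 : ‖a.1‖ ^ 2 = a.1.re ^ 2 + a.1.im ^ 2 := by
    rw [Complex.sq_norm, Complex.normSq_apply]; ring
  have h2 : ‖a.1‖ ^ 2 - ‖z‖ ^ 2 ≤ ‖z ^ 2 - a.1 ^ 2‖ := by
    have := norm_sub_norm_le (a.1 ^ 2) (z ^ 2)
    rwa [norm_pow, norm_pow, norm_sub_rev] at this
  have hz0 := norm_nonneg z
  have h3 : (a.1.im ^ 2 + 1) / 4 ≤ ‖z ^ 2 - a.1 ^ 2‖ := by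
    refine le_trans ?_ h2
    nlinarith
  rw [Set.mem_ofPred_eq, norm_norm, norm_mul, norm_div, Complex.norm_natCast]
  have h4 : ‖z‖ / ‖z ^ 2 - a.1 ^ 2‖ ≤ ‖z‖ / ((a.1.im ^ 2 + 1) / 4) := by gcongr
  calc _ ≤ (analyticOrderNatAt f a : ℝ) * (‖z‖ / ((a.1.im ^ 2 + 1) / 4)) := by gcongr
    _ = _ := by field_simp

theorem hasSum_logDeriv (h : IsXiLike f) {z : ℂ} (hz : f z ≠ 0) :
    HasSum (fun a : {a : ℂ // f a = 0} => (analyticOrderNatAt f a : ℂ) * (z / (z ^ 2 - a ^ 2)))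
      (logDeriv f z) := by
  have h1 := (h.summable_norm_logDeriv z).of_norm.hasSum
  have h2 := h1.comp h.tendsto_zerosUpTo
  have h3 := h.tendsto_sum hz
  simp_rw [h.sum_zerosUpTo_eq hz] at h3
  exact tendsto_nhds_unique h2 h3 ▸ h1

theorem countable_zeros (h : IsXiLike f) : Countable {a : ℂ // f a = 0} := by
  have : (⋃ n : ℕ, closedBall (0 : ℂ) n ∩ {a | f a = 0}).Countable :=
    countable_iUnion fun n => (h.diff.finite_zeros_closedBall h.zero_ne n).countable
  refine (this.mono fun a ha => ?_).to_subtype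
  obtain ⟨n, hn⟩ := exists_nat_ge ‖a‖
  exact mem_iUnion.2 ⟨n, by simpa using hn, ha⟩

end IsXiLike

section MellinPair

open MeasureTheory HurwitzZeta

/-- The nonnegative kernel whose Mellin transform is the entire completed zeta function. -/
noncomputable def xiKernel (x : ℝ) : ℝ :=
  (Ioi 1).indicator (fun x => evenKernel 0 x - 1) x +
    (Ioo 0 1).indicator (fun x => evenKernel 0 x - x ^ (-(1 / 2) : ℝ)) x

theorem one_le_evenKernel_zero {x : ℝ} (hx : 0 < x) : 1 ≤ evenKernel 0 x := by
  have h := hasSum_int_evenKernel 0 hx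
  have h1 := le_hasSum h 0 (fun n _ => (Real.exp_pos _).le)
  simpa using h1

theorem xiKernel_nonneg (x : ℝ) : 0 ≤ xiKernel x := by
  refine add_nonneg (indicator_nonneg (fun x hx => ?_) x) (indicator_nonneg (fun x hx => ?_) x)
  · linarith [one_le_evenKernel_zero (zero_lt_one.trans hx)]
  · have h1 := evenKernel_functional_equation 0 x
    rw [← evenKernel_eq_cosKernel_of_zero] at h1
    have h2 := one_le_evenKernel_zero (one_div_pos.2 hx.1)
    rw [h1, Real.rpow_neg hx.1.le, one_div (x ^ (1 / 2 : ℝ))]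
    have h3 : 0 < (x ^ (1 / 2 : ℝ))⁻¹ := inv_pos.2 (Real.rpow_pos_of_pos hx.1 _)
    nlinarith

theorem f_modif_eq_xiKernel :
    (hurwitzEvenFEPair 0).f_modif = fun x => (xiKernel x : ℂ) := by
  funext x
  simp only [WeakFEPair.f_modif, xiKernel, hurwitzEvenFEPair, Pi.add_apply, indicator, ite_true,
    Function.comp_apply]
  split_ifs <;> simp

theorem hasMellin_xiKernel (s : ℂ) :
    HasMellin (fun x => (xiKernel x : ℂ)) (s / 2) (2 * completedRiemannZeta₀ s) := by
  have h := (hurwitzEvenFEPair 0).isStrongFEPair_toStrongFEPair.hasMellin (s / 2)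
  have h2 : (hurwitzEvenFEPair 0).toStrongFEPair.f = fun x => (xiKernel x : ℂ) :=
    f_modif_eq_xiKernel
  rw [h2] at h
  refine ⟨h.1, ?_⟩
  simp only [completedRiemannZeta₀, completedHurwitzZetaEven₀, WeakFEPair.Λ₀, f_modif_eq_xiKernel]
  ring

theorem integrableOn_xiKernel (a : ℝ) :
    IntegrableOn (fun t : ℝ => t ^ (a / 2 - 1) * xiKernel t) (Ioi 0) := by
  have h := (hasMellin_xiKernel a).1
  refine IntegrableOn.congr_fun h.norm (fun t ht => ?_) measurableSet_Ioi
  have ht' : (0 : ℝ) < t := ht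
  simp only [smul_eq_mul, norm_mul]
  rw [Complex.norm_cpow_eq_rpow_re_of_pos ht', Complex.norm_of_nonneg (xiKernel_nonneg t)]
  simp

theorem integral_xiKernel (a : ℝ) :
    ((∫ t in Ioi (0 : ℝ), t ^ (a / 2 - 1) * xiKernel t : ℝ) : ℂ) =
      2 * completedRiemannZeta₀ a := by
  rw [← (hasMellin_xiKernel a).2, mellin, ← integral_complex_ofReal]
  refine setIntegral_congr_fun measurableSet_Ioi fun t ht => ?_
  have ht' : (0 : ℝ) < t := ht
  simp only [smul_eq_mul]
  push_cast
  rw [Complex.ofReal_cpow ht'.le]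
  push_cast
  rfl

/-- The entire completed zeta function is real and nonnegative on the real line. -/
theorem completedRiemannZeta₀_ofReal (a : ℝ) :
    ((completedRiemannZeta₀ a).re : ℂ) = completedRiemannZeta₀ a ∧
      0 ≤ (completedRiemannZeta₀ a).re := by
  have h := integral_xiKernel a
  have h1 : completedRiemannZeta₀ a =
      (((∫ t in Ioi (0 : ℝ), t ^ (a / 2 - 1) * xiKernel t) / 2 : ℝ) : ℂ) := by
    push_cast
    rw [h]; ring
  rw [h1]
  refine ⟨by simp, ?_⟩
  rw [Complex.ofReal_re]
  refine div_nonneg (setIntegral_nonneg measurableSet_Ioi fun t ht => ?_) (by norm_num)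
  exact mul_nonneg (Real.rpow_nonneg (le_of_lt ht) _) (xiKernel_nonneg t)

theorem norm_completedRiemannZeta₀_le {a b θ : ℝ} (h0 : 0 ≤ θ) (h1 : θ ≤ 1) {s : ℂ}
    (hs : s.re = (1 - θ) * a + θ * b) :
    ‖completedRiemannZeta₀ s‖ ≤
      (1 - θ) * (completedRiemannZeta₀ a).re + θ * (completedRiemannZeta₀ b).re := by
  have key : ∀ c : ℝ, 2 * (completedRiemannZeta₀ c).re =
      ∫ t in Ioi (0 : ℝ), t ^ (c / 2 - 1) * xiKernel t := by
    intro c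
    have := congrArg Complex.re (integral_xiKernel c)
    rw [Complex.ofReal_re] at this
    rw [this]; simp
  have hnorm : 2 * ‖completedRiemannZeta₀ s‖ ≤
      ∫ t in Ioi (0 : ℝ), t ^ (s.re / 2 - 1) * xiKernel t := by
    have h2 : ‖(2 : ℂ) * completedRiemannZeta₀ s‖ = 2 * ‖completedRiemannZeta₀ s‖ := by simp
    rw [← h2, ← (hasMellin_xiKernel s).2, mellin]
    refine (norm_integral_le_integral_norm _).trans (le_of_eq ?_)
    refine setIntegral_congr_fun measurableSet_Ioi fun t ht => ?_
    have ht' : (0 : ℝ) < t := ht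
    simp only [smul_eq_mul, norm_mul]
    rw [Complex.norm_cpow_eq_rpow_re_of_pos ht', Complex.norm_of_nonneg (xiKernel_nonneg t)]
    simp
  have hmono : ∫ t in Ioi (0 : ℝ), t ^ (s.re / 2 - 1) * xiKernel t ≤
      ∫ t in Ioi (0 : ℝ), ((1 - θ) * (t ^ (a / 2 - 1) * xiKernel t) +
        θ * (t ^ (b / 2 - 1) * xiKernel t)) := by
    refine setIntegral_mono_on (integrableOn_xiKernel _)
      (((integrableOn_xiKernel _).const_mul _).add ((integrableOn_xiKernel _).const_mul _))
      measurableSet_Ioi fun t ht => ?_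
    have ht' : (0 : ℝ) < t := ht
    have hc := (convexOn_rpow_left ht').2 (mem_univ (a / 2 - 1)) (mem_univ (b / 2 - 1))
      (sub_nonneg.2 h1) h0 (by ring)
    simp only [smul_eq_mul] at hc
    rw [show (1 - θ) * (a / 2 - 1) + θ * (b / 2 - 1) = s.re / 2 - 1 by rw [hs]; ring] at hc
    nlinarith [xiKernel_nonneg t, mul_le_mul_of_nonneg_right hc (xiKernel_nonneg t)]
  rw [integral_add ((integrableOn_xiKernel _).const_mul _)
    ((integrableOn_xiKernel _).const_mul _), integral_const_mul, integral_const_mul,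
    ← key a, ← key b] at hmono
  linarith

end MellinPair

/-- Riemann's entire function `ξ(s) = s (s - 1) Λ(s)`, centred at `s = 1/2`. -/
noncomputable def xi (z : ℂ) : ℂ := (z ^ 2 - 1 / 4) * completedRiemannZeta₀ (1 / 2 + z) + 1

theorem differentiable_xi : Differentiable ℂ xi := by
  unfold xi
  have h : Differentiable ℂ fun z : ℂ => completedRiemannZeta₀ (1 / 2 + z) :=
    differentiable_completedZeta₀.comp (by fun_prop)
  fun_prop

theorem xi_neg (z : ℂ) : xi (-z) = xi z := by
  unfold xi
  rw [← completedRiemannZeta₀_one_sub (1 / 2 + -z)]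
  ring_nf

theorem xi_half : xi (1 / 2) = 1 := by
  unfold xi; norm_num

theorem xi_eq_completedRiemannZeta {s : ℂ} (h0 : s ≠ 0) (h1 : s ≠ 1) :
    xi (s - 1 / 2) = s * (s - 1) * completedRiemannZeta s := by
  have h2 : 1 - s ≠ 0 := sub_ne_zero.2 h1.symm
  rw [xi, completedRiemannZeta_eq]
  rw [show (1 : ℂ) / 2 + (s - 1 / 2) = s by ring]
  field_simp
  ring

theorem xi_ne_zero_of_half_le_re {z : ℂ} (hz : 1 / 2 ≤ z.re) : xi z ≠ 0 := by
  by_cases h : z = 1 / 2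
  · rw [h, xi_half]; exact one_ne_zero
  · have hre : 1 ≤ (z + 1 / 2).re := by
      simp only [Complex.add_re]; norm_num; linarith
    have h0 : z + 1 / 2 ≠ 0 := fun h0 => by rw [h0] at hre; simp at hre; linarith
    have h1 : z + 1 / 2 ≠ 1 := fun h1 => h (by linear_combination h1)
    have h2 := xi_eq_completedRiemannZeta h0 h1
    rw [add_sub_cancel_right] at h2
    rw [h2]
    have h3 := riemannZeta_ne_zero_of_one_le_re hre
    rw [riemannZeta_def_of_ne_zero h0] at h3
    exact mul_ne_zero (mul_ne_zero h0 (sub_ne_zero.2 h1)) (div_ne_zero_iff.1 h3).1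

theorem completedRiemannZeta₀_zero_eq_one : completedRiemannZeta₀ 0 = completedRiemannZeta₀ 1 := by
  rw [← completedRiemannZeta₀_one_sub]; simp

theorem completedRiemannZeta₀_one_re :
    (completedRiemannZeta₀ 1).re
      = (Real.eulerMascheroniConstant - Real.log (4 * Real.pi)) / 2 + 1 := by
  have h : completedRiemannZeta₀ 1 =
      (((Real.eulerMascheroniConstant - Real.log (4 * Real.pi)) / 2 + 1 : ℝ) : ℂ) := by
    rw [completedRiemannZeta₀_one]
    push_cast
    rw [Complex.ofReal_log (by positivity)]
    push_cast
    rfl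
  rw [h, Complex.ofReal_re]

theorem norm_completedRiemannZeta₀_le_one {s : ℂ} (h0 : 0 ≤ s.re) (h1 : s.re ≤ 1) :
    ‖completedRiemannZeta₀ s‖ ≤ (completedRiemannZeta₀ 1).re := by
  have := norm_completedRiemannZeta₀_le (a := 0) (b := 1) (θ := s.re) h0 h1 (s := s) (by ring)
  simp only [Complex.ofReal_zero, Complex.ofReal_one, completedRiemannZeta₀_zero_eq_one] at this
  linarith

theorem xi_zero_ne : xi 0 ≠ 0 := by
  intro h
  have h1 := norm_completedRiemannZeta₀_le_one (s := 1 / 2) (by norm_num) (by norm_num)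
  rw [completedRiemannZeta₀_one_re] at h1
  have h2 := Real.eulerMascheroniConstant_lt_two_thirds
  have h3 : 0 ≤ Real.log (4 * Real.pi) := Real.log_nonneg (by linarith [Real.pi_gt_three])
  have h4 : completedRiemannZeta₀ (1 / 2) = 4 := by
    unfold xi at h
    rw [add_zero] at h
    linear_combination -4 * h
  rw [h4] at h1
  norm_num at h1
  linarith

theorem exists_norm_completedRiemannZeta₀_le :
    ∃ A : ℝ, 0 ≤ A ∧ ∀ (k : ℕ) (s : ℂ), 1 ≤ k → 0 ≤ s.re → s.re ≤ 2 * k →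
      ‖completedRiemannZeta₀ s‖ ≤ A * (k.factorial + 1) := by
  refine ⟨(completedRiemannZeta₀ 1).re + 2 + ∑' n : ℕ, 1 / (n : ℝ) ^ 2, ?_, fun k s hk h0 h1 => ?_⟩
  · have := (completedRiemannZeta₀_ofReal 1).2
    rw [Complex.ofReal_one] at this
    have h2 : 0 ≤ ∑' n : ℕ, 1 / (n : ℝ) ^ 2 := tsum_nonneg fun n => by positivity
    linarith
  have hk' : (1 : ℝ) ≤ k := by exact_mod_cast hk
  have h2 := norm_completedRiemannZeta₀_le (a := 0) (b := 2 * k) (θ := s.re / (2 * k))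
    (by positivity) ((div_le_one (by positivity)).2 h1) (s := s) (by field_simp; ring)
  have hA0 := (completedRiemannZeta₀_ofReal 1).2
  simp only [Complex.ofReal_zero, Complex.ofReal_one, completedRiemannZeta₀_zero_eq_one] at h2 hA0
  have hk0 := (completedRiemannZeta₀_ofReal (2 * k)).2
  have hle : ‖completedRiemannZeta₀ s‖ ≤
      (completedRiemannZeta₀ 1).re + (completedRiemannZeta₀ (2 * k : ℝ)).re := by
    have e1 : 0 ≤ s.re / (2 * k) := by positivity
    have e2 : s.re / (2 * k) ≤ 1 := (div_le_one (by positivity)).2 h1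
    nlinarith
  have hS : Summable fun n : ℕ => 1 / (n : ℝ) ^ 2 := Real.summable_one_div_nat_pow.2 (by norm_num)
  have hzeta : ‖riemannZeta ((2 * k : ℝ) : ℂ)‖ ≤ ∑' n : ℕ, 1 / (n : ℝ) ^ 2 := by
    rw [zeta_eq_tsum_one_div_nat_cpow (by rw [Complex.ofReal_re]; linarith)]
    refine tsum_of_norm_bounded hS.hasSum fun n => ?_
    rcases Nat.eq_zero_or_pos n with rfl | hn
    · rw [Nat.cast_zero, Complex.zero_cpow (by
        exact_mod_cast (by positivity : (2 * (k : ℝ)) ≠ 0))]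
      simp
    · rw [norm_div, norm_one, Complex.norm_natCast_cpow_of_pos hn, Complex.ofReal_re]
      have hn' : (1 : ℝ) ≤ n := by exact_mod_cast hn
      have : (n : ℝ) ^ 2 ≤ (n : ℝ) ^ (2 * k : ℝ) := by
        rw [← Real.rpow_natCast]
        exact Real.rpow_le_rpow_of_exponent_le hn' (by push_cast; linarith)
      gcongr
  have hne0 : ((2 * k : ℝ) : ℂ) ≠ 0 := by exact_mod_cast (by positivity : (2 * (k : ℝ)) ≠ 0)
  have hGne : Gammaℝ ((2 * k : ℝ) : ℂ) ≠ 0 :=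
    Gammaℝ_ne_zero_of_re_pos (by rw [Complex.ofReal_re]; positivity)
  have hL : completedRiemannZeta₀ ((2 * k : ℝ) : ℂ) = riemannZeta ((2 * k : ℝ) : ℂ) *
      Gammaℝ ((2 * k : ℝ) : ℂ) + 1 / ((2 * k : ℝ) : ℂ) + 1 / (1 - ((2 * k : ℝ) : ℂ)) := by
    rw [riemannZeta_def_of_ne_zero hne0, div_mul_cancel₀ _ hGne, completedRiemannZeta_eq]
    ring
  have hGamma : ‖Gammaℝ ((2 * k : ℝ) : ℂ)‖ ≤ k.factorial := by
    rw [Gammaℝ_def, norm_mul]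
    have e1 : ‖(Real.pi : ℂ) ^ (-((2 * k : ℝ) : ℂ) / 2)‖ ≤ 1 := by
      rw [Complex.norm_cpow_eq_rpow_re_of_pos Real.pi_pos]
      refine Real.rpow_le_one_of_one_le_of_nonpos (by linarith [Real.pi_gt_three]) ?_
      rw [show (-((2 * k : ℝ) : ℂ) / 2) = ((-(k : ℝ) : ℝ) : ℂ) by push_cast; ring,
        Complex.ofReal_re]
      linarith
    have e2 : Complex.Gamma (((2 * k : ℝ) : ℂ) / 2) = ((k - 1).factorial : ℂ) := by
      rw [← Complex.Gamma_nat_eq_factorial]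
      congr 1
      push_cast [Nat.cast_sub hk]
      ring
    rw [e2, Complex.norm_natCast]
    calc _ ≤ 1 * ((k - 1).factorial : ℝ) := by gcongr
      _ ≤ k.factorial := by
        rw [one_mul]; exact_mod_cast Nat.factorial_le (Nat.sub_le k 1)
  have hnorm : (completedRiemannZeta₀ ((2 * k : ℝ) : ℂ)).re ≤
      (∑' n : ℕ, 1 / (n : ℝ) ^ 2) * k.factorial + 1 + 1 := by
    refine (Complex.re_le_norm _).trans ?_
    rw [hL]
    refine (norm_add_le _ _).trans (add_le_add ((norm_add_le _ _).trans (add_le_add ?_ ?_)) ?_)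
    · rw [norm_mul]; gcongr
    · rw [norm_div, norm_one, Complex.norm_of_nonneg (by positivity), div_le_one (by positivity)]
      linarith
    · rw [norm_div, norm_one]
      have : (1 : ℝ) ≤ ‖1 - ((2 * k : ℝ) : ℂ)‖ := by
        rw [norm_sub_rev]
        rw [show ((2 * k : ℝ) : ℂ) - 1 = ((2 * k - 1 : ℝ) : ℂ) by push_cast; ring,
          Complex.norm_of_nonneg (by linarith)]
        linarith
      rw [div_le_one (by linarith)]
      exact this
  have hZ : 0 ≤ ∑' n : ℕ, 1 / (n : ℝ) ^ 2 := tsum_nonneg fun n => by positivity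
  have hfac : (0 : ℝ) ≤ k.factorial := by positivity
  nlinarith

theorem factorial_le_exp (k : ℕ) : (k.factorial : ℝ) ≤ Real.exp (2 * (k : ℝ) ^ (3 / 2 : ℝ)) := by
  rcases Nat.eq_zero_or_pos k with rfl | hk
  · simp
  have hk' : (0 : ℝ) < k := by exact_mod_cast hk
  have h1 : (k.factorial : ℝ) ≤ (k : ℝ) ^ k := by exact_mod_cast Nat.factorial_le_pow k
  refine h1.trans ?_
  rw [← Real.log_le_iff_le_exp (by positivity), Real.log_pow]
  have h2 := Real.log_le_rpow_div hk'.le (ε := 1 / 2) (by norm_num)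
  have h3 : (k : ℝ) ^ (3 / 2 : ℝ) = k * (k : ℝ) ^ (1 / 2 : ℝ) := by
    conv_rhs => rw [← Real.rpow_one_add' hk'.le (by norm_num)]
    norm_num
  rw [h3]
  calc (k : ℝ) * Real.log k ≤ k * ((k : ℝ) ^ (1 / 2 : ℝ) / (1 / 2)) := by gcongr
    _ = _ := by ring

theorem xi_growth : ∃ C, ∀ z, ‖xi z‖ ≤ Real.exp (C * (1 + ‖z‖) ^ (3 / 2 : ℝ)) := by
  obtain ⟨A, hA0, hA⟩ := exists_norm_completedRiemannZeta₀_le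
  have main : ∀ z : ℂ, 0 ≤ z.re →
      ‖xi z‖ ≤ Real.exp ((2 * A + 10) * (1 + ‖z‖) ^ (3 / 2 : ℝ)) := by
    intro z hz
    set y := 1 + ‖z‖ with hy
    have hy1 : 1 ≤ y := by linarith [norm_nonneg z]
    have hyr : y ≤ y ^ (3 / 2 : ℝ) := by
      conv_lhs => rw [← Real.rpow_one y]
      exact Real.rpow_le_rpow_of_exponent_le hy1 (by norm_num)
    set k := ⌈‖z‖⌉₊ + 1 with hk
    have hkz : ‖z‖ ≤ (⌈‖z‖⌉₊ : ℝ) := Nat.le_ceil _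
    have hk2 : (k : ℝ) ≤ 2 * y := by
      have := Nat.ceil_lt_add_one (norm_nonneg z)
      rw [hk]; push_cast; linarith [norm_nonneg z]
    have hre : (1 / 2 + z).re = 1 / 2 + z.re := by simp
    have hzn : z.re ≤ ‖z‖ := Complex.re_le_norm z
    have h1 := hA k (1 / 2 + z) (by omega) (by rw [hre]; linarith)
      (by rw [hre, hk]; push_cast; linarith)
    have hfac : (k.factorial : ℝ) ≤ Real.exp (6 * y ^ (3 / 2 : ℝ)) := by
      refine (factorial_le_exp k).trans (Real.exp_le_exp.2 ?_)
      have e1 : (k : ℝ) ^ (3 / 2 : ℝ) ≤ (2 * y) ^ (3 / 2 : ℝ) := by gcongr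
      rw [Real.mul_rpow (by norm_num) (by linarith)] at e1
      have e2 : (2 : ℝ) ^ (3 / 2 : ℝ) ≤ 3 := by
        have : ((2 : ℝ) ^ (3 / 2 : ℝ)) ^ 2 = 8 := by
          rw [← Real.rpow_natCast, ← Real.rpow_mul (by norm_num)]; norm_num
        nlinarith [Real.rpow_nonneg (by norm_num : (0 : ℝ) ≤ 2) (3 / 2 : ℝ)]
      have e3 : (2 : ℝ) ^ (3 / 2 : ℝ) * y ^ (3 / 2 : ℝ) ≤ 3 * y ^ (3 / 2 : ℝ) := by gcongr
      linarith
    have hexp1 : 1 ≤ Real.exp (6 * y ^ (3 / 2 : ℝ)) := Real.one_le_exp (by positivity)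
    have hxi : ‖xi z‖ ≤ y ^ 2 * (2 * A + 1) * Real.exp (6 * y ^ (3 / 2 : ℝ)) := by
      have e1 : ‖z ^ 2 - 1 / 4‖ ≤ y ^ 2 := by
        refine (norm_sub_le _ _).trans ?_
        rw [norm_pow, hy]
        norm_num
        nlinarith [norm_nonneg z]
      calc ‖xi z‖ ≤ ‖z ^ 2 - 1 / 4‖ * ‖completedRiemannZeta₀ (1 / 2 + z)‖ + 1 := by
            unfold xi
            refine (norm_add_le _ _).trans ?_
            rw [norm_mul, norm_one]
        _ ≤ y ^ 2 * (A * (k.factorial + 1)) + 1 := by gcongr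
        _ ≤ y ^ 2 * (A * (Real.exp (6 * y ^ (3 / 2 : ℝ)) + Real.exp (6 * y ^ (3 / 2 : ℝ))))
            + y ^ 2 * Real.exp (6 * y ^ (3 / 2 : ℝ)) := by
            have : 1 ≤ y ^ 2 := by nlinarith
            have h5 : 1 ≤ y ^ 2 * Real.exp (6 * y ^ (3 / 2 : ℝ)) := by nlinarith
            gcongr
        _ = _ := by ring
    refine hxi.trans ?_
    have e1 : y ^ 2 ≤ Real.exp (2 * y ^ (3 / 2 : ℝ)) := by
      have : y ≤ Real.exp (y ^ (3 / 2 : ℝ)) := by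
        have := Real.add_one_le_exp (y ^ (3 / 2 : ℝ)); linarith
      calc y ^ 2 ≤ (Real.exp (y ^ (3 / 2 : ℝ))) ^ 2 := by gcongr
        _ = _ := by rw [← Real.exp_nat_mul]; norm_num
    have e2 : 2 * A + 1 ≤ Real.exp ((2 * A + 2) * y ^ (3 / 2 : ℝ)) := by
      have := Real.add_one_le_exp ((2 * A + 2) * y ^ (3 / 2 : ℝ))
      nlinarith
    calc _ ≤ Real.exp (2 * y ^ (3 / 2 : ℝ)) * Real.exp ((2 * A + 2) * y ^ (3 / 2 : ℝ)) *
          Real.exp (6 * y ^ (3 / 2 : ℝ)) := by gcongr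
      _ = _ := by
        rw [← Real.exp_add, ← Real.exp_add]
        congr 1
        ring
  refine ⟨2 * A + 10, fun z => ?_⟩
  rcases le_total 0 z.re with hz | hz
  · exact main z hz
  · have := main (-z) (by simpa using hz)
    rwa [xi_neg, norm_neg] at this

theorem isXiLike_xi : IsXiLike xi where
  diff := differentiable_xi
  even := xi_neg
  zero_ne := xi_zero_ne
  growth := xi_growth
  strip a ha := by
    by_contra! h
    rcases le_abs.1 h with h | h
    · exact xi_ne_zero_of_half_le_re h ha
    · exact xi_ne_zero_of_half_le_re (z := -a) (by simpa using h) (by rw [xi_neg, ha])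

theorem logDeriv_xi_half : logDeriv xi (1 / 2) = completedRiemannZeta₀ 1 := by
  have h1 : HasDerivAt (fun z : ℂ => completedRiemannZeta₀ (1 / 2 + z))
      (deriv completedRiemannZeta₀ (1 / 2 + 1 / 2)) (1 / 2) :=
    HasDerivAt.comp_const_add _ _ (differentiable_completedZeta₀ _).hasDerivAt
  have h2 : HasDerivAt (fun z : ℂ => z ^ 2 - 1 / 4) (2 * (1 / 2)) (1 / 2) := by
    simpa using (hasDerivAt_pow 2 (1 / 2 : ℂ)).sub_const (1 / 4)
  have h3 := (h2.mul h1).add_const 1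
  rw [logDeriv_apply, xi_half, div_one]
  have h4 : deriv xi (1 / 2) = _ := h3.deriv
  rw [h4]
  norm_num

theorem eulerMascheroniConstant_le_harmonic_sub_log (n : ℕ) :
    Real.eulerMascheroniConstant ≤ harmonic n - Real.log (n + 1 / 2) := by
  have hanti : Antitone fun n : ℕ => (harmonic n : ℝ) - Real.log (n + 1 / 2) := by
    refine antitone_nat_of_succ_le fun k => ?_
    have h1 := Real.le_log_one_add_of_nonneg (x := 2 / (2 * k + 1)) (by positivity)
    have h2 : 1 + 2 / (2 * (k : ℝ) + 1) = ((k + 1 : ℕ) + 1 / 2) / (k + 1 / 2) := by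
      push_cast; field_simp; ring
    rw [h2, Real.log_div (by positivity) (by positivity)] at h1
    have h3 : 2 * (2 / (2 * (k : ℝ) + 1)) / (2 / (2 * k + 1) + 2) = (k + 1 : ℝ)⁻¹ := by
      field_simp; ring
    rw [h3] at h1
    rw [harmonic_succ]
    push_cast at h1 ⊢
    linarith
  have h1 : Tendsto (fun n : ℕ => (harmonic n : ℝ) - Real.log (n + 1 / 2)) atTop
      (𝓝 Real.eulerMascheroniConstant) := by
    have e1 : Tendsto (fun n : ℕ => Real.log (1 + 1 / 2 * (1 / (n : ℝ)))) atTop (𝓝 0) := by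
      have := ((tendsto_one_div_atTop_nhds_zero_nat (𝕜 := ℝ)).const_mul (1 / 2)).const_add 1
      simpa using this.log (by norm_num)
    have e2 := Real.tendsto_harmonic_sub_log.sub e1
    rw [sub_zero] at e2
    refine e2.congr' ?_
    filter_upwards [eventually_gt_atTop 0] with n hn
    have hn' : (0 : ℝ) < n := by exact_mod_cast hn
    rw [sub_sub, ← Real.log_mul (by positivity) (by positivity)]
    congr 2
    field_simp
  exact hanti.le_of_tendsto h1 n

theorem completedRiemannZeta₀_one_re_le : (completedRiemannZeta₀ 1).re ≤ 0.02312 := by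
  rw [completedRiemannZeta₀_one_re]
  have h1 := eulerMascheroniConstant_le_harmonic_sub_log 40
  have h2 : ((harmonic 40 : ℚ) : ℝ) ≤ 4.278544 := by
    have : harmonic 40 ≤ 4.278544 := by
      norm_num [harmonic, Finset.sum_range_succ]
    calc ((harmonic 40 : ℚ) : ℝ) ≤ ((4.278544 : ℚ) : ℝ) := by exact_mod_cast this
      _ = _ := by norm_num
  have h3 : Real.log ((40 : ℕ) + 1 / 2) = 4 * Real.log 3 - Real.log 2 := by
    rw [show (((40 : ℕ) : ℝ) + 1 / 2) = 3 ^ 4 / 2 by norm_num, Real.log_div (by norm_num)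
      (by norm_num), Real.log_pow]
    norm_num
  have h4 : Real.log (4 * Real.pi) = 2 * Real.log 2 + Real.log Real.pi := by
    rw [Real.log_mul (by norm_num) Real.pi_pos.ne', show (4 : ℝ) = 2 ^ 2 by norm_num, Real.log_pow]
    norm_num
  have h5 : Real.log 3 + 2 * 0.047197 / (0.047197 + 2) ≤ Real.log Real.pi := by
    have := Real.le_log_one_add_of_nonneg (x := 0.047197) (by norm_num)
    have e : Real.log (3 * (1 + 0.047197)) ≤ Real.log Real.pi :=
      Real.log_le_log (by norm_num) (by linarith [Real.pi_gt_d6])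
    rw [Real.log_mul (by norm_num) (by norm_num)] at e
    linarith
  have h6 := Real.log_three_gt_d9
  have h7 := Real.log_two_gt_d9
  rw [h3] at h1
  rw [h4]
  norm_num at h5 h6 h7
  linarith

theorem norm_sq_sub_quarter_le {a : ℂ} (ha : |a.re| < 1 / 2) :
    ‖a ^ 2 - 1 / 4‖ ≤ a.im ^ 2 + 1 / 2 := by
  have hb := abs_lt.1 ha
  have hb2 : a.re ^ 2 ≤ 1 / 4 := by nlinarith
  rw [show a ^ 2 - 1 / 4 = (a - 1 / 2) * (a + 1 / 2) by ring, norm_mul]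
  have h1 : ‖a - 1 / 2‖ ^ 2 = (a.re - 1 / 2) ^ 2 + a.im ^ 2 := by
    rw [Complex.sq_norm, Complex.normSq_apply]; norm_num; ring
  have h2 : ‖a + 1 / 2‖ ^ 2 = (a.re + 1 / 2) ^ 2 + a.im ^ 2 := by
    rw [Complex.sq_norm, Complex.normSq_apply]; norm_num; ring
  nlinarith [sq_nonneg (‖a - 1 / 2‖ - ‖a + 1 / 2‖)]

theorem le_im_sq_of_xi_eq_zero {a : ℂ} (ha : xi a = 0) : 42.7 ≤ a.im ^ 2 := by
  have hs := isXiLike_xi.strip a ha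
  have hb := abs_lt.1 hs
  have h1 := norm_completedRiemannZeta₀_le_one (s := 1 / 2 + a) (by simp; linarith)
    (by simp; linarith)
  have h2 := norm_sq_sub_quarter_le hs
  have h3 : ‖a ^ 2 - 1 / 4‖ * ‖completedRiemannZeta₀ (1 / 2 + a)‖ = 1 := by
    rw [← norm_mul, show (a ^ 2 - 1 / 4) * completedRiemannZeta₀ (1 / 2 + a) = -1 by
      unfold xi at ha; linear_combination ha]
    simp
  have h4 : ‖completedRiemannZeta₀ (1 / 2 + a)‖ ≤ 0.02312 :=
    h1.trans completedRiemannZeta₀_one_re_le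
  have h5 : 1 ≤ (a.im ^ 2 + 1 / 2) * 0.02312 := by
    calc 1 = ‖a ^ 2 - 1 / 4‖ * ‖completedRiemannZeta₀ (1 / 2 + a)‖ := h3.symm
      _ ≤ _ := by gcongr
  linarith

/-- The multiplicity of a zero of `xi`. -/
noncomputable def xiOrder (a : {a : ℂ // xi a = 0}) : ℝ := analyticOrderNatAt xi a

theorem xiOrder_nonneg (a : {a : ℂ // xi a = 0}) : 0 ≤ xiOrder a := Nat.cast_nonneg _

theorem one_le_xiOrder (a : {a : ℂ // xi a = 0}) : 1 ≤ xiOrder a := by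
  have h1 : analyticOrderAt xi a ≠ 0 :=
    (differentiable_xi.analyticAt a.1).analyticOrderAt_ne_zero.2 a.2
  have h2 := differentiable_xi.analyticOrderAt_ne_top xi_zero_ne a.1
  have : analyticOrderNatAt xi a ≠ 0 := fun h => h1 (by
    rw [← Nat.cast_analyticOrderNatAt h2, h, Nat.cast_zero])
  rw [xiOrder]
  exact_mod_cast Nat.one_le_iff_ne_zero.2 this

theorem im_sq_pos (a : {a : ℂ // xi a = 0}) : 0 < a.1.im ^ 2 := by
  linarith [le_im_sq_of_xi_eq_zero a.2]

theorem sum_xiOrder_div_im_sq_le (T : Finset {a : ℂ // xi a = 0}) :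
    ∑ a ∈ T, xiOrder a / a.1.im ^ 2 ≤ 0.04733 := by
  have h1 := isXiLike_xi.sum_div_le (v := 1 / 2) le_rfl T
  have h2 : ∑ a ∈ T, xiOrder a / a.1.im ^ 2 ≤ ∑ a ∈ T, 2.04684 *
      ((analyticOrderNatAt xi a : ℝ) * ((1 / 2) / ((1 / 2) ^ 2 + a.1.im ^ 2 + 3 / 4))) := by
    refine Finset.sum_le_sum fun a _ => ?_
    have hg := le_im_sq_of_xi_eq_zero a.2
    have : 1 / a.1.im ^ 2 ≤ 2.04684 * ((1 / 2) / ((1 / 2) ^ 2 + a.1.im ^ 2 + 3 / 4)) := by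
      rw [div_le_iff₀ (im_sq_pos a), ← mul_div_assoc, div_mul_eq_mul_div, le_div_iff₀ (by positivity)]
      linarith
    calc xiOrder a / a.1.im ^ 2 = xiOrder a * (1 / a.1.im ^ 2) := by ring
      _ ≤ xiOrder a * (2.04684 * ((1 / 2) / ((1 / 2) ^ 2 + a.1.im ^ 2 + 3 / 4))) :=
        mul_le_mul_of_nonneg_left this (xiOrder_nonneg a)
      _ = _ := by rw [xiOrder]; ring
  rw [← Finset.mul_sum] at h2
  have h3 : (logDeriv xi ((1 / 2 : ℝ) : ℂ)).re ≤ 0.02312 := by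
    rw [show ((1 / 2 : ℝ) : ℂ) = 1 / 2 by push_cast; rfl, logDeriv_xi_half]
    exact completedRiemannZeta₀_one_re_le
  linarith

theorem hasDerivAt_log_Gamma {x : ℝ} (hx : 0 < x) :
    HasDerivAt (Real.log ∘ Real.Gamma) (digamma x).re x ∧ ((digamma x).re : ℂ) = digamma x := by
  have hd := Real.differentiableAt_Gamma (s := x) fun m hm => by
    have : (0 : ℝ) ≤ m := by positivity
    linarith
  have h1 := (Complex.differentiableAt_Gamma (x : ℂ) fun m hm => by
    have : x = -(m : ℝ) := by exact_mod_cast hm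
    have h0 : (0 : ℝ) ≤ m := by positivity
    linarith).hasDerivAt
  have h2 := h1.real_of_complex
  have h3 : HasDerivAt Real.Gamma (deriv Complex.Gamma x).re x := by
    simpa [Complex.Gamma_ofReal] using h2
  have h4 : deriv Complex.Gamma x = ((deriv Complex.Gamma x).re : ℂ) := by
    have e1 : HasDerivAt (fun y : ℝ => (Complex.Gamma y)) (deriv Complex.Gamma x) x :=
      h1.comp_ofReal
    have e2 := h3.ofReal_comp
    simp only [← Complex.Gamma_ofReal] at e2
    exact e1.unique e2
  have h5 : digamma x = (((deriv Complex.Gamma x).re / Real.Gamma x : ℝ) : ℂ) := by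
    rw [digamma_def, logDeriv_apply]
    conv_lhs => rw [h4]
    rw [Complex.Gamma_ofReal]
    push_cast
    rfl
  rw [h5, Complex.ofReal_re]
  exact ⟨h3.log (Real.Gamma_pos_of_pos hx).ne', rfl⟩

theorem digamma_ofReal_mono {x y : ℝ} (hx : 0 < x) (hxy : x ≤ y) :
    (digamma x).re ≤ (digamma y).re := by
  rcases hxy.eq_or_lt with rfl | h
  · exact le_rfl
  have hy := hx.trans h
  exact (Real.convexOn_log_Gamma.le_slope_of_hasDerivAt hx hy h (hasDerivAt_log_Gamma hx).1).trans
    (Real.convexOn_log_Gamma.slope_le_of_hasDerivAt hx hy h (hasDerivAt_log_Gamma hy).1)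

theorem digamma_add_natCast {z : ℂ} (hz : 0 < z.re) (N : ℕ) :
    digamma (z + N) = digamma z + ∑ k ∈ Finset.range N, 1 / (z + k) := by
  induction N with
  | zero => simp
  | succ N ih =>
    rw [Finset.sum_range_succ, ← add_assoc, ← ih]
    push_cast
    rw [← add_assoc, digamma_apply_add_one, one_div]
    intro m hm
    have := congrArg Complex.re hm
    simp at this
    have h1 : (0 : ℝ) ≤ m := by positivity
    have h2 : (0 : ℝ) ≤ N := by positivity
    linarith

theorem sum_range_one_div_add_one (N : ℕ) :
    ∑ k ∈ Finset.range N, 1 / ((k : ℝ) + 1) = harmonic N := by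
  simp [harmonic]

theorem digamma_natCast_add_one (N : ℕ) :
    (digamma ((N + 1 : ℝ) : ℂ)).re = harmonic N - Real.eulerMascheroniConstant := by
  have h := digamma_add_natCast (z := 1) (by simp) N
  rw [digamma_one] at h
  rw [show ((N + 1 : ℝ) : ℂ) = 1 + N by push_cast; ring, h]
  have : (∑ k ∈ Finset.range N, 1 / (1 + (k : ℂ))) = ((harmonic N : ℝ) : ℂ) := by
    rw [← sum_range_one_div_add_one]
    push_cast
    simp_rw [add_comm]
  rw [this, ← Complex.ofReal_neg, ← Complex.ofReal_add, Complex.ofReal_re]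
  ring

theorem digamma_add_one_re {x : ℝ} (hx : 0 < x) :
    (digamma ((x + 1 : ℝ) : ℂ)).re = (digamma x).re + 1 / x := by
  have h := digamma_add_natCast (z := x) (by simpa) 1
  simp only [Finset.sum_range_one, Nat.cast_zero, add_zero, Nat.cast_one] at h
  rw [Complex.ofReal_add, Complex.ofReal_one, h, Complex.add_re]
  congr 1
  rw [show (1 : ℂ) / x = ((1 / x : ℝ) : ℂ) by push_cast; rfl, Complex.ofReal_re]

theorem tendsto_log_sub_sum_ofReal {x : ℝ} (hx : 0 < x) :
    Tendsto (fun N : ℕ => Real.log N - ∑ k ∈ Finset.range N, 1 / (x + k)) atTop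
      (𝓝 (digamma x).re) := by
  have hre : ∀ N : ℕ, (digamma ((x + N : ℝ) : ℂ)).re =
      (digamma x).re + ∑ k ∈ Finset.range N, 1 / (x + k) := by
    intro N
    have := congrArg Complex.re (digamma_add_natCast (z := x) (by simpa) N)
    rw [Complex.add_re, Complex.re_sum] at this
    rw [Complex.ofReal_add, Complex.ofReal_natCast, this]
    congr 1
    refine Finset.sum_congr rfl fun k _ => ?_
    rw [show (1 : ℂ) / (x + k) = ((1 / (x + k) : ℝ) : ℂ) by push_cast; rfl, Complex.ofReal_re]
  obtain ⟨M, hM⟩ := exists_nat_ge x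
  have hlim : Tendsto (fun N : ℕ => (digamma ((x + N : ℝ) : ℂ)).re - Real.log N) atTop (𝓝 0) := by
    have hl : Tendsto (fun N : ℕ => (harmonic N : ℝ) - Real.eulerMascheroniConstant - 1 / N
        - Real.log N) atTop (𝓝 0) := by
      have := (Real.tendsto_harmonic_sub_log.sub_const Real.eulerMascheroniConstant).sub
        (tendsto_one_div_atTop_nhds_zero_nat (𝕜 := ℝ))
      rw [sub_self, sub_zero] at this
      exact this.congr fun N => by ring
    have hu : Tendsto (fun N : ℕ => (harmonic N : ℝ) - Real.eulerMascheroniConstant + M * (1 / N)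
        - Real.log N) atTop (𝓝 0) := by
      have := (Real.tendsto_harmonic_sub_log.sub_const Real.eulerMascheroniConstant).add
        ((tendsto_one_div_atTop_nhds_zero_nat (𝕜 := ℝ)).const_mul (M : ℝ))
      rw [sub_self, mul_zero, add_zero] at this
      exact this.congr fun N => by ring
    refine tendsto_of_tendsto_of_tendsto_of_le_of_le' hl hu ?_ ?_
    · filter_upwards [eventually_gt_atTop 0] with N hN
      have hN' : (0 : ℝ) < N := by exact_mod_cast hN
      have h1 := digamma_ofReal_mono hN' (by linarith : (N : ℝ) ≤ x + N)
      have h2 := digamma_add_one_re hN'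
      rw [digamma_natCast_add_one] at h2
      linarith
    · filter_upwards [eventually_gt_atTop 0] with N hN
      have hN' : (0 : ℝ) < N := by exact_mod_cast hN
      have h1 := digamma_ofReal_mono (by linarith : 0 < x + N)
        (by push_cast; linarith : x + N ≤ ((N + M : ℕ) : ℝ) + 1)
      rw [digamma_natCast_add_one] at h1
      have h3 : (harmonic (N + M) : ℝ) ≤ harmonic N + M * (1 / N) := by
        rw [← sum_range_one_div_add_one, ← sum_range_one_div_add_one, Finset.sum_range_add]
        gcongr
        refine (Finset.sum_le_card_nsmul _ _ (1 / (N : ℝ)) fun k _ => ?_).trans (by simp)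
        have : (0 : ℝ) ≤ k := by positivity
        push_cast
        gcongr
        linarith
      linarith
  have h := hlim.const_sub (digamma x).re
  rw [sub_zero] at h
  refine h.congr fun N => ?_
  rw [hre]
  ring

theorem one_div_sub_one_div_natCast_add {z : ℂ} (hz : 0 < z.re) (n : ℕ) :
    1 / ((n : ℂ) + 1) - 1 / (z + n) = (z - 1) / ((n + 1) * (z + n)) := by
  have h1 : (n : ℂ) + 1 ≠ 0 := Nat.cast_add_one_ne_zero n
  have h2 : z + n ≠ 0 := fun h => by
    have := congrArg Complex.re h
    simp at this
    have h0 : (0 : ℝ) ≤ n := by positivity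
    linarith
  field_simp
  ring

theorem norm_digamma_term_le {z : ℂ} {c K : ℝ} (hc : 0 < c) (hc1 : c ≤ 1) (hz : c ≤ z.re)
    (hK : ‖z - 1‖ ≤ K) (n : ℕ) :
    ‖1 / ((n : ℂ) + 1) - 1 / (z + n)‖ ≤ K / c * (1 / ((n : ℝ) + 1) ^ 2) := by
  rw [one_div_sub_one_div_natCast_add (hc.trans_le hz), norm_div, norm_mul]
  have hn : (0 : ℝ) ≤ n := by positivity
  have h1 : ‖(n : ℂ) + 1‖ = n + 1 := by
    rw [← Nat.cast_add_one, Complex.norm_natCast]; push_cast; rfl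
  have h2 : c * (n + 1) ≤ ‖z + n‖ := by
    refine le_trans ?_ (Complex.re_le_norm _)
    simp
    nlinarith
  have hK0 : 0 ≤ K := (norm_nonneg _).trans hK
  rw [h1]
  calc _ ≤ K / ((n + 1) * (c * (n + 1))) := by gcongr
    _ = _ := by field_simp

theorem summable_one_div_natCast_add_one_sq : Summable fun n : ℕ => 1 / ((n : ℝ) + 1) ^ 2 := by
  have := (summable_nat_add_iff 1).2 (Real.summable_one_div_nat_pow.2 one_lt_two)
  simpa using this

theorem hasSum_digamma {z : ℂ} (hz : 0 < z.re) :
    HasSum (fun n : ℕ => 1 / ((n : ℂ) + 1) - 1 / (z + n))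
      (digamma z + Real.eulerMascheroniConstant) := by
  have hsum : ∀ w : ℂ, 0 < w.re → Summable fun n : ℕ => 1 / ((n : ℂ) + 1) - 1 / (w + n) :=
    fun w hw => Summable.of_norm_bounded (summable_one_div_natCast_add_one_sq.mul_left _)
      (norm_digamma_term_le (lt_min hw one_pos) (min_le_right _ _) (min_le_left _ _) le_rfl)
  have hopen : IsOpen {w : ℂ | 0 < w.re} := isOpen_lt continuous_const Complex.continuous_re
  have hE : DifferentiableOn ℂ (fun w => ∑' n : ℕ, (1 / ((n : ℂ) + 1) - 1 / (w + n)))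
      {w : ℂ | 0 < w.re} := by
    intro w hw
    rw [mem_ofPred_eq] at hw
    have hre : ∀ v ∈ ball w (w.re / 2), w.re / 2 ≤ v.re := fun v hv => by
      have h1 : ‖v - w‖ < w.re / 2 := mem_ball_iff_norm.1 hv
      have h2 := (abs_le.1 (Complex.abs_re_le_norm (v - w))).1
      rw [Complex.sub_re] at h2
      linarith
    refine DifferentiableAt.differentiableWithinAt ?_
    refine (differentiableOn_tsum_of_summable_norm (U := ball w (w.re / 2))
      (summable_one_div_natCast_add_one_sq.mul_left ((w.re / 2 + ‖w - 1‖) / min (w.re / 2) 1))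
      (fun n => ?_) isOpen_ball fun n v hv => ?_).differentiableAt
      (isOpen_ball.mem_nhds (mem_ball_self (by linarith)))
    · intro v hv
      have : v + n ≠ 0 := fun h => by
        have h1 := congrArg Complex.re h
        simp at h1
        have h0 : (0 : ℝ) ≤ n := by positivity
        linarith [hre v hv]
      have hd : DifferentiableAt ℂ (fun v : ℂ => 1 / ((n : ℂ) + 1) - 1 / (v + n)) v := by
        fun_prop (disch := assumption)
      exact hd.differentiableWithinAt
    · refine norm_digamma_term_le (lt_min (by linarith) one_pos) (min_le_right _ _)
        ((min_le_left _ _).trans (hre v hv)) ?_ n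
      have h1 : ‖v - w‖ < w.re / 2 := mem_ball_iff_norm.1 hv
      have h2 := norm_add_le (v - w) (w - 1)
      rw [sub_add_sub_cancel] at h2
      linarith
  have hD : DifferentiableOn ℂ (fun w => digamma w + Real.eulerMascheroniConstant)
      {w : ℂ | 0 < w.re} := by
    have hG : DifferentiableOn ℂ Complex.Gamma {w : ℂ | 0 < w.re} := fun w hw =>
      (Complex.differentiableAt_Gamma w fun m hm => by
        rw [mem_ofPred_eq, hm] at hw
        simp at hw
        have h0 : (0 : ℝ) ≤ m := by positivity
        linarith).differentiableWithinAt
    refine DifferentiableOn.add_const _ ?_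
    exact (hG.deriv hopen).div hG fun w hw => Complex.Gamma_ne_zero_of_re_pos hw
  have hreal : ∀ x : ℝ, 0 < x → digamma x + Real.eulerMascheroniConstant =
      ∑' n : ℕ, (1 / ((n : ℂ) + 1) - 1 / ((x : ℂ) + n)) := by
    intro x hx
    have h1 := (hsum x (by simpa)).hasSum.tendsto_sum_nat
    have h2 := (tendsto_log_sub_sum_ofReal hx).add Real.tendsto_harmonic_sub_log
    have h3 := (Complex.continuous_ofReal.tendsto _).comp h2
    have h4 := tendsto_nhds_unique (h3.congr fun N => ?_) h1
    · rw [← h4, ← (hasDerivAt_log_Gamma hx).2]; simp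
    · simp only [Function.comp_apply]
      rw [← sum_range_one_div_add_one]
      push_cast
      rw [Finset.sum_sub_distrib]
      ring
  have key := (hD.analyticOnNhd hopen).eqOn_of_preconnected_of_frequently_eq
    (hE.analyticOnNhd hopen) (convex_halfSpace_re_gt 0).isPreconnected (z₀ := 1) (by simp) ?_
  · have := key hz
    simp only at this
    rw [this]
    exact (hsum z hz).hasSum
  · have h1 : Tendsto (fun n : ℕ => ((1 + 1 / ((n : ℝ) + 1) : ℝ) : ℂ)) atTop (𝓝[≠] 1) := by
      refine tendsto_nhdsWithin_iff.2 ⟨?_, Eventually.of_forall fun n => ?_⟩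
      · have := (Complex.continuous_ofReal.tendsto _).comp
          (tendsto_one_div_add_atTop_nhds_zero_nat.const_add 1)
        simpa [Function.comp_def] using this
      · simp only [mem_compl_iff, mem_singleton_iff]
        rw [← Complex.ofReal_one, Complex.ofReal_inj]
        have : (0 : ℝ) < 1 / ((n : ℝ) + 1) := by positivity
        linarith
    refine h1.frequently (Frequently.of_forall fun n => hreal _ (by positivity))

theorem tendsto_log_sub_sum {z : ℂ} (hz : 0 < z.re) :
    Tendsto (fun N : ℕ => Real.log N - ∑ k ∈ Finset.range N, (1 / (z + k)).re) atTop
      (𝓝 (digamma z).re) := by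
  have h1 := (Complex.continuous_re.tendsto _).comp (hasSum_digamma hz).tendsto_sum_nat
  have h2 := h1.sub Real.tendsto_harmonic_sub_log
  rw [Complex.add_re, Complex.ofReal_re, add_sub_cancel_right] at h2
  refine h2.congr fun N => ?_
  rw [← sum_range_one_div_add_one]
  simp only [Function.comp_apply, Finset.sum_sub_distrib, Complex.sub_re, Complex.re_sum]
  have : ∀ k : ℕ, (1 / ((k : ℂ) + 1)).re = 1 / ((k : ℝ) + 1) := fun k => by
    rw [show 1 / ((k : ℂ) + 1) = ((1 / ((k : ℝ) + 1) : ℝ) : ℂ) by push_cast; rfl, Complex.ofReal_re]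
  simp_rw [this]
  ring

theorem digamma_ofReal_le {x : ℝ} (hx : 0 < x) :
    (digamma x).re ≤ Real.log x - 1 / (2 * x) := by
  have hstep : ∀ y : ℝ, 0 < y →
      Real.log (y + 1) - Real.log y ≤ (1 / y + 1 / (y + 1)) / 2 := by
    intro y hy
    have hanti : ∀ t : ℝ, 1 ≤ t → Real.log t ≤ (t - 1 / t) / 2 := fun t ht => by
      have h := Real.self_le_sinh_iff.2 (Real.log_nonneg ht)
      rwa [Real.sinh_log (by linarith), inv_eq_one_div] at h
    have h1 := hanti ((y + 1) / y) (by rw [le_div_iff₀ hy]; linarith)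
    rw [Real.log_div (by positivity) hy.ne'] at h1
    refine h1.trans (le_of_eq ?_)
    field_simp
    ring
  have hsum : ∀ N : ℕ, Real.log (x + N) - Real.log x + 1 / (2 * x) - 1 / (2 * (x + N)) ≤
      ∑ k ∈ Finset.range N, 1 / (x + k) := by
    intro N
    induction N with
    | zero => simp
    | succ N ih =>
      rw [Finset.sum_range_succ]
      have h := hstep (x + N) (by positivity)
      push_cast
      rw [← add_assoc]
      have e1 : 1 / (2 * (x + N)) = 1 / (x + N) / 2 := by field_simp
      have e2 : 1 / (2 * (x + N + 1)) = 1 / (x + N + 1) / 2 := by field_simp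
      rw [e2]
      rw [e1] at ih
      linarith
  have hlim : Tendsto (fun N : ℕ => Real.log x - 1 / (2 * x) + 1 / (N : ℝ)) atTop
      (𝓝 (Real.log x - 1 / (2 * x))) := by
    simpa using (tendsto_one_div_atTop_nhds_zero_nat (𝕜 := ℝ)).const_add
      (Real.log x - 1 / (2 * x))
  refine le_of_tendsto_of_tendsto (tendsto_log_sub_sum_ofReal hx) hlim ?_
  filter_upwards [eventually_gt_atTop 0] with N hN
  have hN' : (0 : ℝ) < N := by exact_mod_cast hN
  have h1 := hsum N
  have h2 : Real.log N ≤ Real.log (x + N) := Real.log_le_log hN' (by linarith)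
  have h3 : 1 / (2 * (x + N)) ≤ 1 / (N : ℝ) := by gcongr; linarith
  linarith

theorem one_div_add_sq_le_arctan_sub {x t : ℝ} (hx : 1 ≤ x) (ht : 0 < t) :
    1 / (x ^ 2 + t ^ 2) ≤ (Real.arctan (x / t) - Real.arctan ((x - 1) / t)) / t := by
  have hd : ∀ u : ℝ, HasDerivAt (fun u => Real.arctan (u / t)) (t / (u ^ 2 + t ^ 2)) u := by
    intro u
    have := ((hasDerivAt_id u).div_const t).arctan
    simp only [id] at this
    convert this using 1
    field_simp
    ring
  obtain ⟨c, hc, hc2⟩ := exists_hasDerivAt_eq_slope (fun u => Real.arctan (u / t))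
    (fun u => t / (u ^ 2 + t ^ 2)) (a := x - 1) (b := x) (by linarith)
    (fun u _ => (hd u).continuousAt.continuousWithinAt) fun u _ => hd u
  rw [sub_sub_cancel, div_one] at hc2
  rw [← hc2, div_div, mul_comm, ← div_div, div_self ht.ne']
  have hc0 : 0 ≤ c := by linarith [hc.1]
  have := hc.2
  gcongr

theorem log_norm_add_one_sub_le {z : ℂ} (hz : z ≠ 0) (hz1 : z + 1 ≠ 0) :
    Real.log ‖z + 1‖ - Real.log ‖z‖ ≤ (1 / z).re + 1 / (2 * ‖z‖ ^ 2) := by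
  have hn : 0 < ‖z‖ := norm_pos_iff.2 hz
  have hn1 : 0 < ‖z + 1‖ := norm_pos_iff.2 hz1
  have h1 := Real.log_le_sub_one_of_pos (x := ‖z + 1‖ ^ 2 / ‖z‖ ^ 2) (by positivity)
  rw [Real.log_div (by positivity) (by positivity), Real.log_pow, Real.log_pow] at h1
  have h2 : ‖z + 1‖ ^ 2 = ‖z‖ ^ 2 + 2 * z.re + 1 := by
    rw [Complex.sq_norm, Complex.sq_norm, Complex.normSq_apply, Complex.normSq_apply]
    simp
    ring
  have h3 : (1 / z).re = z.re / ‖z‖ ^ 2 := by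
    rw [one_div, Complex.inv_re, Complex.sq_norm]
  rw [h3]
  have h4 : ‖z + 1‖ ^ 2 / ‖z‖ ^ 2 - 1 = 2 * (z.re / ‖z‖ ^ 2 + 1 / (2 * ‖z‖ ^ 2)) := by
    rw [h2]; field_simp; ring
  rw [h4] at h1
  push_cast at h1
  linarith

theorem digamma_re_le {z : ℂ} (hx : 1 ≤ z.re) (ht : 0 < z.im) :
    (digamma z).re ≤ Real.log ‖z‖ + Real.pi / (4 * z.im) := by
  have hne : ∀ k : ℕ, z + k ≠ 0 := fun k h => by
    have := congrArg Complex.im h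
    simp at this
    linarith
  have hsum : ∀ N : ℕ, Real.log ‖z + N‖ - Real.log ‖z‖ ≤ ∑ k ∈ Finset.range N, (1 / (z + k)).re +
      (Real.arctan ((z.re + N - 1) / z.im) - Real.arctan ((z.re - 1) / z.im)) / z.im / 2 := by
    intro N
    induction N with
    | zero => simp
    | succ N ih =>
      rw [Finset.sum_range_succ]
      have h1 := log_norm_add_one_sub_le (hne N) (by
        have := hne (N + 1); push_cast at this; rwa [← add_assoc] at this)
      have hN : (0 : ℝ) ≤ N := by positivity
      have h2 := one_div_add_sq_le_arctan_sub (x := z.re + N) (by linarith) ht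
      have h3 : ‖z + N‖ ^ 2 = (z.re + N) ^ 2 + z.im ^ 2 := by
        rw [Complex.sq_norm, Complex.normSq_apply]
        simp
        ring
      have h4 : 1 / (2 * ‖z + N‖ ^ 2) = 1 / ((z.re + N) ^ 2 + z.im ^ 2) / 2 := by
        rw [h3]; field_simp
      rw [h4] at h1
      push_cast
      rw [← add_assoc, ← add_assoc, add_sub_cancel_right]
      have e : ∀ a b c : ℝ, (a - b) / z.im / 2 = (a - c) / z.im / 2 + (c - b) / z.im / 2 :=
        fun a b c => by ring
      rw [e _ _ (Real.arctan ((z.re + N - 1) / z.im))]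
      linarith
  have hlim : Tendsto (fun N : ℕ => Real.log ‖z‖ + Real.pi / (4 * z.im) + (0 : ℝ)) atTop
      (𝓝 (Real.log ‖z‖ + Real.pi / (4 * z.im))) := by simp
  refine le_of_tendsto_of_tendsto (tendsto_log_sub_sum (by linarith)) hlim ?_
  filter_upwards [eventually_gt_atTop 0] with N hN
  have hN' : (0 : ℝ) < N := by exact_mod_cast hN
  have h1 := hsum N
  have h2 : Real.log N ≤ Real.log ‖z + N‖ := by
    refine Real.log_le_log hN' (le_trans ?_ (Complex.re_le_norm _))
    simp; linarith
  have h3 : 0 ≤ Real.arctan ((z.re - 1) / z.im) := Real.arctan_nonneg.2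
    (div_nonneg (by linarith) ht.le)
  have h4 := (Real.arctan_lt_pi_div_two ((z.re + N - 1) / z.im)).le
  have h5 : (Real.arctan ((z.re + N - 1) / z.im) - Real.arctan ((z.re - 1) / z.im)) / z.im / 2 ≤
      (Real.pi / 2) / z.im / 2 := by gcongr; linarith
  have h6 : (Real.pi / 2) / z.im / 2 = Real.pi / (4 * z.im) := by field_simp; ring
  linarith

theorem xi_sub_half_eq {s : ℂ} (h0 : s ≠ 0) (h1 : s ≠ 1) (hG : Gammaℝ s ≠ 0) :
    xi (s - 1 / 2) =
      2 * (s - 1) * ((Real.pi : ℂ) ^ (-s / 2) * (Complex.Gamma (s / 2 + 1) * riemannZeta s)) := by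
  rw [xi_eq_completedRiemannZeta h0 h1, riemannZeta_def_of_ne_zero h0,
    Complex.Gamma_add_one _ (div_ne_zero h0 two_ne_zero)]
  rw [Gammaℝ_def] at hG ⊢
  have := (mul_ne_zero_iff.1 hG).2
  have := (mul_ne_zero_iff.1 hG).1
  field_simp

theorem logDeriv_xi_sub_half {s : ℂ} (hs : 1 < s.re) :
    logDeriv xi (s - 1 / 2) = 1 / (s - 1) - Real.log Real.pi / 2 + digamma (s / 2 + 1) / 2 +
      deriv riemannZeta s / riemannZeta s := by
  have hopen : IsOpen {w : ℂ | 1 < w.re} := isOpen_lt continuous_const Complex.continuous_re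
  have hev : (fun w => xi (w - 1 / 2)) =ᶠ[𝓝 s] fun w =>
      (2 * (w - 1)) * ((Real.pi : ℂ) ^ (-w / 2) * (Complex.Gamma (w / 2 + 1) * riemannZeta w)) := by
    filter_upwards [hopen.mem_nhds hs] with w hw
    refine xi_sub_half_eq ?_ ?_ (Gammaℝ_ne_zero_of_re_pos (by linarith))
    · rintro rfl; simp at hw; linarith
    · rintro rfl; simp at hw
  have hs1 : s ≠ 1 := by rintro rfl; simp at hs
  have hpi : (Real.pi : ℂ) ≠ 0 := by exact_mod_cast Real.pi_ne_zero
  have hre : (s / 2 + 1).re = s.re / 2 + 1 := by simp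
  have hGre : 0 < (s / 2 + 1).re := by rw [hre]; linarith
  have hG0 : Complex.Gamma (s / 2 + 1) ≠ 0 := Complex.Gamma_ne_zero_of_re_pos hGre
  have hz0 : riemannZeta s ≠ 0 := riemannZeta_ne_zero_of_one_le_re hs.le
  have hp0 : (Real.pi : ℂ) ^ (-s / 2) ≠ 0 := by simp [Complex.cpow_eq_zero_iff, hpi]
  have dG : HasDerivAt Complex.Gamma (deriv Complex.Gamma (s / 2 + 1)) (s / 2 + 1) :=
    (Complex.differentiableAt_Gamma _ fun m hm => by
      have := congrArg Complex.re hm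
      rw [hre] at this
      simp at this
      have h0 : (0 : ℝ) ≤ m := by positivity
      linarith).hasDerivAt
  have dG' : HasDerivAt (fun w : ℂ => Complex.Gamma (w / 2 + 1))
      (deriv Complex.Gamma (s / 2 + 1) * (1 / 2)) s :=
    dG.comp (h := fun w : ℂ => w / 2 + 1) s (((hasDerivAt_id s).div_const 2).add_const 1)
  have dz := (differentiableAt_riemannZeta hs1).hasDerivAt
  have dp : HasDerivAt (fun w : ℂ => (Real.pi : ℂ) ^ (-w / 2))
      ((Real.pi : ℂ) ^ (-s / 2) * Complex.log Real.pi * (-1 / 2)) s :=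
    ((hasDerivAt_id s).neg.div_const 2).const_cpow (Or.inl hpi)
  have dl : HasDerivAt (fun w : ℂ => 2 * (w - 1)) (2 * 1) s :=
    ((hasDerivAt_id s).sub_const 1).const_mul 2
  have hall := dl.mul (dp.mul (dG'.mul dz))
  have dxi : HasDerivAt (fun w => xi (w - 1 / 2)) (deriv xi (s - 1 / 2)) s :=
    HasDerivAt.comp_sub_const _ _ (differentiable_xi _).hasDerivAt
  have e1 := dxi.unique (hall.congr_of_eventuallyEq hev)
  have e2 := hev.eq_of_nhds
  rw [logDeriv_apply, e1, e2, digamma_def, logDeriv_apply, Complex.ofReal_log Real.pi_pos.le]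
  simp only [Pi.mul_apply]
  have := sub_ne_zero.2 hs1
  generalize deriv Complex.Gamma (s / 2 + 1) = G'
  generalize Complex.Gamma (s / 2 + 1) = G at hG0 ⊢
  field_simp
  ring

theorem re_deriv_div_riemannZeta_nonpos {x : ℝ} (hx : 1 < x) :
    (deriv riemannZeta x / riemannZeta x).re ≤ 0 := by
  have h := ArithmeticFunction.LSeries_vonMangoldt_eq_deriv_riemannZeta_div (s := x) (by simpa)
  rw [neg_div] at h
  have h1 := (ArithmeticFunction.LSeriesSummable_vonMangoldt (s := x) (by simpa)).hasSum
  have h2 : 0 ≤ (LSeries (fun n => (ArithmeticFunction.vonMangoldt n : ℂ)) x).re := by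
    rw [LSeries, Complex.re_tsum h1.summable]
    refine tsum_nonneg fun n => ?_
    rcases Nat.eq_zero_or_pos n with rfl | hn
    · simp
    · rw [LSeries.term_of_ne_zero hn.ne', ← Complex.ofReal_natCast,
        ← Complex.ofReal_cpow (by positivity), ← Complex.ofReal_div, Complex.ofReal_re]
      exact div_nonneg ArithmeticFunction.vonMangoldt_nonneg (by positivity)
  rw [h, Complex.neg_re] at h2
  linarith

theorem logDeriv_xi_re_le {v : ℝ} (hv : 28 ≤ v) :
    (logDeriv xi v).re ≤ Real.log (v / (2 * Real.pi)) / 2 + 1.82 / v := by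
  have hv0 : 0 < v := by linarith
  have h := logDeriv_xi_sub_half (s := ((v + 1 / 2 : ℝ) : ℂ)) (by rw [Complex.ofReal_re]; linarith)
  rw [show ((v + 1 / 2 : ℝ) : ℂ) - 1 / 2 = v by push_cast; ring] at h
  rw [h]
  have h1 := re_deriv_div_riemannZeta_nonpos (x := v + 1 / 2) (by linarith)
  have h2 := digamma_ofReal_le (x := (v + 1 / 2) / 2 + 1) (by positivity)
  have e1 : (1 : ℂ) / (((v + 1 / 2 : ℝ) : ℂ) - 1) = ((1 / (v - 1 / 2) : ℝ) : ℂ) := by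
    push_cast; congr 1; ring
  have e2 : ((v + 1 / 2 : ℝ) : ℂ) / 2 + 1 = (((v + 1 / 2) / 2 + 1 : ℝ) : ℂ) := by push_cast; ring
  have e3 : ((Real.log Real.pi : ℝ) : ℂ) / 2 = ((Real.log Real.pi / 2 : ℝ) : ℂ) := by push_cast; ring
  have e4 : ∀ w : ℂ, (w / 2).re = w.re / 2 := fun w => by simp
  rw [e1, e2, e3, Complex.add_re, Complex.add_re, Complex.sub_re, e4, Complex.ofReal_re,
    Complex.ofReal_re]
  have h3 : Real.log ((v + 1 / 2) / 2 + 1) ≤ Real.log v - Real.log 2 + 2.5 / v := by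
    rw [show (v + 1 / 2) / 2 + 1 = v / 2 * (1 + 2.5 / v) by field_simp; ring,
      Real.log_mul (by positivity) (by positivity), Real.log_div hv0.ne' two_ne_zero]
    have := Real.log_le_sub_one_of_pos (x := 1 + 2.5 / v) (by positivity)
    linarith
  rw [Real.log_div hv0.ne' (by positivity), Real.log_mul two_ne_zero Real.pi_ne_zero]
  have h4 : 1 / (v - 1 / 2) - 1 / (2 * v + 5) ≤ 0.57 / v := by
    rw [div_sub_div _ _ (by linarith) (by linarith), div_le_div_iff₀ (by nlinarith) hv0]
    nlinarith
  have h5 : 1 / (2 * ((v + 1 / 2) / 2 + 1)) = 2 * (1 / (2 * v + 5)) := by field_simp; ring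
  rw [h5] at h2
  have h6 : 1.82 / v = 0.57 / v + 2.5 / v / 2 := by ring
  linarith

/-- The truncated logarithmic weight attached to a zero. -/
noncomputable def zeroWeight (g : ℝ) : ℝ := Real.log (1 + g ^ 2 / 28 ^ 2) / 2

theorem zeroWeight_nonneg (g : ℝ) : 0 ≤ zeroWeight g := by
  unfold zeroWeight
  have := Real.log_nonneg (x := 1 + g ^ 2 / 28 ^ 2) (by linarith [(by positivity : 0 ≤ g ^ 2 / 28 ^ 2)])
  linarith

theorem sum_log_one_add_le (T : Finset {a : ℂ // xi a = 0}) :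
    ∑ a ∈ T, xiOrder a * (Real.log (1 + (a.1.im ^ 2 + 3 / 4) / 28 ^ 2) / (2 * (a.1.im ^ 2 + 3 / 4)))
      ≤ ((Real.log (28 / (2 * Real.pi)) + 1) / 2 + 1.82 / (2 * 28)) / 28 := by
  set G : ℝ → ℝ := fun v => ∑ a ∈ T, xiOrder a *
    (Real.log (1 + (a.1.im ^ 2 + 3 / 4) / v ^ 2) / (2 * (a.1.im ^ 2 + 3 / 4))) with hG
  set A : ℝ → ℝ := fun v => ((Real.log (v / (2 * Real.pi)) + 1) / 2 + 1.82 / (2 * v)) / v with hA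
  have hdG : ∀ v : ℝ, 0 < v → HasDerivAt G
      (∑ a ∈ T, xiOrder a * (-(1 / (v * (v ^ 2 + a.1.im ^ 2 + 3 / 4))))) v := by
    intro v hv
    refine HasDerivAt.fun_sum fun a _ => HasDerivAt.const_mul _ ?_
    have hg : 0 < a.1.im ^ 2 + 3 / 4 := by positivity
    have hin : HasDerivAt (fun v : ℝ => 1 + (a.1.im ^ 2 + 3 / 4) / v ^ 2)
        (-((a.1.im ^ 2 + 3 / 4) * (2 * v)) / (v ^ 2) ^ 2) v := by
      have := ((hasDerivAt_const v (a.1.im ^ 2 + 3 / 4)).fun_div (hasDerivAt_pow 2 v)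
        (by positivity)).const_add 1
      exact this.congr_deriv (by ring)
    have := (hin.log (by positivity)).div_const (2 * (a.1.im ^ 2 + 3 / 4))
    exact this.congr_deriv (by field_simp; ring)
  have hdA : ∀ v : ℝ, 0 < v → HasDerivAt A
      (-((Real.log (v / (2 * Real.pi)) / 2 + 1.82 / v) / v ^ 2)) v := by
    intro v hv
    have h1 : HasDerivAt (fun v : ℝ => Real.log (v / (2 * Real.pi))) (1 / v) v := by
      have := ((hasDerivAt_id' v).div_const (2 * Real.pi)).log (by positivity)
      exact this.congr_deriv (by field_simp)
    have h2 : HasDerivAt (fun v : ℝ => 1.82 / (2 * v)) (-(1.82 * 2) / (2 * v) ^ 2) v := by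
      have := (hasDerivAt_const v (1.82 : ℝ)).fun_div ((hasDerivAt_id' v).const_mul 2) (by simp; positivity)
      exact this.congr_deriv (by ring)
    have := (((h1.add_const 1).div_const 2).fun_add h2).fun_div (hasDerivAt_id' v) hv.ne'
    exact this.congr_deriv (by field_simp; ring)
  have hmono : MonotoneOn (fun v => G v - A v) (Ici 28) := by
    refine monotoneOn_of_deriv_nonneg (convex_Ici 28) (fun v hv => ?_) (fun v hv => ?_)
      fun v hv => ?_
    · have hv0 : (0 : ℝ) < v := by rw [mem_Ici] at hv; linarith
      exact ((hdG v hv0).sub (hdA v hv0)).continuousAt.continuousWithinAt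
    · have hv0 : (0 : ℝ) < v := by rw [interior_Ici, mem_Ioi] at hv; linarith
      exact ((hdG v hv0).sub (hdA v hv0)).differentiableAt.differentiableWithinAt
    · rw [interior_Ici, mem_Ioi] at hv
      have hv0 : (0 : ℝ) < v := by linarith
      have hd : HasDerivAt (fun v => G v - A v) _ v := (hdG v hv0).sub (hdA v hv0)
      rw [hd.deriv]
      have h1 := (isXiLike_xi.sum_div_le (v := v) (by linarith) T).trans (logDeriv_xi_re_le hv.le)
      have h2 : ∑ a ∈ T, xiOrder a * (-(1 / (v * (v ^ 2 + a.1.im ^ 2 + 3 / 4)))) =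
          -((∑ a ∈ T, (analyticOrderNatAt xi a : ℝ) * (v / (v ^ 2 + a.1.im ^ 2 + 3 / 4))) / v ^ 2) := by
        rw [Finset.sum_div, ← Finset.sum_neg_distrib]
        refine Finset.sum_congr rfl fun a _ => ?_
        rw [xiOrder]
        field_simp
      rw [h2]
      have := div_le_div_of_nonneg_right h1 (sq_nonneg v)
      linarith
  have hlimG : Tendsto G atTop (𝓝 0) := by
    have : ∀ a ∈ T, Tendsto (fun v : ℝ => xiOrder a *
        (Real.log (1 + (a.1.im ^ 2 + 3 / 4) / v ^ 2) / (2 * (a.1.im ^ 2 + 3 / 4)))) atTop (𝓝 0) := by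
      intro a _
      have h1 : Tendsto (fun v : ℝ => (a.1.im ^ 2 + 3 / 4) / v ^ 2) atTop (𝓝 0) :=
        tendsto_const_nhds.div_atTop (tendsto_pow_atTop two_ne_zero)
      have h2 := (((h1.const_add 1).log (by norm_num)).div_const
        (2 * (a.1.im ^ 2 + 3 / 4))).const_mul (xiOrder a)
      simpa using h2
    simpa using tendsto_finsetSum T this
  have hlimA : Tendsto A atTop (𝓝 0) := by
    have h1 : Tendsto (fun v : ℝ => Real.log v / v) atTop (𝓝 0) := by
      have := Real.isLittleO_log_id_atTop.tendsto_div_nhds_zero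
      simpa using this
    have h2 : Tendsto (fun v : ℝ => (1 - Real.log (2 * Real.pi)) / 2 / v) atTop (𝓝 0) :=
      tendsto_const_nhds.div_atTop tendsto_id
    have h3 : Tendsto (fun v : ℝ => 0.91 / v ^ 2) atTop (𝓝 0) :=
      tendsto_const_nhds.div_atTop (tendsto_pow_atTop two_ne_zero)
    have h4 := ((h1.div_const 2).add h2).add h3
    simp only [zero_div, add_zero] at h4
    refine h4.congr' ?_
    filter_upwards [eventually_gt_atTop 0] with v hv
    rw [hA]
    simp only
    rw [Real.log_div hv.ne' (by positivity)]
    field_simp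
    ring
  have hlim := hlimG.sub hlimA
  rw [sub_zero] at hlim
  have hle : G 28 - A 28 ≤ 0 := by
    refine ge_of_tendsto hlim ?_
    filter_upwards [eventually_ge_atTop 28] with v hv
    exact hmono (by simp) hv hv
  have := sub_nonpos.1 hle
  exact this

theorem sum_zeroWeight_le (T : Finset {a : ℂ // xi a = 0}) :
    ∑ a ∈ T, xiOrder a * zeroWeight a.1.im / a.1.im ^ 2 ≤ 0.0466 := by
  have h1 := sum_log_one_add_le T
  have h2 : ∑ a ∈ T, xiOrder a * zeroWeight a.1.im / a.1.im ^ 2 ≤ 1.0176 *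
      ∑ a ∈ T, xiOrder a *
        (Real.log (1 + (a.1.im ^ 2 + 3 / 4) / 28 ^ 2) / (2 * (a.1.im ^ 2 + 3 / 4))) := by
    rw [Finset.mul_sum]
    refine Finset.sum_le_sum fun a _ => ?_
    have hg := le_im_sq_of_xi_eq_zero a.2
    have e1 : Real.log (1 + a.1.im ^ 2 / 28 ^ 2) ≤ Real.log (1 + (a.1.im ^ 2 + 3 / 4) / 28 ^ 2) := by
      refine Real.log_le_log (by positivity) ?_
      gcongr
      linarith
    have e0 := zeroWeight_nonneg a.1.im
    unfold zeroWeight at e0 ⊢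
    have e2 : 1 / a.1.im ^ 2 ≤ 1.0176 * (1 / (a.1.im ^ 2 + 3 / 4)) := by
      rw [← mul_div_assoc, div_le_div_iff₀ (im_sq_pos a) (by positivity)]
      linarith
    have e3 := mul_le_mul e1 e2 (by positivity) (by linarith)
    have e4 := mul_le_mul_of_nonneg_left e3 (xiOrder_nonneg a)
    calc _ = xiOrder a * (Real.log (1 + a.1.im ^ 2 / 28 ^ 2) * (1 / a.1.im ^ 2)) / 2 := by ring
      _ ≤ xiOrder a * (Real.log (1 + (a.1.im ^ 2 + 3 / 4) / 28 ^ 2) *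
          (1.0176 * (1 / (a.1.im ^ 2 + 3 / 4)))) / 2 := by gcongr
      _ = _ := by field_simp
  have h3 : Real.log (28 / (2 * Real.pi)) ≤ 1.4945 := by
    have e1 : (28 : ℝ) / (2 * Real.pi) ≤ 9 / 2 * (1 - 0.0096) := by
      rw [div_le_iff₀ (by positivity)]
      nlinarith [Real.pi_gt_d4]
    have e2 := Real.log_le_log (by positivity) e1
    have e6 : Real.log (9 / 2) = 2 * Real.log 3 - Real.log 2 := by
      rw [show (9 / 2 : ℝ) = 3 ^ 2 / 2 by norm_num, Real.log_div (by norm_num) (by norm_num),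
        Real.log_pow]
      norm_num
    rw [Real.log_mul (by norm_num) (by norm_num), e6] at e2
    have e3 := Real.log_le_sub_one_of_pos (x := 1 - 0.0096) (by norm_num)
    have e4 := Real.log_three_lt_d9
    have e5 := Real.log_two_gt_d9
    norm_num at e2 e3 e4 e5 ⊢
    linarith
  linarith

theorem completedRiemannZeta₀_conj (s : ℂ) :
    completedRiemannZeta₀ (starRingEnd ℂ s) = starRingEnd ℂ (completedRiemannZeta₀ s) := by
  have h1 := (hasMellin_xiKernel (starRingEnd ℂ s)).2
  have h2 := congrArg (starRingEnd ℂ) (hasMellin_xiKernel s).2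
  rw [mellin, ← integral_conj, map_mul] at h2
  rw [mellin] at h1
  have h3 : 2 * completedRiemannZeta₀ (starRingEnd ℂ s) =
      2 * starRingEnd ℂ (completedRiemannZeta₀ s) := by
    rw [← h1, show (2 : ℂ) * starRingEnd ℂ (completedRiemannZeta₀ s) =
      starRingEnd ℂ 2 * starRingEnd ℂ (completedRiemannZeta₀ s) by rw [map_ofNat], ← h2]
    refine MeasureTheory.setIntegral_congr_fun measurableSet_Ioi fun t ht => ?_
    have ht' : (0 : ℝ) < t := ht
    have harg : (t : ℂ).arg ≠ Real.pi := by
      rw [Complex.arg_ofReal_of_nonneg ht'.le]; exact Real.pi_ne_zero.symm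
    have h := Complex.cpow_conj (t : ℂ) (s / 2 - 1) harg
    simp only [smul_eq_mul, map_mul, Complex.conj_ofReal]
    rw [Complex.conj_ofReal, map_sub, map_div₀, map_one, map_ofNat] at h
    rw [h]
  exact mul_left_cancel₀ two_ne_zero h3

theorem xi_conj (z : ℂ) : xi (starRingEnd ℂ z) = starRingEnd ℂ (xi z) := by
  unfold xi
  have : (1 : ℂ) / 2 + starRingEnd ℂ z = starRingEnd ℂ (1 / 2 + z) := by simp [map_ofNat]
  rw [this, completedRiemannZeta₀_conj]
  simp [map_ofNat]

theorem three_four_one_nonneg {x : ℝ} (hx : 1 < x) (t : ℝ) :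
    3 * (deriv riemannZeta x / riemannZeta x).re +
      4 * (deriv riemannZeta (x + t * I) / riemannZeta (x + t * I)).re +
      (deriv riemannZeta (x + 2 * t * I) / riemannZeta (x + 2 * t * I)).re ≤ 0 := by
  have key : ∀ y : ℝ, HasSum (fun n : ℕ => ArithmeticFunction.vonMangoldt n * (n : ℝ) ^ (-x) *
      Real.cos (y * Real.log n))
      (-(deriv riemannZeta (x + y * I) / riemannZeta (x + y * I)).re) := by
    intro y
    have hre : 1 < (x + y * I : ℂ).re := by simpa
    have h := ArithmeticFunction.LSeries_vonMangoldt_eq_deriv_riemannZeta_div hre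
    have h1 := (ArithmeticFunction.LSeriesSummable_vonMangoldt hre).hasSum
    have h2 := Complex.hasSum_re h1
    change HasSum _ (LSeries _ _).re at h2
    rw [h, neg_div, Complex.neg_re] at h2
    convert h2 using 2 with n
    rcases Nat.eq_zero_or_pos n with rfl | hn
    · simp
    · have hn' : (0 : ℝ) < n := by exact_mod_cast hn
      have e : (-(x + y * I : ℂ)) * (Real.log n : ℂ) =
          ((-x * Real.log n : ℝ) : ℂ) + ((-(y * Real.log n) : ℝ) : ℂ) * I := by push_cast; ring
      rw [LSeries.term_of_ne_zero hn.ne', div_eq_mul_inv, ← Complex.cpow_neg, Complex.re_ofReal_mul,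
        ← Complex.ofReal_natCast, Complex.cpow_def_of_ne_zero (by exact_mod_cast hn'.ne'),
        ← Complex.ofReal_log hn'.le, mul_comm (Real.log n : ℂ), e, Complex.exp_add,
        ← Complex.ofReal_exp, Complex.re_ofReal_mul, Complex.exp_ofReal_mul_I_re, Real.cos_neg,
        Real.rpow_def_of_pos hn', mul_assoc, mul_comm (Real.log n)]
  have h0 := (key 0).mul_left 3
  have h1 := (key t).mul_left 4
  have h2 := key (2 * t)
  have h := ((h0.add h1).add h2)
  have hs := HasSum.nonneg (fun n : ℕ => by
    have e : Real.cos (2 * t * Real.log n) = 2 * Real.cos (t * Real.log n) ^ 2 - 1 := by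
      rw [mul_assoc, Real.cos_two_mul]
    have : 0 ≤ ArithmeticFunction.vonMangoldt n * (n : ℝ) ^ (-x) :=
      mul_nonneg ArithmeticFunction.vonMangoldt_nonneg (by positivity)
    have e2 : 3 * (ArithmeticFunction.vonMangoldt n * (n : ℝ) ^ (-x) * Real.cos (0 * Real.log n)) +
        4 * (ArithmeticFunction.vonMangoldt n * (n : ℝ) ^ (-x) * Real.cos (t * Real.log n)) +
        ArithmeticFunction.vonMangoldt n * (n : ℝ) ^ (-x) * Real.cos (2 * t * Real.log n) =
        (ArithmeticFunction.vonMangoldt n * (n : ℝ) ^ (-x)) *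
          (2 * (1 + Real.cos (t * Real.log n)) ^ 2) := by
      rw [e, zero_mul, Real.cos_zero]; ring
    rw [e2]
    positivity) h
  simp only [Complex.ofReal_zero, zero_mul, add_zero, Complex.ofReal_mul, Complex.ofReal_ofNat] at hs
  linarith

theorem re_div_riemannZeta_eq {s : ℂ} (hs : 1 < s.re) :
    (deriv riemannZeta s / riemannZeta s).re = (logDeriv xi (s - 1 / 2)).re - (1 / (s - 1)).re +
      Real.log Real.pi / 2 - (digamma (s / 2 + 1)).re / 2 := by
  have h := congrArg Complex.re (logDeriv_xi_sub_half hs)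
  have e3 : ((Real.log Real.pi : ℝ) : ℂ) / 2 = ((Real.log Real.pi / 2 : ℝ) : ℂ) := by push_cast; ring
  have e4 : ∀ w : ℂ, (w / 2).re = w.re / 2 := fun w => by simp
  rw [e3, Complex.add_re, Complex.add_re, Complex.sub_re, e4, Complex.ofReal_re] at h
  linarith

theorem neg_re_div_riemannZeta_le {u : ℝ} (hu : 0 < u) :
    -(deriv riemannZeta (1 + u : ℝ) / riemannZeta (1 + u : ℝ)).re ≤
      1 / u - Real.log Real.pi / 2 + (Real.log ((3 + u) / 2) - 1 / (3 + u)) / 2 := by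
  rw [re_div_riemannZeta_eq (by rw [Complex.ofReal_re]; linarith)]
  have h1 := isXiLike_xi.sum_le_re_logDeriv (z := (1 + u : ℝ) - 1 / 2) (by simp; linarith) ∅
  have h2 := digamma_ofReal_le (x := (3 + u) / 2) (by positivity)
  have e1 : (1 : ℂ) / ((1 + u : ℝ) - 1) = ((1 / u : ℝ) : ℂ) := by push_cast; congr 1; ring
  have e2 : ((1 + u : ℝ) : ℂ) / 2 + 1 = ((3 + u) / 2 : ℝ) := by push_cast; ring
  rw [e1, e2, Complex.ofReal_re]
  rw [Finset.sum_empty] at h1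
  rw [mul_div_cancel₀ _ (two_ne_zero' ℝ)] at h2
  linarith

theorem neg_re_div_riemannZeta_add_le {u t : ℝ} (hu : 0 < u) (ht : 0 < t) :
    -(deriv riemannZeta ((1 + u : ℝ) + t * I) / riemannZeta ((1 + u : ℝ) + t * I)).re ≤
      u / t ^ 2 - Real.log Real.pi / 2 +
        (Real.log (t / 2) + (3 + u) ^ 2 / (2 * t ^ 2) + Real.pi / (2 * t)) / 2 -
        (logDeriv xi ((1 / 2 + u : ℝ) + t * I)).re := by
  rw [re_div_riemannZeta_eq (by simpa)]
  have e0 : ((1 + u : ℝ) : ℂ) + t * I - 1 / 2 = (1 / 2 + u : ℝ) + t * I := by push_cast; ring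
  have e1 : ((1 : ℂ) / ((1 + u : ℝ) + t * I - 1)).re ≤ u / t ^ 2 := by
    rw [show ((1 + u : ℝ) : ℂ) + t * I - 1 = u + t * I by push_cast; ring, one_div, Complex.inv_re,
      Complex.normSq_add_mul_I]
    simp only [add_re, ofReal_re, mul_re, I_re, mul_zero, ofReal_im, I_im, mul_one, sub_self, add_zero]
    gcongr
    nlinarith
  have h2 := digamma_re_le (z := ((1 + u : ℝ) + t * I) / 2 + 1) (by simp; linarith) (by simpa)
  have e2 : (((1 + u : ℝ) + t * I : ℂ) / 2 + 1).im = t / 2 := by simp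
  have e3 : Real.log ‖((1 + u : ℝ) + t * I : ℂ) / 2 + 1‖ ≤
      Real.log (t / 2) + (3 + u) ^ 2 / (2 * t ^ 2) := by
    rw [show ((1 + u : ℝ) + t * I : ℂ) / 2 + 1 = ((3 + u) / 2 : ℝ) + (t / 2 : ℝ) * I by
      push_cast; ring, Complex.norm_add_mul_I, Real.log_sqrt (by positivity),
      show ((3 + u) / 2) ^ 2 + (t / 2) ^ 2 = (t / 2) ^ 2 * (1 + (3 + u) ^ 2 / t ^ 2) by
        field_simp; ring, Real.log_mul (by positivity) (by positivity), Real.log_pow]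
    have := Real.log_le_sub_one_of_pos (x := 1 + (3 + u) ^ 2 / t ^ 2) (by positivity)
    have e4 : (3 + u) ^ 2 / (2 * t ^ 2) = (3 + u) ^ 2 / t ^ 2 / 2 := by field_simp
    push_cast
    linarith
  rw [e2] at h2
  rw [e0]
  have e5 : Real.pi / (4 * (t / 2)) = Real.pi / (2 * t) := by congr 1; ring
  linarith

theorem add_le_re_logDeriv_xi {a : ℂ} (ha : xi a = 0) (hre : 0 < a.re) {u : ℝ} (hu : 0 < u) :
    1 / (1 / 2 + u - a.re) + 1 / (1 / 2 + u + a.re) ≤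
      (logDeriv xi ((1 / 2 + u : ℝ) + a.im * I)).re := by
  have hs := (abs_lt.1 (isXiLike_xi.strip a ha)).2
  have ha' : xi (-starRingEnd ℂ a) = 0 := by rw [xi_neg, xi_conj, ha, map_zero]
  have hne : (⟨a, ha⟩ : {a : ℂ // xi a = 0}) ≠ ⟨-starRingEnd ℂ a, ha'⟩ := by
    intro h
    have := congrArg Complex.re (Subtype.ext_iff.1 h)
    simp at this
    linarith
  have h := isXiLike_xi.sum_le_re_logDeriv (z := (1 / 2 + u : ℝ) + a.im * I) (by simp; linarith)
    {⟨a, ha⟩, ⟨-starRingEnd ℂ a, ha'⟩}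
  rw [Finset.sum_pair hne] at h
  have e1 : (1 : ℂ) / ((1 / 2 + u : ℝ) + a.im * I - a) = ((1 / (1 / 2 + u - a.re) : ℝ) : ℂ) := by
    have := Complex.re_add_im a
    push_cast
    congr 1
    linear_combination this
  have e2 : (1 : ℂ) / ((1 / 2 + u : ℝ) + a.im * I - (-starRingEnd ℂ a)) =
      ((1 / (1 / 2 + u + a.re) : ℝ) : ℂ) := by
    have := Complex.re_add_im (starRingEnd ℂ a)
    rw [Complex.conj_re, Complex.conj_im] at this
    push_cast at this ⊢
    congr 1
    linear_combination -this
  simp only [e1, e2, Complex.ofReal_re] at h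
  have m1 := one_le_xiOrder ⟨a, ha⟩
  have m2 := one_le_xiOrder ⟨-starRingEnd ℂ a, ha'⟩
  rw [xiOrder] at m1 m2
  have p1 : 0 ≤ 1 / (1 / 2 + u - a.re) := one_div_nonneg.2 (by linarith)
  have p2 : 0 ≤ 1 / (1 / 2 + u + a.re) := one_div_nonneg.2 (by linarith)
  have := le_mul_of_one_le_left p1 m1
  have := le_mul_of_one_le_left p2 m2
  linarith

theorem zero_free_aux {a : ℂ} (ha : xi a = 0) (hre : 0.44 ≤ a.re) (him : 0 < a.im) :
    0.07179 / (1 / 2 - a.re) ≤ 2.5 * Real.log a.im - 8.6229 +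
      13.9 / a.im ^ 2 + 3.5343 / a.im := by
  have hs := (abs_lt.1 (isXiLike_xi.strip a ha)).2
  set δ := 1 / 2 - a.re with hδ
  have hδ0 : 0 < δ := by linarith
  have hδ1 : δ ≤ 0.06 := by norm_num at hre hδ ⊢; linarith
  set t := a.im
  have hsq : (3 + 6.5 * δ) ^ 2 ≤ 3.39 ^ 2 := by
    gcongr
    norm_num at hδ1 ⊢
    linarith only [hδ1]
  have h1 := neg_re_div_riemannZeta_le (u := 6.5 * δ) (by positivity)
  have h2 := neg_re_div_riemannZeta_add_le (u := 6.5 * δ) (t := t) (by positivity) him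
  have h3 := neg_re_div_riemannZeta_add_le (u := 6.5 * δ) (t := 2 * t) (by positivity) (by positivity)
  have h4 := add_le_re_logDeriv_xi ha (by norm_num at hre; linarith) (u := 6.5 * δ) (by positivity)
  have h5 := isXiLike_xi.sum_le_re_logDeriv (z := (1 / 2 + 6.5 * δ : ℝ) + (2 * t : ℝ) * I)
    (by simp; positivity) ∅
  rw [Finset.sum_empty] at h5
  have h6 := three_four_one_nonneg (x := 1 + 6.5 * δ) (by linarith) t
  rw [show (2 : ℂ) * (t : ℂ) = ((2 * t : ℝ) : ℂ) by push_cast; ring] at h6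
  have e1 : 1 / (1 / 2 + 6.5 * δ - a.re) = 1 / (7.5 * δ) := by congr 1; rw [hδ]; ring
  have e2 : 1 / (1 / 2 + 6.5 * δ + a.re) = 1 / (1 + 5.5 * δ) := by congr 1; rw [hδ]; ring
  rw [e1, e2] at h4
  have e3 : 1 / 1.33 ≤ 1 / (1 + 5.5 * δ) := by gcongr; norm_num at hδ1 ⊢; linarith
  have e4 : 0.07179 / δ ≤ 4 * (1 / (7.5 * δ)) - 3 * (1 / (6.5 * δ)) := by
    have : 4 * (1 / (7.5 * δ)) - 3 * (1 / (6.5 * δ)) = (4 / 7.5 - 3 / 6.5) / δ := by field_simp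
    rw [this]
    gcongr
    norm_num
  have e5 : Real.log ((3 + 6.5 * δ) / 2) ≤ 0.5278 := by
    have b1 : (3 + 6.5 * δ) / 2 ≤ 3 ^ 3 / 2 ^ 4 * (1 + 0.0045) := by norm_num at hδ1 ⊢; linarith
    have b2 := Real.log_le_log (by positivity) b1
    have b4 : Real.log (3 ^ 3 / 2 ^ 4 * (1 + 0.0045)) =
        3 * Real.log 3 - 4 * Real.log 2 + Real.log (1 + 0.0045) := by
      rw [Real.log_mul (by norm_num) (by norm_num), Real.log_div (by norm_num) (by norm_num),
        Real.log_pow, Real.log_pow]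
      norm_num
    rw [b4] at b2
    have b3 := Real.log_le_sub_one_of_pos (x := 1 + 0.0045) (by norm_num)
    have := Real.log_three_lt_d9
    have := Real.log_two_gt_d9
    norm_num at b3
    linarith
  have e6 : 1 / 3.39 ≤ 1 / (3 + 6.5 * δ) := by gcongr; norm_num at hδ1 ⊢; linarith
  have e7 : 1.1446 ≤ Real.log Real.pi := by
    have b0 := Real.pi_gt_d4
    have b1 := Real.log_le_log (x := 3 * (1 + 0.0471)) (by norm_num) (y := Real.pi) (by linarith)
    rw [Real.log_mul (by norm_num) (by norm_num)] at b1
    have b2 := Real.le_log_one_add_of_nonneg (x := 0.0471) (by norm_num)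
    have := Real.log_three_gt_d9
    norm_num at b1 b2
    linarith
  have e8 : Real.log (t / 2) = Real.log t - Real.log 2 := Real.log_div him.ne' two_ne_zero
  have e9 : Real.log (2 * t / 2) = Real.log t := by congr 1; ring
  have e10 := Real.log_two_gt_d9
  rw [e8] at h2
  rw [e9] at h3
  have e11 : Real.pi / (2 * t) = Real.pi / 2 * (1 / t) := by ring
  have e12 : Real.pi / (2 * (2 * t)) = Real.pi / 4 * (1 / t) := by ring
  have e13 : 3.5343 / t = 3.5343 * (1 / t) := by ring
  have e14 : (3 + 6.5 * δ) ^ 2 / (2 * t ^ 2) ≤ 5.75 * (1 / t ^ 2) := by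
    rw [show (3 + 6.5 * δ) ^ 2 / (2 * t ^ 2) = (3 + 6.5 * δ) ^ 2 / 2 * (1 / t ^ 2) by field_simp]
    gcongr
    norm_num at hsq ⊢
    linarith only [hsq]
  have e15 : (3 + 6.5 * δ) ^ 2 / (2 * (2 * t) ^ 2) ≤ 1.4375 * (1 / t ^ 2) := by
    rw [show (3 + 6.5 * δ) ^ 2 / (2 * (2 * t) ^ 2) = (3 + 6.5 * δ) ^ 2 / 8 * (1 / t ^ 2) by
      field_simp; ring]
    gcongr
    norm_num at hsq ⊢
    linarith only [hsq]
  have e16 : 6.5 * δ / t ^ 2 ≤ 0.39 * (1 / t ^ 2) := by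
    rw [show 6.5 * δ / t ^ 2 = 6.5 * δ * (1 / t ^ 2) by field_simp]
    gcongr
    norm_num at hδ1 ⊢
    linarith only [hδ1]
  have e17 : 6.5 * δ / (2 * t) ^ 2 ≤ 0.1 * (1 / t ^ 2) := by
    rw [show 6.5 * δ / (2 * t) ^ 2 = 6.5 * δ / 4 * (1 / t ^ 2) by field_simp; norm_num]
    gcongr
    norm_num at hδ1 ⊢
    linarith only [hδ1]
  have e18 : 13.9 / t ^ 2 = 13.9 * (1 / t ^ 2) := by ring
  have e20 : 0 < 1 / t ^ 2 := by positivity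
  have e19 : Real.pi * (1 / t) ≤ 3.1416 * (1 / t) := by
    gcongr
    exact Real.pi_lt_d4.le
  rw [e11] at h2
  rw [e12] at h3
  rw [e13, e18]
  change _ ≤ (logDeriv xi (((1 / 2 + 6.5 * δ : ℝ) : ℂ) + t * I)).re at h4
  generalize (logDeriv xi (((1 / 2 + 6.5 * δ : ℝ) : ℂ) + t * I)).re = A₁ at h2 h4
  generalize (logDeriv xi (((1 / 2 + 6.5 * δ : ℝ) : ℂ) + (2 * t : ℝ) * I)).re = A₂ at h3 h5
  generalize (deriv riemannZeta (1 + 6.5 * δ : ℝ) / riemannZeta (1 + 6.5 * δ : ℝ)).re = B₀ at h1 h6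
  generalize (deriv riemannZeta ((1 + 6.5 * δ : ℝ) + t * I) /
    riemannZeta ((1 + 6.5 * δ : ℝ) + t * I)).re = B₁ at h2 h6
  generalize (deriv riemannZeta ((1 + 6.5 * δ : ℝ) + (2 * t : ℝ) * I) /
    riemannZeta ((1 + 6.5 * δ : ℝ) + (2 * t : ℝ) * I)).re = B₂ at h3 h6
  generalize 0.07179 / δ = C₀ at e4 ⊢
  generalize 1 / (7.5 * δ) = C₁ at e4 h4
  generalize 1 / (6.5 * δ) = C₂ at e4 h1
  generalize 1 / (1 + 5.5 * δ) = C₃ at e3 h4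
  generalize 1 / (3 + 6.5 * δ) = C₄ at e6 h1
  generalize 1 / t ^ 2 = R at *
  generalize 1 / t = r at *
  generalize (3 + 6.5 * δ) ^ 2 / (2 * t ^ 2) = D₁ at *
  generalize (3 + 6.5 * δ) ^ 2 / (2 * (2 * t) ^ 2) = D₂ at *
  generalize 6.5 * δ / t ^ 2 = D₃ at *
  generalize 6.5 * δ / (2 * t) ^ 2 = D₄ at *
  generalize Real.log ((3 + 6.5 * δ) / 2) = D₅ at *
  have e21 : 0 ≤ r * Real.pi - Real.pi * r := by rw [mul_comm, sub_self]
  clear e1 e2 hδ hδ0 hδ1 hsq e11 e12 e13 e18 e8 e9 hre hs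
  linarith

theorem zero_free_of_pos {a : ℂ} (ha : xi a = 0) (hre : 0.44 ≤ a.re) (him : 0 < a.im) :
    0.07179 / (1 / 2 - a.re) ≤ 2.5 * zeroWeight a.im := by
  have h := zero_free_aux ha hre him
  have hs := (abs_lt.1 (isXiLike_xi.strip a ha)).2
  have hsq := le_im_sq_of_xi_eq_zero ha
  set t := a.im
  have h1 : 1.19 ≤ 0.07179 / (1 / 2 - a.re) := by
    rw [le_div_iff₀ (by linarith)]
    norm_num at hre ⊢
    linarith
  have l2 := Real.log_two_lt_d9
  have l3 := Real.log_three_lt_d9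
  have ht6 : 6.5 ≤ t := by
    by_contra! hlt
    norm_num at hlt hsq
    nlinarith
  have ht : 18 ≤ t := by
    by_contra! hlt
    have e1 := Real.log_le_log him hlt.le
    rw [show (18 : ℝ) = 2 * 3 ^ 2 by norm_num, Real.log_mul (by norm_num) (by norm_num),
      Real.log_pow] at e1
    have e2 : 13.9 / t ^ 2 ≤ 0.33 := by
      rw [div_le_iff₀ (by positivity)]
      linarith
    have e3 : 3.5343 / t ≤ 0.55 := by
      rw [div_le_iff₀ him]
      linarith
    push_cast at e1
    linarith
  have e2 : 13.9 / t ^ 2 ≤ 0.043 := by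
    rw [div_le_iff₀ (by positivity)]
    nlinarith
  have e3 : 3.5343 / t ≤ 0.197 := by
    rw [div_le_iff₀ him]
    linarith
  have e4 : 2 * Real.log t - 2 * Real.log 28 ≤ Real.log (1 + t ^ 2 / 28 ^ 2) := by
    have : 2 * Real.log t - 2 * Real.log 28 = Real.log (t ^ 2 / 28 ^ 2) := by
      rw [Real.log_div (by positivity) (by positivity), Real.log_pow, Real.log_pow]
      norm_num
    rw [this]
    exact Real.log_le_log (by positivity) (by linarith)
  have e5 : Real.log 28 ≤ 3.333 := by
    have b1 : Real.log 28 = 3 * Real.log 3 + Real.log (28 / 27) := by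
      rw [show (28 : ℝ) = 3 ^ 3 * (28 / 27) by norm_num, Real.log_mul (by norm_num) (by norm_num),
        Real.log_pow]
      norm_num
    have b2 := Real.log_le_sub_one_of_pos (x := 28 / 27) (by norm_num)
    rw [b1]
    norm_num at b2 l3 ⊢
    linarith
  unfold zeroWeight
  linarith

theorem zeroWeight_neg (g : ℝ) : zeroWeight (-g) = zeroWeight g := by
  unfold zeroWeight
  rw [neg_sq]

theorem zero_free {a : ℂ} (ha : xi a = 0) (hre : 0.44 ≤ a.re) :
    0.07179 / (1 / 2 - a.re) ≤ 2.5 * zeroWeight a.im := by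
  have hsq := le_im_sq_of_xi_eq_zero ha
  rcases lt_trichotomy a.im 0 with h | h | h
  · have := zero_free_of_pos (a := starRingEnd ℂ a) (by rw [xi_conj, ha, map_zero]) (by simpa)
      (by simpa)
    rwa [Complex.conj_re, Complex.conj_im, zeroWeight_neg] at this
  · rw [h] at hsq; norm_num at hsq
  · exact zero_free_of_pos ha hre h

/-- The dominating function `t ^ (-3 / 2)` on `(0, 1]`. -/
noncomputable def unitWeight : ℝ → ℝ := indicator (Ioc 0 1) fun t => t ^ (-(3 / 2) : ℝ)

theorem integrableOn_unitWeight : MeasureTheory.IntegrableOn (fun t => t * unitWeight t) (Ioi 0) := by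
  have h : MeasureTheory.IntegrableOn (fun t : ℝ => t ^ (-(1 / 2) : ℝ)) (Ioc 0 1) := by
    have := intervalIntegral.intervalIntegrable_rpow' (a := 0) (b := 1) (r := -(1 / 2)) (by norm_num)
    rwa [intervalIntegrable_iff_integrableOn_Ioc_of_le zero_le_one] at this
  have h2 : MeasureTheory.Integrable (indicator (Ioc 0 1) fun t : ℝ => t ^ (-(1 / 2) : ℝ)) :=
    h.integrable_indicator measurableSet_Ioc
  refine h2.integrableOn.congr_fun (fun t ht => ?_) measurableSet_Ioi
  have ht' : (0 : ℝ) < t := ht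
  unfold unitWeight
  by_cases h1 : t ∈ Ioc (0 : ℝ) 1
  · simp only [indicator_of_mem h1]
    rw [show (-(1 / 2) : ℝ) = 1 + -(3 / 2) by norm_num, Real.rpow_add ht', Real.rpow_one]
  · simp only [indicator_of_notMem h1, mul_zero]

theorem hasMellin_tsum {ι : Type*} [Countable ι] {g : ι → ℝ → ℂ} {c : ι → ℝ} (hc : Summable c)
    (hb : ∀ i t, 0 < t → ‖g i t‖ ≤ c i * unitWeight t) {s : ℂ} (hs : s.re = 2) {M : ι → ℂ}
    (hM : ∀ i, HasMellin (g i) s (M i)) :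
    HasMellin (fun t => ∑' i, g i t) s (∑' i, M i) := by
  have hF : ∀ i, ∀ t ∈ Ioi (0 : ℝ), ‖(t : ℂ) ^ (s - 1) • g i t‖ ≤ c i * (t * unitWeight t) := by
    intro i t ht
    have ht' : (0 : ℝ) < t := ht
    rw [norm_smul, Complex.norm_cpow_eq_rpow_re_of_pos ht']
    have : (s - 1).re = 1 := by rw [Complex.sub_re, hs, Complex.one_re]; norm_num
    rw [this, Real.rpow_one]
    calc _ ≤ t * (c i * unitWeight t) := by gcongr; exact hb i t ht'
      _ = _ := by ring
  have hInt := fun i => (hM i).1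
  have hsum : Summable fun i => ∫ t in Ioi (0 : ℝ), ‖(t : ℂ) ^ (s - 1) • g i t‖ := by
    refine Summable.of_nonneg_of_le (fun i => by positivity) (fun i => ?_)
      (hc.mul_right (∫ t in Ioi (0 : ℝ), t * unitWeight t))
    rw [← MeasureTheory.integral_const_mul]
    exact MeasureTheory.setIntegral_mono_on (hInt i).norm (integrableOn_unitWeight.const_mul _)
      measurableSet_Ioi (hF i)
  have h1 := MeasureTheory.hasSum_integral_of_summable_integral_norm hInt hsum
  have e : ∀ t ∈ Ioi (0 : ℝ), ∑' i, (t : ℂ) ^ (s - 1) • g i t = (t : ℂ) ^ (s - 1) • ∑' i, g i t :=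
    fun t _ => by simp only [smul_eq_mul, tsum_mul_left]
  refine ⟨?_, ?_⟩
  · have hmeas : MeasureTheory.AEStronglyMeasurable (fun t : ℝ => ∑' i, (t : ℂ) ^ (s - 1) • g i t)
        (MeasureTheory.volume.restrict (Ioi 0)) := by
      refine aestronglyMeasurable_of_tendsto_ae atTop (f := fun T : Finset ι => fun t : ℝ =>
        ∑ i ∈ T, (t : ℂ) ^ (s - 1) • g i t) (fun T => ?_) ?_
      · exact Finset.aestronglyMeasurable_fun_sum T fun i _ => (hInt i).1
      · refine (MeasureTheory.ae_restrict_mem measurableSet_Ioi).mono fun t ht => ?_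
        exact (Summable.of_norm_bounded (hc.mul_right _) fun i => hF i t ht).hasSum
    have : MeasureTheory.IntegrableOn (fun t : ℝ => ∑' i, (t : ℂ) ^ (s - 1) • g i t) (Ioi 0) := by
      refine (integrableOn_unitWeight.const_mul (∑' i, c i)).mono' hmeas ?_
      refine (MeasureTheory.ae_restrict_mem measurableSet_Ioi).mono fun t ht => ?_
      rw [← tsum_mul_right]
      exact tsum_of_norm_bounded ((hc.mul_right _).hasSum) fun i => hF i t ht
    exact this.congr_fun e measurableSet_Ioi
  · rw [mellin, ← MeasureTheory.setIntegral_congr_fun measurableSet_Ioi e, ← h1.tsum_eq]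
    exact tsum_congr fun i => (hM i).2

theorem continuousAt_tsum_of_unitWeight {ι : Type*} {g : ι → ℝ → ℂ} {c : ι → ℝ} (hc : Summable c)
    (hb : ∀ i t, 0 < t → ‖g i t‖ ≤ c i * unitWeight t)
    (hg : ∀ i, ContinuousOn (g i) (Ioo 0 1)) {t : ℝ} (ht : t ∈ Ioo (0 : ℝ) 1) :
    ContinuousAt (fun t => ∑' i, g i t) t := by
  have h0 : 0 < t / 2 := by linarith [ht.1]
  have h : ContinuousOn (fun t => ∑' i, g i t) (Ioo (t / 2) 1) := by
    refine continuousOn_tsum (u := fun i => |c i| * (t / 2) ^ (-(3 / 2) : ℝ))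
      (fun i => (hg i).mono (Ioo_subset_Ioo_left h0.le)) (hc.abs.mul_right _) fun i x hx => ?_
    have hx0 : 0 < x := h0.trans hx.1
    have e : unitWeight x = x ^ (-(3 / 2) : ℝ) :=
      indicator_of_mem (s := Ioc 0 1) ⟨hx0, hx.2.le⟩ _
    have h1 := hb i x hx0
    rw [e] at h1
    calc _ ≤ c i * x ^ (-(3 / 2) : ℝ) := h1
      _ ≤ |c i| * x ^ (-(3 / 2) : ℝ) := by gcongr; exact le_abs_self _
      _ ≤ _ := by
        exact mul_le_mul_of_nonneg_left
          (Real.rpow_le_rpow_of_nonpos h0 hx.1.le (by norm_num)) (abs_nonneg _)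
  exact h.continuousAt (Ioo_mem_nhds (by linarith) ht.2)

/-- The function `log (1 / t)` on `(0, 1]`, extended by zero. -/
noncomputable def unitLog : ℝ → ℂ := indicator (Ioc 0 1) fun t => ((-Real.log t : ℝ) : ℂ)

theorem hasMellin_unitLog {s : ℂ} (hs : 0 < s.re) : HasMellin unitLog s (1 / s ^ 2) := by
  set f : ℝ → ℂ := indicator (Ioc 0 1) fun _ => 1 with hf
  have hloc : MeasureTheory.LocallyIntegrableOn f (Ioi 0) := by
    refine MeasureTheory.IntegrableOn.locallyIntegrableOn ?_
    have : MeasureTheory.Integrable f := by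
      refine (MeasureTheory.integrable_indicator_iff measurableSet_Ioc).2 ?_
      exact MeasureTheory.integrableOn_const (by simp)
    exact this.integrableOn
  have htop : f =O[atTop] (· ^ (-(s.re + 1)) : ℝ → ℝ) := by
    refine Asymptotics.IsBigO.of_bound 0 ?_
    filter_upwards [eventually_gt_atTop 1] with t ht
    rw [hf, indicator_of_notMem (fun h => absurd h.2 (not_le.2 ht))]
    simp
  have hbot : f =O[𝓝[>] 0] (· ^ (-(0 : ℝ)) : ℝ → ℝ) := by
    refine Asymptotics.IsBigO.of_bound 1 (Eventually.of_forall fun t => ?_)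
    rw [neg_zero, Real.rpow_zero, norm_one, hf]
    by_cases h : t ∈ Ioc (0 : ℝ) 1 <;> simp [indicator, h]
  have h := mellin_hasDerivAt_of_isBigO_rpow hloc htop (by linarith) hbot hs
  have hs0 : s ≠ 0 := by rintro rfl; simp at hs
  have hd : HasDerivAt (mellin f) (-(1 / s ^ 2)) s := by
    have h1 : HasDerivAt (fun s : ℂ => 1 / s) (-(1 / s ^ 2)) s := by
      have := hasDerivAt_inv hs0
      simpa [one_div] using this
    refine h1.congr_of_eventuallyEq ?_
    filter_upwards [(isOpen_lt continuous_const Complex.continuous_re).mem_nhds hs] with w hw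
    exact (hasMellin_one_Ioc hw).2
  have e : unitLog = fun t => (-1 : ℂ) • (Real.log t • f t) := by
    funext t
    unfold unitLog
    by_cases ht : t ∈ Ioc (0 : ℝ) 1
    · simp [hf, indicator_of_mem ht]
    · simp [hf, indicator_of_notMem ht]
  rw [e]
  have := hasMellin_const_smul h.1 (-1 : ℂ)
  rwa [h.2.unique hd, smul_eq_mul, neg_one_mul, neg_neg] at this

theorem hasMellin_unitLog_mul {n : ℝ} (hn : 0 < n) {s : ℂ} (hs : 0 < s.re) :
    HasMellin (fun t => unitLog (n * t)) s ((n : ℂ) ^ (-s) * (1 / s ^ 2)) := by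
  have h := hasMellin_unitLog hs
  refine ⟨(MellinConvergent.comp_mul_left hn).2 h.1, ?_⟩
  rw [mellin_comp_mul_left _ _ hn, h.2, smul_eq_mul]

/-- The function `(t ^ (-ρ) - 1 + ρ log t) / ρ ^ 2` on `(0, 1]`, extended by zero. -/
noncomputable def unitRemainder (ρ : ℂ) : ℝ → ℂ :=
  indicator (Ioc 0 1) fun t => ((t : ℂ) ^ (-ρ) - 1 + ρ * Real.log t) / ρ ^ 2

theorem HasMellin.add' {f g : ℝ → ℂ} {s a b : ℂ} (hf : HasMellin f s a) (hg : HasMellin g s b) :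
    HasMellin (fun t => f t + g t) s (a + b) := by
  have := hasMellin_add hf.1 hg.1
  rwa [hf.2, hg.2] at this

theorem HasMellin.const_mul' {f : ℝ → ℂ} {s a : ℂ} (hf : HasMellin f s a) (c : ℂ) :
    HasMellin (fun t => c * f t) s (c * a) := by
  have := hasMellin_const_smul hf.1 c
  rwa [hf.2] at this

theorem hasMellin_unitRemainder {ρ s : ℂ} (hρ : ρ ≠ 0) (hs : 0 < s.re) (h : ρ.re < s.re) :
    HasMellin (unitRemainder ρ) s (1 / (s ^ 2 * (s - ρ))) := by
  have h1 := hasMellin_cpow_Ioc (-ρ) (s := s) (by rw [Complex.neg_re]; linarith)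
  have h2 := hasMellin_one_Ioc hs
  have h3 := hasMellin_unitLog hs
  have h4 := ((h1.add' (h2.const_mul' (-1))).add' (h3.const_mul' (-ρ))).const_mul' (1 / ρ ^ 2)
  have hs0 : s ≠ 0 := by rintro rfl; simp at hs
  have hsρ : s - ρ ≠ 0 := by
    intro h0
    have := congrArg Complex.re h0
    simp at this
    linarith
  have e : 1 / ρ ^ 2 * (1 / (s + -ρ) + -1 * (1 / s) + -ρ * (1 / s ^ 2)) =
      1 / (s ^ 2 * (s - ρ)) := by
    rw [← sub_eq_add_neg]
    field_simp
    ring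
  rw [e] at h4
  convert h4 using 1
  funext t
  unfold unitRemainder unitLog
  by_cases ht : t ∈ Ioc (0 : ℝ) 1
  · simp only [indicator_of_mem ht]
    push_cast
    ring
  · simp only [indicator_of_notMem ht]
    ring

/-- The function `(1 - t ^ k) / k ^ 2` on `(0, 1]`, extended by zero. -/
noncomputable def unitPow (k : ℝ) : ℝ → ℂ :=
  indicator (Ioc 0 1) fun t => (1 - (t : ℂ) ^ (k : ℂ)) / k ^ 2

theorem hasMellin_unitPow {k : ℝ} (hk : 0 < k) {s : ℂ} (hs : 0 < s.re) :
    HasMellin (unitPow k) s (1 / (k * (s * (s + k)))) := by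
  have h1 := hasMellin_cpow_Ioc (k : ℂ) (s := s) (by rw [Complex.ofReal_re]; linarith)
  have h2 := hasMellin_one_Ioc hs
  have h4 := (h2.add' (h1.const_mul' (-1))).const_mul' (1 / (k : ℂ) ^ 2)
  have hs0 : s ≠ 0 := by rintro rfl; simp at hs
  have hk0 : (k : ℂ) ≠ 0 := by exact_mod_cast hk.ne'
  have hsρ : s + k ≠ 0 := by
    intro h0
    have := congrArg Complex.re h0
    simp at this
    linarith
  have e : 1 / (k : ℂ) ^ 2 * (1 / s + -1 * (1 / (s + k))) = 1 / (k * (s * (s + k))) := by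
    field_simp
    ring
  rw [e] at h4
  convert h4 using 1
  funext t
  unfold unitPow
  by_cases ht : t ∈ Ioc (0 : ℝ) 1
  · simp only [indicator_of_mem ht]
    ring
  · simp only [indicator_of_notMem ht]
    ring

theorem one_le_unitWeight {t : ℝ} (ht : t ∈ Ioc (0 : ℝ) 1) : 1 ≤ unitWeight t := by
  rw [unitWeight, indicator_of_mem ht]
  exact Real.one_le_rpow_of_pos_of_le_one_of_nonpos ht.1 ht.2 (by norm_num)

theorem inv_le_unitWeight {t : ℝ} (ht : t ∈ Ioc (0 : ℝ) 1) : t⁻¹ ≤ unitWeight t := by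
  rw [unitWeight, indicator_of_mem ht, ← Real.rpow_neg_one]
  exact Real.rpow_le_rpow_of_exponent_ge ht.1 ht.2 (by norm_num)

theorem neg_log_le_unitWeight {t : ℝ} (ht : t ∈ Ioc (0 : ℝ) 1) : -Real.log t ≤ unitWeight t := by
  have h1 := Real.log_le_sub_one_of_pos (inv_pos.2 ht.1)
  rw [Real.log_inv] at h1
  linarith [inv_le_unitWeight ht]

theorem unitWeight_nonneg (t : ℝ) : 0 ≤ unitWeight t :=
  indicator_nonneg (fun _ h => Real.rpow_nonneg h.1.le _) t

theorem norm_unitLog_le (t : ℝ) : ‖unitLog t‖ ≤ unitWeight t := by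
  by_cases ht : t ∈ Ioc (0 : ℝ) 1
  · rw [unitLog, indicator_of_mem ht, Complex.norm_real, Real.norm_of_nonneg]
    · exact neg_log_le_unitWeight ht
    · linarith [Real.log_nonpos ht.1.le ht.2]
  · rw [unitLog, indicator_of_notMem ht, norm_zero]
    exact unitWeight_nonneg t

theorem unitWeight_mul_le {n t : ℝ} (hn : 1 ≤ n) (ht : 0 < t) :
    unitWeight (n * t) ≤ n ^ (-(3 / 2) : ℝ) * unitWeight t := by
  have hn0 : 0 < n := by linarith
  by_cases h : n * t ∈ Ioc (0 : ℝ) 1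
  · have ht1 : t ∈ Ioc (0 : ℝ) 1 := ⟨ht, by nlinarith [h.2]⟩
    rw [unitWeight, indicator_of_mem h, indicator_of_mem ht1, Real.mul_rpow hn0.le ht.le]
  · rw [unitWeight, indicator_of_notMem h]
    exact mul_nonneg (by positivity) (unitWeight_nonneg t)

theorem norm_unitPow_le {k : ℝ} (hk : 0 < k) (t : ℝ) :
    ‖unitPow k t‖ ≤ 1 / k ^ 2 * unitWeight t := by
  by_cases ht : t ∈ Ioc (0 : ℝ) 1
  · rw [unitPow, indicator_of_mem ht, ← Complex.ofReal_cpow ht.1.le]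
    have : (1 - ((t ^ k : ℝ) : ℂ)) / (k : ℂ) ^ 2 = (((1 - t ^ k) / k ^ 2 : ℝ) : ℂ) := by push_cast; rfl
    rw [this, Complex.norm_real]
    have h1 : t ^ k ≤ 1 := Real.rpow_le_one ht.1.le ht.2 hk.le
    have h2 : 0 ≤ t ^ k := Real.rpow_nonneg ht.1.le _
    rw [Real.norm_of_nonneg (div_nonneg (by linarith) (by positivity)), div_eq_mul_inv, mul_comm,
      one_div]
    gcongr
    linarith [one_le_unitWeight ht]
  · rw [unitPow, indicator_of_notMem ht, norm_zero]
    exact mul_nonneg (by positivity) (unitWeight_nonneg t)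

theorem norm_cpow_sub_one_div_le {ρ : ℂ} {t : ℝ} (ht : 0 < t) (h : ρ.im ≠ 0) :
    ‖((t : ℂ) ^ (-ρ) - 1) / ρ ^ 2‖ ≤ (t ^ (-ρ.re) + 1) / ρ.im ^ 2 := by
  rw [norm_div, norm_pow]
  have h1 : ρ.im ^ 2 ≤ ‖ρ‖ ^ 2 := by
    rw [← sq_abs]; gcongr; exact Complex.abs_im_le_norm ρ
  have h2 : ‖(t : ℂ) ^ (-ρ) - 1‖ ≤ t ^ (-ρ.re) + 1 := by
    refine (norm_sub_le _ _).trans ?_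
    rw [Complex.norm_cpow_eq_rpow_re_of_pos ht, norm_one, Complex.neg_re]
  exact div_le_div₀ (by positivity) h2 (by positivity) h1

/-- The contribution of a zero of `xi` to the smoothed explicit formula. -/
noncomputable def zeroTerm (a : {a : ℂ // xi a = 0}) (t : ℝ) : ℂ :=
  (xiOrder a : ℂ) * (1 / 2 * (unitRemainder (1 / 2 + a) t + unitRemainder (1 / 2 - a) t))

theorem summable_xiOrder_div_im_sq : Summable fun a : {a : ℂ // xi a = 0} => xiOrder a / a.1.im ^ 2 :=
  summable_of_sum_le (fun a => div_nonneg (xiOrder_nonneg a) (sq_nonneg _)) sum_xiOrder_div_im_sq_le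

theorem abs_re_lt_half (a : {a : ℂ // xi a = 0}) : |a.1.re| < 1 / 2 := isXiLike_xi.strip a a.2

theorem im_ne_zero (a : {a : ℂ // xi a = 0}) : a.1.im ≠ 0 := fun h => by
  have := im_sq_pos a
  simp [h] at this

theorem half_add_ne_zero (a : {a : ℂ // xi a = 0}) : (1 / 2 + a : ℂ) ≠ 0 := fun h => by
  have := congrArg Complex.im h
  simp at this
  exact im_ne_zero a this

theorem half_sub_ne_zero (a : {a : ℂ // xi a = 0}) : (1 / 2 - a : ℂ) ≠ 0 := fun h => by
  have := congrArg Complex.im h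
  simp at this
  exact im_ne_zero a this

theorem zeroTerm_eq (a : {a : ℂ // xi a = 0}) {t : ℝ} (ht : t ∈ Ioc (0 : ℝ) 1) :
    zeroTerm a t = xiOrder a / 2 * (((t : ℂ) ^ (-(1 / 2 + a) : ℂ) - 1) / (1 / 2 + a) ^ 2 +
      ((t : ℂ) ^ (-(1 / 2 - a) : ℂ) - 1) / (1 / 2 - a) ^ 2) +
      Real.log t * (xiOrder a * ((1 / 2) / ((1 / 2) ^ 2 - (a : ℂ) ^ 2))) := by
  have h1 := half_add_ne_zero a
  have h2 := half_sub_ne_zero a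
  have e : ((1 / 2) / ((1 / 2) ^ 2 - (a : ℂ) ^ 2)) = 1 / 2 * (1 / (1 / 2 + a) + 1 / (1 / 2 - a)) := by
    have : ((1 / 2) ^ 2 - (a : ℂ) ^ 2) = (1 / 2 + a) * (1 / 2 - a) := by ring
    rw [this, div_add_div _ _ h1 h2]
    ring
  rw [e, zeroTerm, unitRemainder, unitRemainder, indicator_of_mem ht, indicator_of_mem ht]
  generalize (t : ℂ) ^ (-(1 / 2 + a) : ℂ) = P
  generalize (t : ℂ) ^ (-(1 / 2 - a) : ℂ) = Q
  generalize (1 / 2 + a : ℂ) = ρ at *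
  generalize (1 / 2 - a : ℂ) = σ at *
  field_simp
  ring

theorem norm_zeroTerm_aux (a : {a : ℂ // xi a = 0}) {t : ℝ} (ht : t ∈ Ioc (0 : ℝ) 1) :
    ‖(xiOrder a : ℂ) / 2 * (((t : ℂ) ^ (-(1 / 2 + a) : ℂ) - 1) / (1 / 2 + a) ^ 2 +
      ((t : ℂ) ^ (-(1 / 2 - a) : ℂ) - 1) / (1 / 2 - a) ^ 2)‖ ≤
      xiOrder a / 2 * ((t ^ (-(1 / 2 + a.1.re)) + t ^ (-(1 / 2 - a.1.re)) + 2) / a.1.im ^ 2) := by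
  have h1 := norm_cpow_sub_one_div_le (ρ := 1 / 2 + a) ht.1 (by simpa using im_ne_zero a)
  have h2 := norm_cpow_sub_one_div_le (ρ := 1 / 2 - a) ht.1 (by simpa using im_ne_zero a)
  have e1 : (1 / 2 + a : ℂ).re = 1 / 2 + a.1.re := by simp
  have e2 : (1 / 2 - a : ℂ).re = 1 / 2 - a.1.re := by simp
  have e3 : (1 / 2 + a : ℂ).im = a.1.im := by simp
  have e4 : (1 / 2 - a : ℂ).im = -a.1.im := by simp
  rw [e1, e3] at h1
  rw [e2, e4, neg_sq] at h2
  rw [norm_mul, norm_div, Complex.norm_real, Real.norm_of_nonneg (xiOrder_nonneg a),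
    Complex.norm_two]
  refine mul_le_mul_of_nonneg_left ?_ (div_nonneg (xiOrder_nonneg a) two_pos.le)
  refine (norm_add_le _ _).trans ((add_le_add h1 h2).trans (le_of_eq ?_))
  rw [← add_div]
  congr 1
  ring

theorem norm_half_div_le (a : {a : ℂ // xi a = 0}) :
    ‖(1 / 2 : ℂ) / ((1 / 2) ^ 2 - (a : ℂ) ^ 2)‖ ≤ 1 / 2 / a.1.im ^ 2 := by
  have h : a.1.im ^ 2 ≤ ‖(1 / 2 : ℂ) ^ 2 - (a : ℂ) ^ 2‖ := by
    refine le_trans ?_ (Complex.re_le_norm _)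
    have hb := abs_lt.1 (abs_re_lt_half a)
    have : ((1 / 2 : ℂ) ^ 2 - (a : ℂ) ^ 2).re = 1 / 4 - (a.1.re ^ 2 - a.1.im ^ 2) := by
      rw [Complex.sub_re, sq (a : ℂ), Complex.mul_re]
      norm_num
      ring
    rw [this]
    nlinarith
  rw [norm_div]
  refine div_le_div₀ (by norm_num) (by norm_num) (im_sq_pos a) h

theorem norm_zeroTerm_le (a : {a : ℂ // xi a = 0}) (t : ℝ) :
    ‖zeroTerm a t‖ ≤ 5 / 2 * (xiOrder a / a.1.im ^ 2) * unitWeight t := by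
  have hb := abs_lt.1 (abs_re_lt_half a)
  have h0 := xiOrder_nonneg a
  by_cases ht : t ∈ Ioc (0 : ℝ) 1
  · rw [zeroTerm_eq a ht]
    refine (norm_add_le _ _).trans ?_
    have h1 := norm_zeroTerm_aux a ht
    have w1 := one_le_unitWeight ht
    have w2 := inv_le_unitWeight ht
    have w3 := neg_log_le_unitWeight ht
    have p : ∀ b : ℝ, b ≤ 1 → t ^ (-b) ≤ unitWeight t := fun b hb => by
      refine le_trans ?_ w2
      rw [← Real.rpow_neg_one]
      exact Real.rpow_le_rpow_of_exponent_ge ht.1 ht.2 (by linarith)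
    have h2 : xiOrder a / 2 * ((t ^ (-(1 / 2 + a.1.re)) + t ^ (-(1 / 2 - a.1.re)) + 2) / a.1.im ^ 2)
        ≤ xiOrder a / 2 * (4 * unitWeight t / a.1.im ^ 2) := by
      gcongr
      linarith [p (1 / 2 + a.1.re) (by linarith), p (1 / 2 - a.1.re) (by linarith)]
    have h3 : ‖(Real.log t : ℂ) * (xiOrder a * ((1 / 2) / ((1 / 2) ^ 2 - (a : ℂ) ^ 2)))‖ ≤
        unitWeight t * (xiOrder a * (1 / 2 / a.1.im ^ 2)) := by
      rw [norm_mul, norm_mul, Complex.norm_real, Complex.norm_real, Real.norm_of_nonneg h0,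
        Real.norm_of_nonpos (Real.log_nonpos ht.1.le ht.2)]
      gcongr
      exact norm_half_div_le a
    refine (add_le_add (h1.trans h2) h3).trans (le_of_eq ?_)
    ring
  · rw [zeroTerm, unitRemainder, unitRemainder, indicator_of_notMem ht, indicator_of_notMem ht]
    simp only [add_zero, mul_zero, norm_zero]
    exact mul_nonneg (by positivity) (unitWeight_nonneg t)

theorem hasMellin_zeroTerm (a : {a : ℂ // xi a = 0}) {s : ℂ} (hs : s.re = 2) :
    HasMellin (zeroTerm a) s
      (1 / s ^ 2 * (xiOrder a * ((s - 1 / 2) / ((s - 1 / 2) ^ 2 - (a : ℂ) ^ 2)))) := by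
  have hb := abs_lt.1 (abs_re_lt_half a)
  have h1 := hasMellin_unitRemainder (s := s) (half_add_ne_zero a) (by rw [hs]; norm_num)
    (by simp [hs]; linarith)
  have h2 := hasMellin_unitRemainder (s := s) (half_sub_ne_zero a) (by rw [hs]; norm_num)
    (by simp [hs]; linarith)
  have h := ((h1.add' h2).const_mul' (1 / 2)).const_mul' (xiOrder a)
  have n1 : s - (1 / 2 + a) ≠ 0 := fun h0 => by
    have := congrArg Complex.re h0
    simp [hs] at this
    linarith
  have n2 : s - (1 / 2 - a) ≠ 0 := fun h0 => by
    have := congrArg Complex.re h0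
    simp [hs] at this
    linarith
  have n3 : s ≠ 0 := by rintro rfl; simp at hs
  have e : (s - 1 / 2) ^ 2 - (a : ℂ) ^ 2 = (s - (1 / 2 + a)) * (s - (1 / 2 - a)) := by ring
  have e2 : 1 / s ^ 2 * (xiOrder a * ((s - 1 / 2) / ((s - 1 / 2) ^ 2 - (a : ℂ) ^ 2))) =
      xiOrder a * (1 / 2 * (1 / (s ^ 2 * (s - (1 / 2 + a))) + 1 / (s ^ 2 * (s - (1 / 2 - a))))) := by
    have : s - 1 / 2 = ((s - (1 / 2 + a)) + (s - (1 / 2 - a))) / 2 := by ring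
    rw [e, this]
    generalize s - (1 / 2 + (a : ℂ)) = p at *
    generalize s - (1 / 2 - (a : ℂ)) = q at *
    field_simp
    ring
  rw [e2]
  exact h

theorem hasSum_logDeriv_xi {z : ℂ} (hz : 1 / 2 ≤ z.re) :
    HasSum (fun a : {a : ℂ // xi a = 0} => (xiOrder a : ℂ) * (z / (z ^ 2 - (a : ℂ) ^ 2)))
      (logDeriv xi z) := by
  have h := isXiLike_xi.hasSum_logDeriv (xi_ne_zero_of_half_le_re hz)
  simpa only [xiOrder, Complex.ofReal_natCast] using h

theorem hasSum_unitPow_mellin {s : ℂ} (hs : 0 < s.re) :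
    HasSum (fun n : ℕ => 1 / (((2 * (n + 1) : ℝ) : ℂ) * (s * (s + (2 * (n + 1) : ℝ)))))
      (1 / s ^ 2 * ((digamma (s / 2 + 1) + Real.eulerMascheroniConstant) / 2)) := by
  have h := ((hasSum_digamma (z := s / 2 + 1) (by simp; linarith)).div_const 2).mul_left (1 / s ^ 2)
  refine h.congr_fun fun n => ?_
  have k0 : ((n : ℂ) + 1) ≠ 0 := Nat.cast_add_one_ne_zero n
  have n3 : s ≠ 0 := by rintro rfl; simp at hs
  have pos : ∀ c : ℝ, 0 < c → s + c ≠ 0 := fun c hc h0 => by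
    have := congrArg Complex.re h0
    simp at this
    linarith
  have k1 : s + 2 * ((n : ℂ) + 1) ≠ 0 := by
    have := pos (2 * (n + 1)) (by positivity)
    push_cast at this
    exact this
  have k2 : s / 2 + 1 + (n : ℂ) = (s + 2 * (n + 1)) / 2 := by ring
  rw [k2]
  push_cast
  have e : s + 2 * ((n : ℂ) + 1) - 2 * (n + 1) = s := by ring
  generalize hq : s + 2 * ((n : ℂ) + 1) = q at *
  generalize (n : ℂ) + 1 = p at *
  subst hq
  field_simp
  ring

theorem eq_zero_of_hasMellin_zero {f : ℝ → ℂ} {σ : ℝ} (h : ∀ s : ℂ, s.re = σ → HasMellin f s 0)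
    {t : ℝ} (ht : 0 < t) (hc : ContinuousAt f t) : f t = 0 := by
  have e : ∀ y : ℝ, mellin f (σ + y * I) = 0 := fun y => (h _ (by simp)).2
  have hv : VerticalIntegrable (mellin f) σ := by
    simp only [VerticalIntegrable, e]
    exact MeasureTheory.integrable_zero _ _ _
  rw [← mellinInv_mellin_eq σ f ht (h σ (by simp)).1 hv hc, mellinInv]
  simp [e]

theorem continuousOn_unitLog : ContinuousOn unitLog (Ioi 0) := by
  have h : ContinuousOn (fun t : ℝ => ((max (-Real.log t) 0 : ℝ) : ℂ)) (Ioi 0) := by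
    refine Complex.continuous_ofReal.comp_continuousOn ?_
    exact ContinuousOn.sup ((Real.continuousOn_log.mono fun x hx => ne_of_gt hx).neg)
      continuousOn_const
  refine h.congr fun t ht => ?_
  have ht' : (0 : ℝ) < t := ht
  beta_reduce
  by_cases h1 : t ≤ 1
  · rw [unitLog, indicator_of_mem (s := Ioc 0 1) ⟨ht', h1⟩,
      max_eq_left (neg_nonneg.2 (Real.log_nonpos ht'.le h1))]
  · rw [unitLog, indicator_of_notMem fun h2 : t ∈ Ioc 0 1 => h1 h2.2, max_eq_right]
    · simp
    · linarith [Real.log_nonneg (not_le.1 h1).le]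

theorem continuousOn_unitRemainder (ρ : ℂ) : ContinuousOn (unitRemainder ρ) (Ioo 0 1) := by
  have h : ContinuousOn (fun t : ℝ => ((t : ℂ) ^ (-ρ) - 1 + ρ * Real.log t) / ρ ^ 2) (Ioo 0 1) := by
    refine (((ContinuousOn.sub (fun t ht => ?_) continuousOn_const)).add ?_).div_const _
    · exact (Complex.continuousAt_ofReal_cpow_const t _ (Or.inr ht.1.ne')).continuousWithinAt
    · exact continuousOn_const.mul (Complex.continuous_ofReal.comp_continuousOn
        (Real.continuousOn_log.mono fun x hx => ne_of_gt hx.1))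
  exact h.congr fun t ht => indicator_of_mem (s := Ioc 0 1) ⟨ht.1, ht.2.le⟩ _

theorem continuousOn_unitPow (k : ℝ) : ContinuousOn (unitPow k) (Ioo 0 1) := by
  have h : ContinuousOn (fun t : ℝ => (1 - (t : ℂ) ^ (k : ℂ)) / (k : ℂ) ^ 2) (Ioo 0 1) := by
    refine ((ContinuousOn.sub continuousOn_const fun t ht => ?_)).div_const _
    exact (Complex.continuousAt_ofReal_cpow_const t _ (Or.inr ht.1.ne')).continuousWithinAt
  exact h.congr fun t ht => indicator_of_mem (s := Ioc 0 1) ⟨ht.1, ht.2.le⟩ _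

theorem continuousOn_zeroTerm (a : {a : ℂ // xi a = 0}) : ContinuousOn (zeroTerm a) (Ioo 0 1) :=
  continuousOn_const.mul (continuousOn_const.mul
    ((continuousOn_unitRemainder _).add (continuousOn_unitRemainder _)))

/-- The contribution of `n` to the smoothed Chebyshev function. -/
noncomputable def mangoldtTerm (n : ℕ) (t : ℝ) : ℂ :=
  (ArithmeticFunction.vonMangoldt n : ℂ) * unitLog (n * t)

theorem mangoldtTerm_zero (t : ℝ) : mangoldtTerm 0 t = 0 := by simp [mangoldtTerm]

theorem continuousOn_mangoldtTerm (n : ℕ) : ContinuousOn (mangoldtTerm n) (Ioo 0 1) := by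
  rcases Nat.eq_zero_or_pos n with rfl | hn
  · exact continuousOn_const.congr fun t _ => mangoldtTerm_zero t
  · have hn' : (0 : ℝ) < n := Nat.cast_pos.2 hn
    exact continuousOn_const.mul (continuousOn_unitLog.comp (continuousOn_const.mul continuousOn_id)
      fun t ht => mul_pos hn' ht.1)

theorem norm_mangoldtTerm_le (n : ℕ) {t : ℝ} (ht : 0 < t) :
    ‖mangoldtTerm n t‖ ≤
      ArithmeticFunction.vonMangoldt n * (n : ℝ) ^ (-(3 / 2) : ℝ) * unitWeight t := by
  rcases Nat.eq_zero_or_pos n with rfl | hn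
  · simp [mangoldtTerm_zero]
  · rw [mangoldtTerm, norm_mul, Complex.norm_real,
      Real.norm_of_nonneg ArithmeticFunction.vonMangoldt_nonneg, mul_assoc]
    refine mul_le_mul_of_nonneg_left ?_ ArithmeticFunction.vonMangoldt_nonneg
    exact (norm_unitLog_le _).trans (unitWeight_mul_le (Nat.one_le_cast.2 hn) ht)

theorem summable_vonMangoldt_mul_rpow :
    Summable fun n : ℕ => ArithmeticFunction.vonMangoldt n * (n : ℝ) ^ (-(3 / 2) : ℝ) := by
  have h := (ArithmeticFunction.LSeriesSummable_vonMangoldt (s := (3 / 2 : ℝ))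
    (by rw [Complex.ofReal_re]; norm_num)).norm
  refine h.congr fun n => ?_
  rcases Nat.eq_zero_or_pos n with rfl | hn
  · simp
  · rw [LSeries.term_of_ne_zero hn.ne', norm_div, Complex.norm_real,
      Real.norm_of_nonneg ArithmeticFunction.vonMangoldt_nonneg,
      Complex.norm_natCast_cpow_of_pos hn, Complex.ofReal_re, Real.rpow_neg (Nat.cast_nonneg n),
      div_eq_mul_inv]

theorem hasMellin_mangoldtTerm (n : ℕ) {s : ℂ} (hs : s.re = 2) :
    HasMellin (mangoldtTerm n) s
      (LSeries.term (fun n => (ArithmeticFunction.vonMangoldt n : ℂ)) s n * (1 / s ^ 2)) := by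
  have hs0 : 0 < s.re := by rw [hs]; norm_num
  rcases Nat.eq_zero_or_pos n with rfl | hn
  · have e : mangoldtTerm 0 = fun t => 0 * unitLog t :=
      funext fun t => by rw [mangoldtTerm_zero, zero_mul]
    rw [e, LSeries.term_zero]
    have := (hasMellin_unitLog hs0).const_mul' 0
    rwa [zero_mul] at this ⊢
  · have h := (hasMellin_unitLog_mul (n := n) (Nat.cast_pos.2 hn) hs0).const_mul'
      (ArithmeticFunction.vonMangoldt n)
    rw [LSeries.term_of_ne_zero hn.ne', div_eq_mul_inv, ← Complex.cpow_neg, mul_assoc]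
    rw [Complex.ofReal_natCast] at h
    exact h

/-- The smoothed explicit formula. -/
theorem tsum_mangoldtTerm_eq {t : ℝ} (ht : t ∈ Ioo (0 : ℝ) 1) :
    ∑' n, mangoldtTerm n t = unitRemainder 1 t +
      (-Real.log Real.pi / 2 - Real.eulerMascheroniConstant / 2) * unitLog t +
      ∑' n : ℕ, unitPow (2 * (n + 1)) t - ∑' a, zeroTerm a t := by
  have hct := isXiLike_xi.countable_zeros
  set K : ℂ := -Real.log Real.pi / 2 - Real.eulerMascheroniConstant / 2 with hK
  have hsq : Summable fun n : ℕ => 1 / (2 * ((n : ℝ) + 1)) ^ 2 := by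
    have := ((summable_nat_add_iff 1).2 (Real.summable_one_div_nat_pow.2 one_lt_two)).mul_left (1 / 4)
    refine this.congr fun n => ?_
    push_cast
    field_simp
    norm_num
  have bP : ∀ (n : ℕ) (t : ℝ), 0 < t → ‖unitPow (2 * (n + 1)) t‖ ≤
      1 / (2 * ((n : ℝ) + 1)) ^ 2 * unitWeight t := fun n t _ => norm_unitPow_le (by positivity) t
  have hz := summable_xiOrder_div_im_sq.mul_left (5 / 2)
  have bZ := fun a t (_ : (0 : ℝ) < t) => norm_zeroTerm_le a t
  have bM := fun n t (h : (0 : ℝ) < t) => norm_mangoldtTerm_le n h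
  have key := eq_zero_of_hasMellin_zero (σ := 2) (f := fun t => ∑' n, mangoldtTerm n t +
    -1 * ((unitRemainder 1 t + K * unitLog t) + (∑' n : ℕ, unitPow (2 * (n + 1)) t +
      -1 * ∑' a, zeroTerm a t))) (fun s hs => ?_) ht.1 ?_
  · linear_combination key
  · have hs0 : 0 < s.re := by rw [hs]; norm_num
    have hs1 : 1 < s.re := by rw [hs]; norm_num
    have h1 := hasMellin_tsum summable_vonMangoldt_mul_rpow bM hs
      fun n => hasMellin_mangoldtTerm n hs
    have h2 := hasMellin_unitRemainder (ρ := 1) one_ne_zero hs0 (by rw [Complex.one_re]; exact hs1)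
    have h3 := (hasMellin_unitLog hs0).const_mul' K
    have h4 := hasMellin_tsum hsq bP hs fun n => hasMellin_unitPow (by positivity) hs0
    have h5 := hasMellin_tsum hz bZ hs fun a => hasMellin_zeroTerm a hs
    rw [tsum_mul_right] at h1
    rw [(hasSum_unitPow_mellin hs0).tsum_eq] at h4
    rw [tsum_mul_left, (hasSum_logDeriv_xi (z := s - 1 / 2) (by
      rw [Complex.sub_re, hs]; norm_num)).tsum_eq, logDeriv_xi_sub_half hs1] at h5
    have hL := ArithmeticFunction.LSeries_vonMangoldt_eq_deriv_riemannZeta_div hs1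
    rw [LSeries] at hL
    rw [hL] at h1
    have h := h1.add' (((h2.add' h3).add' (h4.add' (h5.const_mul' (-1)))).const_mul' (-1))
    have n3 : s ≠ 0 := by rintro rfl; simp at hs
    have n4 : s - 1 ≠ 0 := fun h0 => by
      have := congrArg Complex.re h0
      simp [hs] at this
      norm_num at this
    refine ⟨h.1, h.2.trans ?_⟩
    · rw [hK, neg_div]
      generalize deriv riemannZeta s / riemannZeta s = Z
      field_simp
      ring
  · have c1 := continuousAt_tsum_of_unitWeight summable_vonMangoldt_mul_rpow bM
      continuousOn_mangoldtTerm ht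
    have c2 := (continuousOn_unitRemainder 1).continuousAt (Ioo_mem_nhds ht.1 ht.2)
    have c3 := continuousOn_unitLog.continuousAt (Ioi_mem_nhds ht.1)
    have c4 := continuousAt_tsum_of_unitWeight hsq bP (fun n => continuousOn_unitPow _) ht
    have c5 := continuousAt_tsum_of_unitWeight hz bZ continuousOn_zeroTerm ht
    exact c1.add (continuousAt_const.mul ((c2.add (continuousAt_const.mul c3)).add
      (c4.add (continuousAt_const.mul c5))))

theorem norm_tsum_unitPow_le {t : ℝ} (ht : t ∈ Ioo (0 : ℝ) 1) :
    ‖∑' n : ℕ, unitPow (2 * (n + 1)) t‖ ≤ 1 := by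
  have h0 : HasSum (fun n : ℕ => 1 / 4 * (1 / ((n : ℝ) + 1) ^ 2)) (1 / 4 * (Real.pi ^ 2 / 6)) := by
    have := (hasSum_nat_add_iff' 1).2 hasSum_zeta_two
    simp only [Finset.range_one, Finset.sum_singleton, Nat.cast_zero, ne_eq, OfNat.ofNat_ne_zero,
      not_false_eq_true, zero_pow, div_zero, sub_zero, Nat.cast_add, Nat.cast_one] at this
    exact this.mul_left _
  refine (tsum_of_norm_bounded h0 fun n => ?_).trans ?_
  · have hk : (0 : ℝ) < 2 * ((n : ℝ) + 1) := by positivity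
    have p0 := Real.rpow_pos_of_pos ht.1 (2 * ((n : ℝ) + 1))
    have p1 := Real.rpow_le_one ht.1.le ht.2.le hk.le
    rw [unitPow, indicator_of_mem (s := Ioc 0 1) ⟨ht.1, ht.2.le⟩, ← Complex.ofReal_cpow ht.1.le]
    generalize t ^ (2 * ((n : ℝ) + 1)) = p at p0 p1
    rw [← Complex.ofReal_one, ← Complex.ofReal_sub, ← Complex.ofReal_pow, ← Complex.ofReal_div,
      Complex.norm_real, Real.norm_of_nonneg (div_nonneg (by linarith) (by positivity))]
    calc (1 - p) / (2 * ((n : ℝ) + 1)) ^ 2 ≤ 1 / (2 * ((n : ℝ) + 1)) ^ 2 := by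
          gcongr
          linarith
      _ = _ := by field_simp; norm_num
  · have h1 := Real.pi_lt_d4
    have h2 := Real.pi_pos
    nlinarith

theorem neg_re_tsum_zeroTerm_le {t η : ℝ} (ht : t ∈ Ioo (0 : ℝ) 1)
    (hη : ∀ T : Finset {a : ℂ // xi a = 0}, ∑ a ∈ T, xiOrder a / 2 *
      ((t ^ (-(1 / 2 + a.1.re)) + t ^ (-(1 / 2 - a.1.re)) + 2) / a.1.im ^ 2) ≤ η) :
    -(∑' a, zeroTerm a t).re ≤ η - 0.02312 * Real.log t := by
  have ht' : t ∈ Ioc (0 : ℝ) 1 := ⟨ht.1, ht.2.le⟩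
  have hB := (hasSum_logDeriv_xi (z := 1 / 2) (by norm_num)).mul_left ((Real.log t : ℝ) : ℂ)
  rw [logDeriv_xi_half] at hB
  have hZ : Summable fun a => zeroTerm a t :=
    Summable.of_norm_bounded ((summable_xiOrder_div_im_sq.mul_left (5 / 2)).mul_right _)
      fun a => norm_zeroTerm_le a t
  have hA := hZ.hasSum.sub hB
  have hle : ‖∑' a, zeroTerm a t - Real.log t * completedRiemannZeta₀ 1‖ ≤ η := by
    refine le_of_tendsto hA.norm (Eventually.of_forall fun T => ?_)
    refine (norm_sum_le _ _).trans ((Finset.sum_le_sum fun a _ => ?_).trans (hη T))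
    rw [zeroTerm_eq a ht', add_sub_cancel_right]
    exact norm_zeroTerm_aux a ht'
  have h1 := (abs_le.1 ((Complex.abs_re_le_norm _).trans hle)).1
  rw [Complex.sub_re, Complex.re_ofReal_mul] at h1
  have h2 := completedRiemannZeta₀_one_re_le
  have h3 := Real.log_nonpos ht.1.le ht.2.le
  nlinarith

/-- An upper bound for the smoothed Chebyshev function in terms of a sum over zeros of `xi`. -/
theorem sum_log_mul_log_le {x η : ℝ} (hx : 1 < x) {S : Finset ℕ}
    (hS : ∀ p ∈ S, p.Prime ∧ (p : ℝ) ≤ x)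
    (hη : ∀ T : Finset {a : ℂ // xi a = 0}, ∑ a ∈ T, xiOrder a / 2 *
      ((x ^ (1 / 2 + a.1.re) + x ^ (1 / 2 - a.1.re) + 2) / a.1.im ^ 2) ≤ η) :
    ∑ p ∈ S, Real.log p * (Real.log x - Real.log p) ≤ x + η := by
  have hx0 : 0 < x := by linarith
  have ht : x⁻¹ ∈ Ioo (0 : ℝ) 1 := ⟨by positivity, inv_lt_one_of_one_lt₀ hx⟩
  have hy := Real.log_pos hx
  have hM : Summable fun n => mangoldtTerm n x⁻¹ :=
    Summable.of_norm_bounded (summable_vonMangoldt_mul_rpow.mul_right _)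
      fun n => norm_mangoldtTerm_le n ht.1
  have hre := Complex.hasSum_re hM.hasSum
  have hnn : ∀ n, 0 ≤ (mangoldtTerm n x⁻¹).re := fun n => by
    rw [mangoldtTerm, Complex.re_ofReal_mul]
    refine mul_nonneg ArithmeticFunction.vonMangoldt_nonneg ?_
    by_cases h : (n * x⁻¹ : ℝ) ∈ Ioc (0 : ℝ) 1
    · rw [unitLog, indicator_of_mem h, Complex.ofReal_re]
      exact neg_nonneg.2 (Real.log_nonpos h.1.le h.2)
    · rw [unitLog, indicator_of_notMem h, Complex.zero_re]
  have h1 : ∑ p ∈ S, Real.log p * (Real.log x - Real.log p) ≤ (∑' n, mangoldtTerm n x⁻¹).re := by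
    refine le_trans (le_of_eq (Finset.sum_congr rfl fun p hp => ?_))
      (sum_le_hasSum S (fun n _ => hnn n) hre)
    obtain ⟨hpp, hpx⟩ := hS p hp
    have hp0 : (0 : ℝ) < p := Nat.cast_pos.2 hpp.pos
    have h : (p * x⁻¹ : ℝ) ∈ Ioc (0 : ℝ) 1 := ⟨by positivity, by
      rw [← div_eq_mul_inv]; exact (div_le_one hx0).2 hpx⟩
    rw [mangoldtTerm, Complex.re_ofReal_mul, unitLog, indicator_of_mem h, Complex.ofReal_re,
      ArithmeticFunction.vonMangoldt_apply_prime hpp, Real.log_mul hp0.ne' ht.1.ne', Real.log_inv]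
    ring
  rw [tsum_mangoldtTerm_eq ht] at h1
  have e : ∀ b : ℝ, x⁻¹ ^ (-b) = x ^ b := fun b => by
    rw [Real.inv_rpow hx0.le, Real.rpow_neg hx0.le, inv_inv]
  have h2 := neg_re_tsum_zeroTerm_le ht (η := η) (by simpa only [e] using hη)
  have h3 := (Complex.re_le_norm _).trans (norm_tsum_unitPow_le ht)
  have h4 : (unitRemainder 1 x⁻¹).re = x - 1 - Real.log x := by
    rw [unitRemainder, indicator_of_mem (s := Ioc 0 1) ⟨ht.1, ht.2.le⟩, Complex.cpow_neg_one,
      ← Complex.ofReal_inv, inv_inv, Real.log_inv]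
    simp
    ring
  have h5 : ((-Real.log Real.pi / 2 - Real.eulerMascheroniConstant / 2) * unitLog x⁻¹).re ≤ 0 := by
    have hu : unitLog x⁻¹ = (Real.log x : ℝ) := by
      rw [unitLog, indicator_of_mem (s := Ioc 0 1) ⟨ht.1, ht.2.le⟩, Real.log_inv, neg_neg]
    rw [hu, Complex.re_mul_ofReal]
    refine mul_nonpos_of_nonpos_of_nonneg ?_ hy.le
    have g1 := Real.one_half_lt_eulerMascheroniConstant
    have g2 : 0 < Real.log Real.pi := Real.log_pos (by linarith [Real.pi_gt_three])
    have : (-Real.log Real.pi / 2 - Real.eulerMascheroniConstant / 2 : ℂ) =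
        ((-Real.log Real.pi / 2 - Real.eulerMascheroniConstant / 2 : ℝ) : ℂ) := by push_cast; ring
    rw [this, Complex.ofReal_re]
    linarith
  rw [Complex.sub_re, Complex.add_re, Complex.add_re, h4] at h1
  rw [Real.log_inv] at h2
  linarith

theorem exp_neg_le_third {u : ℝ} (hu : 0 < u) :
    Real.exp (-u) ≤ Real.exp (-(1 / 3)) * (2 / 3 + 1 / (9 * u)) := by
  have e : Real.exp (-u) = Real.exp (-(1 / 3)) * Real.exp (1 / 3 - u) := by
    rw [← Real.exp_add]
    congr 1
    ring
  rw [e]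
  refine mul_le_mul_of_nonneg_left ?_ (Real.exp_pos _).le
  have e2 : 2 / 3 + 1 / (9 * u) = (6 * u + 1) / (9 * u) := by field_simp; ring
  rw [e2, le_div_iff₀ (by positivity)]
  rcases le_total u (1 / 3) with h | h
  · have h1 : Real.exp (1 / 3 - u) * (1 - (1 / 3 - u)) ≤ 1 := by
      have h2 := Real.add_one_le_exp (-(1 / 3 - u))
      have h3 : Real.exp (1 / 3 - u) * Real.exp (-(1 / 3 - u)) = 1 := by
        rw [← Real.exp_add, add_neg_cancel, Real.exp_zero]
      nlinarith [Real.exp_pos (1 / 3 - u)]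
    have h0 : 0 < 1 - (1 / 3 - u) := by linarith
    refine le_of_mul_le_mul_right ?_ h0
    nlinarith [sq_nonneg (1 / 3 - u)]
  · set s := u - 1 / 3 with hs
    have hs0 : 0 ≤ s := by linarith
    have h1 := Real.quadratic_le_exp_of_nonneg hs0
    have h3 : Real.exp (1 / 3 - u) * Real.exp s = 1 := by
      rw [← Real.exp_add, hs, sub_add_sub_cancel, sub_self, Real.exp_zero]
    have h4 : 9 * u ≤ (6 * u + 1) * Real.exp s := by
      have h5 : (6 * u + 1) * (1 + s + s ^ 2 / 2) ≤ (6 * u + 1) * Real.exp s :=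
        mul_le_mul_of_nonneg_left h1 (by linarith)
      have h6 : u = s + 1 / 3 := by linarith
      rw [h6] at h5 ⊢
      nlinarith [pow_nonneg hs0 3, sq_nonneg s]
    calc Real.exp (1 / 3 - u) * (9 * u)
        ≤ Real.exp (1 / 3 - u) * ((6 * u + 1) * Real.exp s) := by gcongr
      _ = (6 * u + 1) * (Real.exp (1 / 3 - u) * Real.exp s) := by ring
      _ = _ := by rw [h3, mul_one]

theorem exp_neg_le_inv {u : ℝ} (hu : 0 < u) : Real.exp (-u) ≤ Real.exp (-1) / u := by
  rw [le_div_iff₀ hu]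
  have h1 := Real.add_one_le_exp (u - 1)
  have h3 : Real.exp (-u) * Real.exp (u - 1) = Real.exp (-1) := by
    rw [← Real.exp_add]
    congr 1
    ring
  nlinarith [Real.exp_pos (-u)]

theorem zero_free_abs {a : ℂ} (ha : xi a = 0) (hre : 0.44 ≤ |a.re|) (hd : 0 < 1 / 2 - |a.re|) :
    1 / (1 / 2 - |a.re|) ≤ 34.824 * zeroWeight a.im := by
  have h : 0.07179 / (1 / 2 - |a.re|) ≤ 2.5 * zeroWeight a.im := by
    rcases le_total 0 a.re with h0 | h0
    · rw [abs_of_nonneg h0] at hre ⊢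
      exact zero_free ha hre
    · rw [abs_of_nonpos h0] at hre ⊢
      have := zero_free (a := -a) (by rw [xi_neg, ha]) (by simpa using hre)
      simpa only [Complex.neg_re, Complex.neg_im, zeroWeight_neg] using this
  have h2 := zeroWeight_nonneg a.im
  rw [div_le_iff₀ hd] at h ⊢
  nlinarith

theorem rpow_add_rpow_le {x : ℝ} (hx : 1 ≤ x) (b : ℝ) :
    x ^ (1 / 2 + b) + x ^ (1 / 2 - b) ≤
      x * (Real.exp (-(Real.log x * (1 / 2 - |b|))) + x ^ (-(1 / 2) : ℝ)) := by
  have hx0 : 0 < x := by linarith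
  have key : ∀ c : ℝ, 0 ≤ c → x ^ (1 / 2 + c) + x ^ (1 / 2 - c) ≤
      x * (Real.exp (-(Real.log x * (1 / 2 - c))) + x ^ (-(1 / 2) : ℝ)) := fun c hc => by
    have e1 : x ^ (1 / 2 + c) = x * Real.exp (-(Real.log x * (1 / 2 - c))) := by
      rw [Real.rpow_def_of_pos hx0]
      nth_rewrite 2 [← Real.exp_log hx0]
      rw [← Real.exp_add]
      congr 1
      ring
    have e2 : x ^ (1 / 2 - c) ≤ x * x ^ (-(1 / 2) : ℝ) := by
      calc x ^ (1 / 2 - c) ≤ x ^ (1 + -(1 / 2) : ℝ) :=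
            Real.rpow_le_rpow_of_exponent_le hx (by linarith)
        _ = _ := by rw [Real.rpow_add hx0, Real.rpow_one]
    rw [mul_add]
    linarith
  rcases le_total 0 b with h | h
  · rw [abs_of_nonneg h]
    exact key b h
  · have := key (-b) (by linarith)
    rw [sub_neg_eq_add (1 / 2 : ℝ) b, ← sub_eq_add_neg, add_comm] at this
    rw [abs_of_nonpos h, sub_neg_eq_add]
    exact this

/-- Passing from a bound for each zero to a bound for the smoothed Chebyshev function. -/
theorem sum_log_mul_log_le_of_forall {x A B ε : ℝ} (hx : 1 < x) (hA : 0 ≤ A) (hB : 0 ≤ B)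
    (hε : x ^ (-(1 / 2) : ℝ) + 2 / x ≤ ε)
    (h : ∀ a, xi a = 0 → |a.re| < 1 / 2 →
      Real.exp (-(Real.log x * (1 / 2 - |a.re|))) ≤ A + B * zeroWeight a.im)
    {S : Finset ℕ} (hS : ∀ p ∈ S, p.Prime ∧ (p : ℝ) ≤ x) :
    ∑ p ∈ S, Real.log p * (Real.log x - Real.log p) ≤
      x * (1 + ((A + ε) * 0.04733 + B * 0.0466) / 2) := by
  have hx0 : 0 < x := by linarith
  have hε0 : 0 ≤ ε := le_trans (by positivity) hε
  have := sum_log_mul_log_le (η := x * (((A + ε) * 0.04733 + B * 0.0466) / 2)) hx hS fun T => ?_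
  · linarith
  · calc _ ≤ ∑ a ∈ T, x * (((A + ε) * (xiOrder a / a.1.im ^ 2) +
          B * (xiOrder a * zeroWeight a.1.im / a.1.im ^ 2)) / 2) := by
          refine Finset.sum_le_sum fun a _ => ?_
          have h1 := rpow_add_rpow_le hx.le a.1.re
          have h2 := h a a.2 (abs_re_lt_half a)
          have h3 : x ^ (1 / 2 + a.1.re) + x ^ (1 / 2 - a.1.re) + 2 ≤
              x * (A + ε + B * zeroWeight a.1.im) := by
            have e : (2 : ℝ) = x * (2 / x) := by field_simp
            have h4 := mul_le_mul_of_nonneg_left (add_le_add h2 hε) hx0.le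
            nlinarith
          have h5 : (x ^ (1 / 2 + a.1.re) + x ^ (1 / 2 - a.1.re) + 2) / a.1.im ^ 2 ≤
              x * (A + ε + B * zeroWeight a.1.im) / a.1.im ^ 2 :=
            div_le_div_of_nonneg_right h3 (sq_nonneg _)
          refine (mul_le_mul_of_nonneg_left h5 (div_nonneg (xiOrder_nonneg a) two_pos.le)).trans
            (le_of_eq ?_)
          ring
      _ = x * (((A + ε) * ∑ a ∈ T, xiOrder a / a.1.im ^ 2 +
          B * ∑ a ∈ T, xiOrder a * zeroWeight a.1.im / a.1.im ^ 2) / 2) := by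
          rw [← Finset.mul_sum, ← Finset.sum_div, Finset.sum_add_distrib, Finset.mul_sum,
            Finset.mul_sum]
      _ ≤ _ := by
          have h1 := sum_xiOrder_div_im_sq_le T
          have h2 := sum_zeroWeight_le T
          gcongr

theorem sum_log_mul_log_le_of_two_pow_le {x : ℝ} (hx : 2 ^ 20 ≤ x)
    {S : Finset ℕ} (hS : ∀ p ∈ S, p.Prime ∧ (p : ℝ) ≤ x) :
    ∑ p ∈ S, Real.log p * (Real.log x - Real.log p) ≤ x * (1 + 0.01134 + 0.06463 / Real.log x) := by
  have hx0 : 0 < x := by linarith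
  have hy : 13.86 ≤ Real.log x := by
    have := Real.log_le_log (by norm_num) hx
    rw [Real.log_pow] at this
    have h2 := Real.log_two_gt_d9
    push_cast at this
    linarith
  have h13 : Real.exp (-(1 / 3)) ≤ 0.71654 := by
    have h := Real.exp_one_gt_d9
    have e : Real.exp (-(1 / 3)) ^ 3 = (Real.exp 1)⁻¹ := by
      rw [← Real.exp_nat_mul, ← Real.exp_neg]
      norm_num
    refine le_of_pow_le_pow_left₀ (n := 3) (by norm_num) (by norm_num) ?_
    rw [e]
    refine (inv_anti₀ (by norm_num) h.le).trans (by norm_num)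
  refine (sum_log_mul_log_le_of_forall (A := 0.47772) (B := 2.7726 / Real.log x) (ε := 0.00098)
    (by linarith) (by norm_num) (by positivity) ?_ (fun a ha hlt => ?_) hS).trans ?_
  · have h1 : x ^ (-(1 / 2) : ℝ) ≤ 1 / 1024 := by
      have h2 : (2 ^ 20 : ℝ) ^ (-(1 / 2) : ℝ) = 1 / 1024 := by
        rw [← Real.rpow_natCast, ← Real.rpow_mul (by norm_num)]
        norm_num
      rw [← h2]
      exact Real.rpow_le_rpow_of_nonpos (by norm_num) hx (by norm_num)
    have h3 : 2 / x ≤ 2 / 2 ^ 20 := by gcongr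
    norm_num at h1 h3
    linarith
  · have hd : 0 < 1 / 2 - |a.re| := by linarith
    have hy0 : 0 < Real.log x := by linarith
    have hw := zeroWeight_nonneg a.im
    rcases le_total 0.44 |a.re| with h | h
    · refine (exp_neg_le_third (mul_pos hy0 hd)).trans ?_
      have h1 := zero_free_abs ha h hd
      have h2 : 1 / (9 * (Real.log x * (1 / 2 - |a.re|))) ≤
          34.824 * zeroWeight a.im / (9 * Real.log x) := by
        rw [show 1 / (9 * (Real.log x * (1 / 2 - |a.re|))) =
          1 / (1 / 2 - |a.re|) / (9 * Real.log x) by field_simp]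
        gcongr
      have h3 : 34.824 * zeroWeight a.im / (9 * Real.log x) =
          34.824 / 9 * (zeroWeight a.im / Real.log x) := by field_simp
      have h4 : 2.7726 / Real.log x * zeroWeight a.im = 2.7726 * (zeroWeight a.im / Real.log x) := by
        field_simp
      have h5 : 0 ≤ zeroWeight a.im / Real.log x := div_nonneg hw hy0.le
      rw [h4]
      rw [h3] at h2
      generalize zeroWeight a.im / Real.log x = W at *
      calc _ ≤ 0.71654 * (2 / 3 + 34.824 / 9 * W) := by gcongr
        _ ≤ _ := by linarith
    · refine (exp_neg_le_inv (mul_pos hy0 hd)).trans ?_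
      have h1 : 0.8316 ≤ Real.log x * (1 / 2 - |a.re|) := by nlinarith
      have h2 : 0 ≤ 2.7726 / Real.log x * zeroWeight a.im := by positivity
      have h3 : Real.exp (-1) / (Real.log x * (1 / 2 - |a.re|)) ≤ 0.36788 / 0.8316 := by
        gcongr
        linarith [Real.exp_neg_one_lt_d9]
      norm_num at h3
      linarith
  · have : 0 < Real.log x := by linarith
    refine mul_le_mul_of_nonneg_left ?_ hx0.le
    rw [div_mul_eq_mul_div, div_eq_mul_inv (2.7726 * _), div_eq_mul_inv 0.06463]
    have := inv_pos.2 this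
    linarith

theorem sum_log_mul_log_le_of_forty_le_log {x : ℝ} (hx0 : 0 < x) (hy : 40 ≤ Real.log x)
    {S : Finset ℕ} (hS : ∀ p ∈ S, p.Prime ∧ (p : ℝ) ≤ x) :
    ∑ p ∈ S, Real.log p * (Real.log x - Real.log p) ≤ x * (1 + 0.386 / Real.log x) := by
  set y := Real.log x with hyx
  have hex : x = Real.exp y := (Real.exp_log hx0).symm
  have hy0 : 0 < y := by linarith
  have h1x : 1 < x := by rw [hex]; exact Real.one_lt_exp_iff.2 hy0
  have h12 : 11 ≤ Real.exp 2.4 := by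
    have h := Real.exp_one_gt_d9
    have e : Real.exp 2.4 ^ 5 = Real.exp 1 ^ 12 := by
      rw [← Real.exp_nat_mul, ← Real.exp_nat_mul]
      norm_num
    refine le_of_pow_le_pow_left₀ (n := 5) (by norm_num) (Real.exp_pos _).le ?_
    rw [e]
    exact le_trans (by norm_num) (pow_le_pow_left₀ (n := 12) (by norm_num) h.le)
  have hA : Real.exp (-(0.06 * y)) ≤ 3.64 / y := by
    have h1 := Real.add_one_le_exp (0.06 * (y - 40))
    have h2 : Real.exp (0.06 * y) = Real.exp 2.4 * Real.exp (0.06 * (y - 40)) := by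
      rw [← Real.exp_add]
      congr 1
      ring
    rw [Real.exp_neg, ← one_div, div_le_div_iff₀ (Real.exp_pos _) hy0, h2]
    nlinarith [Real.exp_pos 2.4]
  have hs : x ^ (-(1 / 2) : ℝ) ≤ 0.001 / y := by
    have h1 := Real.pow_div_factorial_le_exp (y / 2) (by linarith) 8
    have h2 : x ^ (-(1 / 2) : ℝ) = (Real.exp (y / 2))⁻¹ := by
      rw [Real.rpow_def_of_pos hx0, ← Real.exp_neg, ← hyx]
      congr 1
      ring
    rw [h2, ← one_div, div_le_div_iff₀ (Real.exp_pos _) hy0]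
    have h3 : (20 : ℝ) ^ 7 ≤ (y / 2) ^ 7 := pow_le_pow_left₀ (by norm_num) (by linarith) 7
    have h4 : (y / 2) ^ 8 = (y / 2) ^ 7 * (y / 2) := pow_succ _ _
    norm_num [Nat.factorial] at h1 h3
    nlinarith
  have hx2 : 2 / x ≤ 0.001 / y := by
    have h1 := Real.pow_div_factorial_le_exp y hy0.le 8
    rw [← hex] at h1
    rw [div_le_div_iff₀ hx0 hy0]
    have h3 : (40 : ℝ) ^ 7 ≤ y ^ 7 := pow_le_pow_left₀ (by norm_num) (by linarith) 7
    have h4 : y ^ 8 = y ^ 7 * y := pow_succ _ _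
    norm_num [Nat.factorial] at h1 h3
    nlinarith
  refine (sum_log_mul_log_le_of_forall (A := 3.64 / y) (B := 12.812 / y) (ε := 0.002 / y)
    h1x (by positivity) (by positivity) ?_ (fun a ha hlt => ?_) hS).trans ?_
  · refine (add_le_add hs hx2).trans (le_of_eq ?_)
    rw [← add_div]
    norm_num
  · have hd : 0 < 1 / 2 - |a.re| := by linarith
    have hw := zeroWeight_nonneg a.im
    have hA0 : 0 ≤ 3.64 / y := by positivity
    rcases le_total 0.44 |a.re| with h | h
    · refine (exp_neg_le_inv (mul_pos hy0 hd)).trans ?_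
      have h1 := zero_free_abs ha h hd
      have h2 : Real.exp (-1) / (y * (1 / 2 - |a.re|)) =
          Real.exp (-1) / y * (1 / (1 / 2 - |a.re|)) := by field_simp
      rw [h2]
      calc _ ≤ 0.36788 / y * (34.824 * zeroWeight a.im) := by
            gcongr
            linarith [Real.exp_neg_one_lt_d9]
        _ = 12.81105312 / y * zeroWeight a.im := by ring
        _ ≤ 12.812 / y * zeroWeight a.im := by
            gcongr
            norm_num
        _ ≤ _ := by linarith
    · have h2 : 0 ≤ 12.812 / y * zeroWeight a.im := by positivity
      have h3 : Real.exp (-(y * (1 / 2 - |a.re|))) ≤ Real.exp (-(0.06 * y)) := by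
        refine Real.exp_le_exp.2 (neg_le_neg ?_)
        nlinarith
      rw [← hyx]
      linarith
  · refine mul_le_mul_of_nonneg_left ?_ hx0.le
    have := inv_pos.2 hy0
    simp only [div_eq_mul_inv _ y]
    linarith

/-- Evaluates `x` before passing it on, so that kernel computations stay shallow. -/
def force {α : Type} (x : ℕ) (f : ℕ → α) : α :=
  Nat.rec (f 0) (fun m _ => f (Nat.succ m)) x

/-- For `2 ^ 63 ≤ m`, a lower bound for `2 ^ r * (log₂ m - 63 + e)`. -/
def fracLower (r : ℕ) : ℕ → ℕ → ℕ :=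
  Nat.rec (fun _ e => e) (fun _ ih m e => force (Nat.mul m m) fun q =>
    cond (Nat.ble 170141183460469231731687303715884105728 q)
      (force (Nat.shiftRight q 64) fun m' => force (Nat.succ (Nat.mul 2 e)) (ih m'))
      (force (Nat.shiftRight q 63) fun m' => force (Nat.mul 2 e) (ih m'))) r

/-- A lower bound for `2 ^ r * log₂ m`. -/
def log2Lower (r m : ℕ) : ℕ :=
  force (Nat.log2 m) fun e =>
    force (Nat.shiftRight (Nat.mul m (Nat.sub (Nat.pow 2 (Nat.sub 64 e)) 1)) 1) fun q =>
      cond (Nat.ble 9223372036854775808 q) (fracLower r q e) (Nat.mul e (Nat.pow 2 r))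

/-- An upper bound for `2 ^ r * (log₂ m - 63 + e)`. -/
def fracUpper (r : ℕ) : ℕ → ℕ → ℕ :=
  Nat.rec (fun m e => Nat.add e (Nat.succ (Nat.sub (Nat.log2 m) 63)))
    (fun _ ih m e => force (Nat.mul m m) fun q =>
      cond (Nat.ble 170141183460469231731687303715884105728 q)
        (force (Nat.succ (Nat.shiftRight q 64)) fun m' => force (Nat.succ (Nat.mul 2 e)) (ih m'))
        (force (Nat.succ (Nat.shiftRight q 63)) fun m' => force (Nat.mul 2 e) (ih m'))) r

/-- An upper bound for `2 ^ r * log₂ m`. -/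
def log2Upper (r m : ℕ) : ℕ :=
  force (Nat.log2 m) fun e =>
    force (Nat.mul m (Nat.succ (Nat.pow 2 (Nat.sub 63 e)))) fun q => fracUpper r q e

/-- A lower bound for Robin's function at any `z` with `2 ^ 20 * z ≥ t * log 2`. -/
def robinLower (t : ℕ) : ℕ :=
  force (Nat.div (Nat.mul t 11629079) 16777216) fun Z =>
    force (Nat.succ (Nat.div (Nat.mul (Nat.sub (log2Upper 20 Z) 20971520) 11629080) 16777216))
      fun l => cond (Nat.ble 7340032 Z)
        (Nat.div (Nat.mul Z (Nat.add (Nat.mul 10000 (Nat.mul l (Nat.add l 1048576)))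
          (Nat.mul 28973 1099511627776))) (Nat.mul 10000 (Nat.mul l (Nat.mul l l)))) 0

/-- Counts `c` further numbers, each with binary logarithm at least `l / 2 ^ 20`. -/
def countAux (κ : ℕ → ℕ → ℕ → ℕ → ℕ → ℕ → Bool) (c a l k t B J : ℕ) : Bool :=
  force (Nat.add k c) fun k' => force (Nat.add t (Nat.mul c l)) fun t' =>
    force (Nat.add J (Nat.mul c (Nat.pow (Nat.sub 20971520 l) 2))) fun J' =>
      cond (Nat.ble k' B) (κ k' t' a l B J')
        (force (robinLower (Nat.add t l)) fun B' => cond (Nat.ble k' B') (κ k' t' a l B' J') false)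

/-- Counts `c` further numbers, none of which is less than `p`. -/
def countStep (κ : ℕ → ℕ → ℕ → ℕ → ℕ → ℕ → Bool) (p c k t a l B J : ℕ) : Bool :=
  cond (cond (Nat.ble p 8192) true (Nat.ble a (Nat.mul (Nat.sub p a) 512)))
    (force (log2Lower 20 p) fun l' => countAux κ c p l' k t B J)
    (countAux κ c a l k t B J)

/-- Runs through `f` blocks of length `w`, the last one starting at `E`. -/
def countLoop (ν : ℕ → ℕ) (w E : ℕ) (κ : ℕ → ℕ → ℕ → ℕ → ℕ → ℕ → Bool) (f : ℕ) :
    ℕ → ℕ → ℕ → ℕ → ℕ → ℕ → Bool :=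
  Nat.rec κ (fun f ih k t a l B J =>
    force (Nat.sub E (Nat.mul w f)) fun p => force (ν p) fun c =>
      cond (Nat.ble c 0) (ih k t a l B J) (countStep ih p c k t a l B J)) f

/-- Whether `p` is coprime to `P`, as a number. -/
def countOne (P p : ℕ) : ℕ := Nat.div 1 (Nat.gcd p P)

/-- How many of the numbers in `[p, p + 30)` which are coprime to `30` are coprime to `P`,
if `p - 1` is divisible by `30`. -/
def countThirty (P p : ℕ) : ℕ :=
  Nat.add (Nat.add (Nat.add (countOne P p) (countOne P (Nat.add p 6)))
    (Nat.add (countOne P (Nat.add p 10)) (countOne P (Nat.add p 12))))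
    (Nat.add (Nat.add (countOne P (Nat.add p 16)) (countOne P (Nat.add p 18)))
    (Nat.add (countOne P (Nat.add p 22)) (countOne P (Nat.add p 28))))

/-- The final test: all `z < 2 ^ 20` are covered, and the weighted sum is small. -/
def countEnd (_ t _ _ _ J : ℕ) : Bool :=
  cond (Nat.ble 18446744073709551616 (Nat.mul t 11629079)) (Nat.ble J 455500000000000000) false

/-- The state reached at `75001`. -/
def countMid (k t a l B J : ℕ) : Bool :=
  cond (Nat.beq k 7393) (cond (Nat.beq t 112951768013) (cond (Nat.beq a 74923)
    (cond (Nat.beq l 16979718) (cond (Nat.beq B 7394) (Nat.beq J 261773879542845865)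
      false) false) false) false) false

/-- The verification up to `75000`. -/
def countSmall : Bool :=
  force (Nat.factorial 47) fun Q => force (Nat.factorial 1030) fun P =>
    countStep (countLoop (countOne 1) 2 7 (countLoop (countOne 5040) 2 47
      (countLoop (countOne Q) 2 1031 (countLoop (countOne P) 2 74999 countMid 36984) 492) 20) 3)
      2 1 0 0 1 0 7 0

/-- The verification from `75001` to `1050000`. -/
def countLarge : Bool :=
  force (Nat.factorial 1030) fun P => countLoop (countThirty P) 30 1049971 countEnd 32500
    7393 112951768013 74923 16979718 7394 261773879542845865

theorem countSmall_eq_true : countSmall = true := by decide +kernel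

theorem countLarge_eq_true : countLarge = true := by decide +kernel

@[simp]
theorem force_eq {α : Type} (x : ℕ) (f : ℕ → α) : force x f = f x := by
  cases x <;> rfl

theorem fracLower_succ (r m e : ℕ) : fracLower (r + 1) m e =
    if 2 ^ 127 ≤ m * m then fracLower r (m * m / 2 ^ 64) (2 * e + 1)
    else fracLower r (m * m / 2 ^ 63) (2 * e) := by
  have h : fracLower (r + 1) m e = force (m * m) fun q =>
    cond (Nat.ble (2 ^ 127) q)
      (force (q >>> 64) fun m' => force (2 * e + 1) (fracLower r m'))
      (force (q >>> 63) fun m' => force (2 * e) (fracLower r m')) := rfl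
  rw [h]
  simp only [force_eq, Nat.shiftRight_eq_div_pow, cond_eq_ite, Nat.ble_eq]

theorem fracUpper_succ (r m e : ℕ) : fracUpper (r + 1) m e =
    if 2 ^ 127 ≤ m * m then fracUpper r (m * m / 2 ^ 64 + 1) (2 * e + 1)
    else fracUpper r (m * m / 2 ^ 63 + 1) (2 * e) := by
  have h : fracUpper (r + 1) m e = force (m * m) fun q =>
    cond (Nat.ble (2 ^ 127) q)
      (force (q >>> 64 + 1) fun m' => force (2 * e + 1) (fracUpper r m'))
      (force (q >>> 63 + 1) fun m' => force (2 * e) (fracUpper r m')) := rfl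
  rw [h]
  simp only [force_eq, Nat.shiftRight_eq_div_pow, cond_eq_ite, Nat.ble_eq]

theorem log_nat_div_two_pow_le {q d : ℕ} (h : 0 < q / 2 ^ d) :
    Real.log (q / 2 ^ d : ℕ) ≤ Real.log q - d * Real.log 2 := by
  have hq : 0 < q := Nat.pos_of_ne_zero (by rintro rfl; simp at h)
  rw [← Real.log_pow, ← Real.log_div (by positivity) (by positivity)]
  refine Real.log_le_log (by exact_mod_cast h) ?_
  exact_mod_cast (Nat.cast_div_le : ((q / 2 ^ d : ℕ) : ℝ) ≤ (q : ℝ) / ((2 ^ d : ℕ) : ℝ))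

theorem le_log_nat_div_two_pow_succ {q : ℕ} (d : ℕ) (h : 0 < q) :
    Real.log q - d * Real.log 2 ≤ Real.log (q / 2 ^ d + 1 : ℕ) := by
  rw [← Real.log_pow, ← Real.log_div (by positivity) (by positivity)]
  refine Real.log_le_log (by positivity) ?_
  have h1 := Nat.lt_div_mul_add (a := q) (b := 2 ^ d) (by positivity)
  rw [div_le_iff₀ (by positivity)]
  have h2 : q ≤ (q / 2 ^ d + 1) * 2 ^ d := by rw [add_mul, one_mul]; exact h1.le
  exact_mod_cast h2

theorem fracLower_mul_log_two_le (r : ℕ) : ∀ {m : ℕ} (e : ℕ), 2 ^ 63 ≤ m →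
    fracLower r m e * Real.log 2 ≤ 2 ^ r * (Real.log m - 63 * Real.log 2 + e * Real.log 2) := by
  induction r with
  | zero =>
    intro m e hm
    have h : Real.log ((2 : ℝ) ^ 63) ≤ Real.log m :=
      Real.log_le_log (by positivity) (by exact_mod_cast hm)
    rw [Real.log_pow] at h
    have h0 : fracLower 0 m e = e := rfl
    rw [h0]
    push_cast at h
    linarith
  | succ r ih =>
    intro m e hm
    have hm0 : (m : ℝ) ≠ 0 := by
      have : 0 < m := lt_of_lt_of_le (by positivity) hm
      positivity
    have hmm : 2 ^ 126 ≤ m * m := le_trans (by norm_num) (Nat.mul_le_mul hm hm)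
    have hr : (0 : ℝ) < 2 ^ r := by positivity
    have hlog : Real.log ((m * m : ℕ) : ℝ) = 2 * Real.log m := by
      rw [Nat.cast_mul, Real.log_mul hm0 hm0]; ring
    rw [fracLower_succ]
    split_ifs with h
    · have h1 : 2 ^ 63 ≤ m * m / 2 ^ 64 := by
        rw [Nat.le_div_iff_mul_le (by positivity)]; exact h
      have h2 := log_nat_div_two_pow_le (lt_of_lt_of_le (by positivity) h1)
      refine (ih (2 * e + 1) h1).trans ?_
      rw [pow_succ (2 : ℝ) r, mul_assoc]
      refine mul_le_mul_of_nonneg_left ?_ hr.le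
      rw [hlog] at h2
      push_cast at h2 ⊢
      linarith
    · have h1 : 2 ^ 63 ≤ m * m / 2 ^ 63 := by
        rw [Nat.le_div_iff_mul_le (by positivity)]; exact hmm
      have h2 := log_nat_div_two_pow_le (lt_of_lt_of_le (by positivity) h1)
      refine (ih (2 * e) h1).trans ?_
      rw [pow_succ (2 : ℝ) r, mul_assoc]
      refine mul_le_mul_of_nonneg_left ?_ hr.le
      rw [hlog] at h2
      push_cast at h2 ⊢
      linarith

theorem log_nat_le_log2_succ {m : ℕ} (hm : 0 < m) :
    Real.log m ≤ (Nat.log2 m + 1 : ℕ) * Real.log 2 := by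
  rw [← Real.log_pow]
  refine Real.log_le_log (by positivity) ?_
  have := (Nat.log2_lt (k := Nat.log2 m + 1) hm.ne').1 (Nat.lt_succ_self _)
  exact_mod_cast this.le

theorem log2_mul_log_two_le {m : ℕ} (hm : 0 < m) :
    Nat.log2 m * Real.log 2 ≤ Real.log m := by
  rw [← Real.log_pow]
  refine Real.log_le_log (by positivity) ?_
  have := Nat.log2_self_le hm.ne'
  exact_mod_cast this

theorem le_fracUpper_mul_log_two (r : ℕ) : ∀ {m : ℕ} (e : ℕ), 0 < m →
    2 ^ r * (Real.log m - 63 * Real.log 2 + e * Real.log 2) ≤ fracUpper r m e * Real.log 2 := by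
  have hl : 0 < Real.log 2 := Real.log_pos one_lt_two
  induction r with
  | zero =>
    intro m e hm
    have h := log_nat_le_log2_succ hm
    have h0 : fracUpper 0 m e = e + (Nat.log2 m - 63 + 1) := rfl
    have h1 : ((Nat.log2 m + 1 : ℕ) : ℝ) + e ≤ fracUpper 0 m e + 63 := by
      rw [h0]; exact_mod_cast (by omega)
    nlinarith
  | succ r ih =>
    intro m e hm
    have hm0 : (m : ℝ) ≠ 0 := by positivity
    have hr : (0 : ℝ) < 2 ^ r := by positivity
    have hlog : Real.log ((m * m : ℕ) : ℝ) = 2 * Real.log m := by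
      rw [Nat.cast_mul, Real.log_mul hm0 hm0]; ring
    rw [fracUpper_succ]
    split_ifs with h
    · have h2 := le_log_nat_div_two_pow_succ 64 (Nat.mul_pos hm hm)
      refine le_trans ?_ (ih (2 * e + 1) (Nat.succ_pos _))
      rw [pow_succ (2 : ℝ) r, mul_assoc]
      refine mul_le_mul_of_nonneg_left ?_ hr.le
      rw [hlog] at h2
      push_cast at h2 ⊢
      linarith
    · have h2 := le_log_nat_div_two_pow_succ 63 (Nat.mul_pos hm hm)
      refine le_trans ?_ (ih (2 * e) (Nat.succ_pos _))
      rw [pow_succ (2 : ℝ) r, mul_assoc]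
      refine mul_le_mul_of_nonneg_left ?_ hr.le
      rw [hlog] at h2
      push_cast at h2 ⊢
      linarith

theorem log2Lower_mul_log_two_le (r : ℕ) {m : ℕ} (hm : 0 < m) :
    log2Lower r m * Real.log 2 ≤ 2 ^ r * Real.log m := by
  have h : log2Lower r m = force (Nat.log2 m) fun e => force ((m * (2 ^ (64 - e) - 1)) >>> 1)
    fun q => cond (Nat.ble (2 ^ 63) q) (fracLower r q e) (e * 2 ^ r) := rfl
  rw [h]
  simp only [force_eq, cond_eq_ite, Nat.ble_eq, Nat.shiftRight_eq_div_pow]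
  split_ifs with hq
  · set q := m * (2 ^ (64 - Nat.log2 m) - 1) / 2 ^ 1 with hqdef
    have he : Nat.log2 m ≤ 63 := by
      by_contra hc
      have : 64 - Nat.log2 m = 0 := by omega
      rw [this] at hqdef
      simp only [pow_zero, Nat.sub_self, mul_zero, Nat.zero_div] at hqdef
      rw [hqdef] at hq
      norm_num at hq
    refine (fracLower_mul_log_two_le r _ hq).trans ?_
    refine mul_le_mul_of_nonneg_left ?_ (by positivity)
    have h1 : q ≤ m * 2 ^ (63 - Nat.log2 m) := by
      rw [hqdef]
      refine Nat.div_le_of_le_mul ?_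
      have h64 : 64 - Nat.log2 m = (63 - Nat.log2 m) + 1 := by omega
      rw [h64, pow_succ]
      calc m * (2 ^ (63 - Nat.log2 m) * 2 - 1) ≤ m * (2 ^ (63 - Nat.log2 m) * 2) :=
            Nat.mul_le_mul_left _ (Nat.sub_le _ _)
        _ = _ := by ring
    have h2 : Real.log q ≤ Real.log (m * 2 ^ (63 - Nat.log2 m)) :=
      Real.log_le_log (by exact_mod_cast lt_of_lt_of_le (by positivity) hq)
        (by exact_mod_cast h1)
    rw [Real.log_mul (by positivity) (by positivity), Real.log_pow, Nat.cast_sub he] at h2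
    push_cast at h2
    linarith
  · have := log2_mul_log_two_le hm
    push_cast
    have hr : (0 : ℝ) < 2 ^ r := by positivity
    nlinarith

theorem le_log2Upper_mul_log_two (r : ℕ) {m : ℕ} (hm : 0 < m) :
    2 ^ r * Real.log m ≤ log2Upper r m * Real.log 2 := by
  have h : log2Upper r m = force (Nat.log2 m) fun e => force (m * (2 ^ (63 - e) + 1))
    fun q => fracUpper r q e := rfl
  rw [h]
  simp only [force_eq]
  refine le_trans ?_ (le_fracUpper_mul_log_two r _ (by positivity))
  refine mul_le_mul_of_nonneg_left ?_ (by positivity)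
  have h1 : Real.log (m * 2 ^ (63 - Nat.log2 m)) ≤ Real.log (m * (2 ^ (63 - Nat.log2 m) + 1) : ℕ) := by
    refine Real.log_le_log (by positivity) ?_
    push_cast
    nlinarith [(Nat.cast_nonneg m : (0 : ℝ) ≤ m)]
  rw [Real.log_mul (by positivity) (by positivity), Real.log_pow] at h1
  have h2 : (63 : ℝ) - Nat.log2 m ≤ (63 - Nat.log2 m : ℕ) := by
    have : 63 ≤ (63 - Nat.log2 m : ℕ) + Nat.log2 m := by omega
    rw [sub_le_iff_le_add]
    exact_mod_cast this
  nlinarith [Real.log_pos one_lt_two]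

/-- Robin's function, as a function of the logarithm of the variable. -/
noncomputable def robinExp (l : ℝ) : ℝ := Real.exp l * (l ^ 2 + l + 2.8973) / l ^ 3

/-- Robin's function. -/
noncomputable def robinBound (z : ℝ) : ℝ := robinExp (Real.log z)

theorem hasDerivAt_robinExp {l : ℝ} (hl : 0 < l) : HasDerivAt robinExp
    (Real.exp l / l ^ 4 * (l ^ 3 + 0.8973 * l - 3 * 2.8973)) l := by
  have h1 : HasDerivAt (fun l : ℝ => l ^ 2 + l + 2.8973) (2 * l + 1) l := by
    simpa using ((hasDerivAt_pow 2 l).add (hasDerivAt_id l)).add_const 2.8973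
  have h := ((Real.hasDerivAt_exp l).mul h1).div (hasDerivAt_pow 3 l) (by positivity)
  refine h.congr_deriv ?_
  simp only [Pi.mul_apply]
  field_simp
  push_cast
  ring

theorem monotoneOn_robinExp : MonotoneOn robinExp (Ici 1.92) := by
  have hpos : ∀ l ∈ Ici (1.92 : ℝ), 0 < l := fun l hl => lt_of_lt_of_le (by norm_num) hl
  refine monotoneOn_of_deriv_nonneg (convex_Ici _)
    (fun l hl => (hasDerivAt_robinExp (hpos l hl)).continuousAt.continuousWithinAt)
    (fun l hl => (hasDerivAt_robinExp (hpos l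
      (interior_subset hl))).differentiableAt.differentiableWithinAt) fun l hl => ?_
  have hl' : (1.92 : ℝ) ≤ l := interior_subset hl
  rw [(hasDerivAt_robinExp (hpos l hl')).deriv]
  refine mul_nonneg (by positivity) ?_
  nlinarith [mul_nonneg (sub_nonneg.2 hl') (sub_nonneg.2 hl'), sq_nonneg (l + 1)]

theorem seven_le_robinExp {l : ℝ} (hl : 0 < l) : 7 ≤ robinExp l := by
  have h : 1 + l + l ^ 2 / 2 + l ^ 3 / 6 + l ^ 4 / 24 ≤ Real.exp l := by
    have := Real.sum_le_exp_of_nonneg hl.le 5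
    simp only [Finset.sum_range_succ, Finset.sum_range_zero, Nat.factorial] at this
    norm_num at this
    linarith
  rw [robinExp, le_div_iff₀ (by positivity)]
  refine le_trans ?_ (mul_le_mul_of_nonneg_right h (by positivity))
  nlinarith [mul_nonneg hl.le (sq_nonneg (l - 1.7)), mul_nonneg (pow_pos hl 3).le
    (sq_nonneg (l - 1.7)), sq_nonneg (l * (l - 1.7)), sq_nonneg (l ^ 2 * (l - 1.7)), pow_pos hl 2,
    pow_pos hl 3]

theorem le_log_seven : (1.92 : ℝ) ≤ Real.log 7 := by
  rw [Real.le_log_iff_exp_le (by norm_num)]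
  have h : (1.92 : ℝ) = (48 : ℕ) * 0.04 := by norm_num
  rw [h, Real.exp_nat_mul]
  have h1 : Real.exp 0.04 ≤ 1.0409 := by
    have := Real.exp_bound' (x := 0.04) (by norm_num) (by norm_num) (n := 3) (by norm_num)
    simp only [Finset.sum_range_succ, Finset.sum_range_zero, Nat.factorial] at this
    norm_num at this
    linarith
  refine (pow_le_pow_left₀ (Real.exp_pos _).le h1 48).trans ?_
  norm_num

theorem robinBound_mono {w z : ℝ} (hw : 7 ≤ w) (h : w ≤ z) : robinBound w ≤ robinBound z := by
  have h7 : Real.log 7 ≤ Real.log w := Real.log_le_log (by norm_num) hw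
  have hwz : Real.log w ≤ Real.log z := Real.log_le_log (by linarith) h
  exact monotoneOn_robinExp (le_log_seven.trans h7) (le_log_seven.trans (h7.trans hwz)) hwz

theorem seven_le_robinBound {z : ℝ} (hz : 1 < z) : 7 ≤ robinBound z :=
  seven_le_robinExp (Real.log_pos hz)

theorem le_robinBound {w l : ℝ} (hw : 1 < w) (hl : Real.log w ≤ l) :
    w * (l ^ 2 + l + 2.8973) / l ^ 3 ≤ robinBound w := by
  have h0 := Real.log_pos hw
  have hl0 : 0 < l := h0.trans_le hl
  have hw0 : 0 < w := by linarith
  have key : ∀ x : ℝ, 0 < x → w * (x ^ 2 + x + 2.8973) / x ^ 3 =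
      w * (1 / x + 1 / x ^ 2 + 2.8973 / x ^ 3) := fun x hx => by field_simp
  rw [robinBound, robinExp, Real.exp_log hw0, key _ h0, key _ hl0]
  gcongr

theorem robinLower_le {t : ℕ} {z : ℝ} (hz : 1 < z) (h : t * Real.log 2 ≤ 2 ^ 20 * z) :
    (robinLower t : ℝ) ≤ robinBound z := by
  have hr : robinLower t = force (t * 11629079 / 16777216) fun Z =>
    force ((log2Upper 20 Z - 20971520) * 11629080 / 16777216 + 1) fun l =>
      cond (Nat.ble 7340032 Z) (Z * (10000 * (l * (l + 1048576)) + 28973 * 1099511627776) /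
        (10000 * (l * (l * l)))) 0 := rfl
  rw [hr]
  simp only [force_eq, cond_eq_ite, Nat.ble_eq]
  obtain ⟨Z, hZ⟩ : ∃ Z, Z = t * 11629079 / 16777216 := ⟨_, rfl⟩
  obtain ⟨u, hu⟩ : ∃ u, u = log2Upper 20 Z - 20971520 := ⟨_, rfl⟩
  obtain ⟨l, hl⟩ : ∃ l, l = u * 11629080 / 16777216 + 1 := ⟨_, rfl⟩
  rw [← hZ, ← hu, ← hl]
  have hlog2 := Real.log_two_gt_d9
  have hlog2' := Real.log_two_lt_d9
  split_ifs with h7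
  swap
  · have := seven_le_robinBound hz
    push_cast
    linarith
  have hZ0 : 0 < Z := lt_of_lt_of_le (by norm_num) h7
  have h2 : (log2Upper 20 Z : ℝ) ≤ u + (20971520 : ℕ) := by
    exact_mod_cast hu ▸ le_tsub_add
  have h3 : (u : ℝ) * 11629080 ≤ l * 16777216 := by
    have := Nat.lt_div_mul_add (a := u * 11629080) (b := 16777216) (by norm_num)
    rw [← Nat.succ_mul, Nat.succ_eq_add_one, ← hl] at this
    exact_mod_cast this.le
  have hl0 : (0 : ℝ) < l := by
    have : 0 < l := hl ▸ Nat.succ_pos _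
    exact_mod_cast this
  have h7' : (7340032 : ℝ) ≤ Z := by exact_mod_cast h7
  have hZt : (Z : ℝ) * 16777216 ≤ t * 11629079 := by
    have : Z * 16777216 ≤ t * 11629079 := hZ ▸ Nat.div_mul_le_self _ _
    exact_mod_cast this
  clear hZ hu hl h7
  rw [Nat.cast_ofNat] at h2
  have ht0 : (0 : ℝ) ≤ t := Nat.cast_nonneg t
  have e20 : (2 : ℝ) ^ 20 = 1048576 := by norm_num
  rw [e20] at h
  have hwz : (Z : ℝ) / 1048576 ≤ z := by
    rw [div_le_iff₀ (by norm_num)]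
    nlinarith
  have hw7 : 7 ≤ (Z : ℝ) / 1048576 := by
    rw [le_div_iff₀ (by norm_num)]
    linarith
  refine le_trans ?_ (robinBound_mono hw7 hwz)
  have hlogw : Real.log ((Z : ℝ) / 1048576) ≤ (l : ℝ) / 1048576 := by
    have h1 := le_log2Upper_mul_log_two 20 hZ0
    rw [← e20, Real.log_div (by positivity) (by norm_num), Real.log_pow, e20,
      le_div_iff₀ (by norm_num)]
    rw [e20] at h1
    have hu0 : (0 : ℝ) ≤ u := Nat.cast_nonneg u
    have h4 : (log2Upper 20 Z : ℝ) * Real.log 2 ≤ (u + 20971520) * Real.log 2 :=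
      mul_le_mul_of_nonneg_right h2 (by linarith)
    push_cast
    nlinarith
  refine le_trans ?_ (le_robinBound (by linarith) hlogw)
  refine (Nat.cast_div_le).trans (le_of_eq ?_)
  push_cast
  field_simp
  ring

/-- If `C` contains all primes below `n` and nothing beyond, then the logarithms of at least as many
distinct primes have at least the same sum. -/
theorem sum_log_add_le {C s : Finset ℕ} {n c : ℕ} (hC : ∀ p, p.Prime → p < n → p ∈ C)
    (hn : ∀ p ∈ C, p < n) (hs : ∀ p ∈ s, p.Prime) (h : C.card + c ≤ s.card) :
    ∑ p ∈ C, Real.log p + c * Real.log n ≤ ∑ p ∈ s, Real.log p := by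
  have h1 : ∑ p ∈ C \ s, Real.log p ≤ (C \ s).card * Real.log n := by
    rw [← nsmul_eq_mul]
    refine Finset.sum_le_card_nsmul _ _ _ fun p hp => ?_
    rcases Nat.eq_zero_or_pos p with rfl | h0
    · simpa using Real.log_natCast_nonneg n
    · exact Real.log_le_log (by exact_mod_cast h0)
        (by exact_mod_cast (hn p (Finset.mem_sdiff.1 hp).1).le)
  have h2 : (s \ C).card * Real.log n ≤ ∑ p ∈ s \ C, Real.log p := by
    rw [← nsmul_eq_mul]
    refine Finset.card_nsmul_le_sum _ _ _ fun p hp => ?_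
    have hp' := Finset.mem_sdiff.1 hp
    have hnp : n ≤ p := not_lt.1 fun hlt => hp'.2 (hC p (hs p hp'.1) hlt)
    rcases Nat.eq_zero_or_pos n with rfl | h0
    · simpa using Real.log_natCast_nonneg p
    · exact Real.log_le_log (by exact_mod_cast h0) (by exact_mod_cast hnp)
  have h3 : (C \ s).card + c ≤ (s \ C).card := by
    have e1 := Finset.card_sdiff_add_card_inter C s
    have e2 := Finset.card_sdiff_add_card_inter s C
    rw [Finset.inter_comm] at e2
    omega
  have h4 : ((C \ s).card + c : ℝ) * Real.log n ≤ (s \ C).card * Real.log n :=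
    mul_le_mul_of_nonneg_right (by exact_mod_cast h3) (Real.log_natCast_nonneg n)
  have h5 := Finset.sum_inter_add_sum_sdiff C s fun p => Real.log p
  have h6 := Finset.sum_inter_add_sum_sdiff s C fun p => Real.log p
  rw [Finset.inter_comm] at h6
  linarith

/-- Robin's bound for numbers with `j` prime factors. -/
def RobinCard (j : ℕ) : Prop := ∀ s : Finset ℕ, (∀ p ∈ s, p.Prime) → s.card = j →
  ∀ z : ℝ, 1 < z → ∑ p ∈ s, Real.log p ≤ z → (j : ℝ) ≤ robinBound z

/-- The meaning of the state of the computation when it arrives at `n`. -/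
structure CountState (n k t a l B J : ℕ) : Prop where
  exists_superset : ∃ C : Finset ℕ, (∀ p, p.Prime → p < n → p ∈ C) ∧ (∀ p ∈ C, p < n) ∧
    C.card = k ∧ (t : ℝ) * Real.log 2 ≤ 2 ^ 20 * ∑ p ∈ C, Real.log p ∧
    ∑ p ∈ C, (max 0 (20 * 2 ^ 20 - 2 ^ 20 * (Real.log p / Real.log 2)) : ℝ) ^ 2 ≤ J
  log_le : (l : ℝ) * Real.log 2 ≤ 2 ^ 20 * Real.log a
  pos : 0 < a
  le : a ≤ n
  robinCard : ∀ j ≤ k, RobinCard j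
  le_robinBound : ∀ z : ℝ, 1 < z → t * Real.log 2 ≤ 2 ^ 20 * z → (B : ℝ) ≤ robinBound z

/-- `ν n` is the number of elements of a set between the primes in `[n, m)` and `[n, m)`. -/
def CountsPrimes (ν : ℕ → ℕ) (n m : ℕ) : Prop :=
  ∃ D : Finset ℕ, (∀ p, p.Prime → n ≤ p → p < m → p ∈ D) ∧ (∀ p ∈ D, n ≤ p ∧ p < m) ∧
    D.card = ν n

/-- The continuation `κ` accepts a state which describes the situation at `n`. -/
def AcceptsAt (κ : ℕ → ℕ → ℕ → ℕ → ℕ → ℕ → Bool) (n : ℕ) : Prop :=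
  ∃ k t a l B J, CountState n k t a l B J ∧ κ k t a l B J = true

theorem CountState.of_countsPrimes_zero {n m k t a l B J : ℕ} (hs : CountState n k t a l B J)
    (hnm : n ≤ m) {ν : ℕ → ℕ} (hν : CountsPrimes ν n m) (h0 : ν n = 0) :
    CountState m k t a l B J := by
  obtain ⟨C, hC, hn, hk⟩ := hs.exists_superset
  obtain ⟨D, hD, -, hDc⟩ := hν
  rw [h0, Finset.card_eq_zero] at hDc
  subst hDc
  refine { hs with exists_superset := ⟨C, fun p hp hpm => hC p hp ?_, ?_, hk⟩, le := ?_ }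
  · by_contra hc
    exact absurd (hD p hp (not_lt.1 hc) hpm) (Finset.notMem_empty p)
  · exact fun p hp => (hn p hp).trans_le hnm
  · exact hs.le.trans hnm

theorem AcceptsAt.of_countAux {κ : ℕ → ℕ → ℕ → ℕ → ℕ → ℕ → Bool} {n m k t a₀ l₀ B J a l : ℕ}
    (hs : CountState n k t a₀ l₀ B J) (hnm : n ≤ m) {ν : ℕ → ℕ} (hν : CountsPrimes ν n m)
    (h0 : 0 < ν n) (hl : l * Real.log 2 ≤ 2 ^ 20 * Real.log a) (ha : 0 < a) (han : a ≤ n)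
    (h : countAux κ (ν n) a l k t B J = true) : AcceptsAt κ m := by
  obtain ⟨C, hC, hn, hk, ht, hJ⟩ := hs.exists_superset
  obtain ⟨D, hD, hDm, hDc⟩ := hν
  have hl2 : 0 < Real.log 2 := Real.log_pos one_lt_two
  have hlog : ∀ p, n ≤ p → l * Real.log 2 ≤ 2 ^ 20 * Real.log p := fun p hp => by
    refine hl.trans (mul_le_mul_of_nonneg_left ?_ (by positivity))
    exact Real.log_le_log (by exact_mod_cast ha) (by exact_mod_cast han.trans hp)
  have hdisj : Disjoint C D := by
    rw [Finset.disjoint_left]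
    exact fun p hp hp' => absurd (hn p hp) (not_lt.2 (hDm p hp').1)
  set t' := t + ν n * l with ht'
  set J' := J + ν n * (20971520 - l) ^ 2 with hJ'
  have hsup : ∃ C : Finset ℕ, (∀ p, p.Prime → p < m → p ∈ C) ∧ (∀ p ∈ C, p < m) ∧
      C.card = k + ν n ∧ (t' : ℝ) * Real.log 2 ≤ 2 ^ 20 * ∑ p ∈ C, Real.log p ∧
      ∑ p ∈ C, (max 0 (20 * 2 ^ 20 - 2 ^ 20 * (Real.log p / Real.log 2)) : ℝ) ^ 2 ≤ J' := by
    refine ⟨C ∪ D, fun p hp hpm => ?_, fun p hp => ?_, ?_, ?_, ?_⟩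
    · rcases lt_or_ge p n with h | h
      · exact Finset.mem_union_left _ (hC p hp h)
      · exact Finset.mem_union_right _ (hD p hp h hpm)
    · rcases Finset.mem_union.1 hp with h | h
      · exact (hn p h).trans_le hnm
      · exact (hDm p h).2
    · rw [Finset.card_union_of_disjoint hdisj, hk, hDc]
    · rw [Finset.sum_union hdisj, mul_add, Finset.mul_sum (s := D)]
      have := Finset.card_nsmul_le_sum D (fun p : ℕ => 2 ^ 20 * Real.log p) (l * Real.log 2)
        fun p hp => hlog p (hDm p hp).1
      rw [hDc, nsmul_eq_mul] at this
      rw [ht']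
      push_cast
      linarith
    · rw [Finset.sum_union hdisj]
      have := Finset.sum_le_card_nsmul D
        (fun p : ℕ => (max 0 (20 * 2 ^ 20 - 2 ^ 20 * (Real.log p / Real.log 2)) : ℝ) ^ 2)
        ((20971520 - l : ℕ) ^ 2 : ℝ) fun p hp => ?_
      · rw [hDc, nsmul_eq_mul] at this
        rw [hJ', Nat.cast_add, Nat.cast_mul, Nat.cast_pow]
        linarith
      · refine pow_le_pow_left₀ (le_max_left _ _) (max_le (Nat.cast_nonneg _) ?_) 2
        have h1 := hlog p (hDm p hp).1
        rw [← le_div_iff₀ hl2, mul_div_assoc] at h1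
        have h2 : ((20971520 : ℕ) : ℝ) ≤ (20971520 - l : ℕ) + l := by
          exact_mod_cast le_tsub_add
        rw [Nat.cast_ofNat] at h2
        linarith
  have hgood : ∀ B' : ℕ, (∀ z : ℝ, 1 < z → (t + l : ℕ) * Real.log 2 ≤ 2 ^ 20 * z →
      (B' : ℝ) ≤ robinBound z) → k + ν n ≤ B' → ∀ j ≤ k + ν n, RobinCard j := by
    intro B' hB' hk' j hj
    rcases le_or_gt j k with h | h
    · exact hs.robinCard j h
    · intro s hsp hsc z hz hsz
      refine le_trans ?_ (hB' z hz ?_)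
      · exact_mod_cast hj.trans hk'
      · have h1 := sum_log_add_le (c := 1) hC hn hsp (by omega)
        have h2 := hlog n le_rfl
        push_cast at h1 ⊢
        linarith
  have htt : ((t + l : ℕ) : ℝ) * Real.log 2 ≤ t' * Real.log 2 := by
    refine mul_le_mul_of_nonneg_right ?_ hl2.le
    rw [ht']
    exact_mod_cast Nat.add_le_add_left (Nat.le_mul_of_pos_left l h0) t
  have hB : ∀ z : ℝ, 1 < z → (t + l : ℕ) * Real.log 2 ≤ 2 ^ 20 * z → (B : ℝ) ≤ robinBound z := by
    intro z hz hz'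
    refine hs.le_robinBound z hz (le_trans ?_ hz')
    refine mul_le_mul_of_nonneg_right ?_ hl2.le
    exact_mod_cast Nat.le_add_right t l
  have hc : countAux κ (ν n) a l k t B J = force (k + ν n) fun k' => force (t + ν n * l) fun t' =>
    force (J + ν n * (20971520 - l) ^ 2) fun J' => cond (Nat.ble k' B) (κ k' t' a l B J')
      (force (robinLower (t + l)) fun B' => cond (Nat.ble k' B') (κ k' t' a l B' J') false) := rfl
  rw [hc] at h
  simp only [force_eq, cond_eq_ite, Nat.ble_eq] at h
  rw [← ht', ← hJ'] at h
  split_ifs at h with h1 h2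
  · exact ⟨_, _, _, _, _, _, ⟨hsup, hl, ha, han.trans hnm, hgood B hB h1,
      fun z hz hz' => hB z hz (htt.trans hz')⟩, h⟩
  · exact ⟨_, _, _, _, _, _, ⟨hsup, hl, ha, han.trans hnm,
      hgood _ (fun z hz hz' => robinLower_le hz hz') h2,
      fun z hz hz' => robinLower_le hz (htt.trans hz')⟩, h⟩

theorem AcceptsAt.of_countStep {κ : ℕ → ℕ → ℕ → ℕ → ℕ → ℕ → Bool} {n m k t a l B J : ℕ}
    (hs : CountState n k t a l B J) (hnm : n ≤ m) {ν : ℕ → ℕ} (hν : CountsPrimes ν n m)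
    (h0 : 0 < ν n) (h : countStep κ n (ν n) k t a l B J = true) : AcceptsAt κ m := by
  have hn : 0 < n := hs.pos.trans_le hs.le
  have h1 : countAux κ (ν n) n (log2Lower 20 n) k t B J = true ∨
      countAux κ (ν n) a l k t B J = true := by
    rw [countStep, force_eq, Bool.cond_eq_ite (b := cond _ _ _)] at h
    split_ifs at h
    · exact Or.inl h
    · exact Or.inr h
  rcases h1 with h1 | h1
  · exact AcceptsAt.of_countAux hs hnm hν h0 (log2Lower_mul_log_two_le 20 hn) hn le_rfl h1
  · exact AcceptsAt.of_countAux hs hnm hν h0 hs.log_le hs.pos hs.le h1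

theorem AcceptsAt.of_countLoop {κ : ℕ → ℕ → ℕ → ℕ → ℕ → ℕ → Bool} {ν : ℕ → ℕ} {w E : ℕ} (f : ℕ) :
    ∀ {n : ℕ}, n + w * f = E + w →
      (∀ i, n + w * i ≤ E → CountsPrimes ν (n + w * i) (n + w * i + w)) →
      AcceptsAt (countLoop ν w E κ f) n → AcceptsAt κ (E + w) := by
  induction f with
  | zero =>
    intro n hn _ h
    rw [mul_zero, add_zero] at hn
    rwa [← hn]
  | succ f ih =>
    rintro n hn hν ⟨k, t, a, l, B, J, hs, h⟩
    rw [mul_add, mul_one, ← add_assoc, Nat.add_right_cancel_iff] at hn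
    have hc : countLoop ν w E κ (f + 1) k t a l B J = force (E - w * f) fun p => force (ν p)
      fun c => cond (Nat.ble c 0) (countLoop ν w E κ f k t a l B J)
        (countStep (countLoop ν w E κ f) p c k t a l B J) := rfl
    have hp : E - w * f = n := by omega
    rw [hc, hp] at h
    simp only [force_eq, cond_eq_ite, Nat.ble_eq, Nat.le_zero] at h
    have hν0 : CountsPrimes ν n (n + w) := by
      simpa using hν 0 (by rw [mul_zero]; omega)
    refine ih (n := n + w) (by omega) (fun i hi => ?_) ?_
    · have := hν (i + 1) (by rw [mul_add]; omega)
      rwa [mul_add, mul_one, add_comm (w * i), ← add_assoc] at this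
    · split_ifs at h with h0
      · exact ⟨_, _, _, _, _, _, hs.of_countsPrimes_zero (Nat.le_add_right _ _) hν0 h0, h⟩
      · exact AcceptsAt.of_countStep hs (Nat.le_add_right _ _) hν0 (Nat.pos_of_ne_zero h0) h

theorem countOne_eq (P p : ℕ) : countOne P p = if p.Coprime P then 1 else 0 := by
  have h : countOne P p = 1 / Nat.gcd p P := rfl
  rw [h]
  split_ifs with hc
  · rw [hc]
  · rcases Nat.eq_zero_or_pos (Nat.gcd p P) with h0 | h0
    · rw [h0]
    · exact Nat.div_eq_of_lt (lt_of_le_of_ne h0 (Ne.symm hc))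

theorem coprime_factorial_of_lt {p M : ℕ} (hp : p.Prime) (h : M < p) : p.Coprime M.factorial :=
  hp.coprime_iff_not_dvd.2 fun hd => absurd (hp.dvd_factorial.1 hd) (not_le.2 h)

/-- If all primes from `n` on are coprime to `P` and lie among the `n + r` with `r ∈ R`, then it
suffices to count the latter numbers which are coprime to `P`. -/
theorem CountsPrimes.of_offsets {ν : ℕ → ℕ} {P n w : ℕ} (R : Finset ℕ) (hR : ∀ r ∈ R, r < w)
    (hP : ∀ p, p.Prime → n ≤ p → p.Coprime P)
    (h : ∀ r, (n + r).Prime → r < w → r ∈ R) (hν : ν n = ∑ r ∈ R, countOne P (n + r)) :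
    CountsPrimes ν n (n + w) := by
  refine ⟨(R.filter fun r => (n + r).Coprime P).image (n + ·), fun p hp hnp hpw => ?_,
    fun p hp => ?_, ?_⟩
  · obtain ⟨r, rfl⟩ := Nat.exists_eq_add_of_le hnp
    exact Finset.mem_image_of_mem _
      (Finset.mem_filter.2 ⟨h r hp (Nat.add_lt_add_iff_left.1 hpw), hP _ hp hnp⟩)
  · obtain ⟨r, hr, rfl⟩ := Finset.mem_image.1 hp
    exact ⟨Nat.le_add_right _ _, Nat.add_lt_add_left (hR r (Finset.mem_filter.1 hr).1) _⟩
  · rw [Finset.card_image_of_injective _ (add_right_injective n), Finset.card_filter, hν]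
    exact Finset.sum_congr rfl fun r _ => (countOne_eq _ _).symm

theorem countsPrimes_countOne {P n : ℕ} (h1 : 2 < n) (hn : n % 2 = 1)
    (hP : ∀ p, p.Prime → n ≤ p → p.Coprime P) : CountsPrimes (countOne P) n (n + 2) := by
  refine CountsPrimes.of_offsets {0} (by simp) hP (fun r hr hr2 => ?_) (by simp)
  have := hr.eq_two_or_odd
  rw [Finset.mem_singleton]
  omega

theorem countsPrimes_countThirty {P n : ℕ} (h1 : 5 < n) (hn : n % 30 = 1)
    (hP : ∀ p, p.Prime → n ≤ p → p.Coprime P) : CountsPrimes (countThirty P) n (n + 30) := by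
  refine CountsPrimes.of_offsets {0, 6, 10, 12, 16, 18, 22, 28} (by simp) hP
    (fun r hr hr2 => ?_) ?_
  · have h2 : (n + r) % 2 ≠ 0 := fun h => by
      have := (Nat.prime_dvd_prime_iff_eq Nat.prime_two hr).1 (Nat.dvd_of_mod_eq_zero h)
      omega
    have h3 : (n + r) % 3 ≠ 0 := fun h => by
      have := (Nat.prime_dvd_prime_iff_eq Nat.prime_three hr).1 (Nat.dvd_of_mod_eq_zero h)
      omega
    have h5 : (n + r) % 5 ≠ 0 := fun h => by
      have := (Nat.prime_dvd_prime_iff_eq Nat.prime_five hr).1 (Nat.dvd_of_mod_eq_zero h)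
      omega
    have hm : n % 2 = 1 ∧ n % 3 = 1 ∧ n % 5 = 1 := by omega
    clear hr
    interval_cases r <;> first | omega | simp
  · have h : countThirty P n = countOne P (n + 0) + countOne P (n + 6) +
      (countOne P (n + 10) + countOne P (n + 12)) + (countOne P (n + 16) + countOne P (n + 18) +
      (countOne P (n + 22) + countOne P (n + 28))) := rfl
    rw [h]
    simp [Finset.sum_insert]
    ring

theorem countsPrimes_two : CountsPrimes (fun _ => 1) 2 3 :=
  ⟨{2}, fun p _ h2 h3 => Finset.mem_singleton.2 (by omega),
    fun p hp => by rw [Finset.mem_singleton.1 hp]; norm_num, rfl⟩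

theorem countState_two : CountState 2 0 0 1 0 7 0 where
  exists_superset := ⟨∅, fun p hp h => absurd hp.two_le (not_le.2 h), by simp, rfl, by simp,
    by simp⟩
  log_le := by simp
  pos := one_pos
  le := one_le_two
  robinCard j hj s _ _ z hz _ := by
    have := seven_le_robinBound hz
    rw [Nat.le_zero.1 hj]
    push_cast
    linarith
  le_robinBound z hz _ := by
    have := seven_le_robinBound hz
    push_cast
    linarith

theorem acceptsAt_of_countLoop_countOne {κ : ℕ → ℕ → ℕ → ℕ → ℕ → ℕ → Bool} {P E n f : ℕ}
    (hn : n + 2 * f = E + 2) (h2 : 2 < n) (hodd : n % 2 = 1)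
    (hP : ∀ p, p.Prime → n ≤ p → p.Coprime P)
    (h : AcceptsAt (countLoop (countOne P) 2 E κ f) n) : AcceptsAt κ (E + 2) :=
  AcceptsAt.of_countLoop f hn (fun i _ => countsPrimes_countOne (by omega) (by omega)
    fun p hp hnp => hP p hp (by omega)) h

theorem countMid_of_countStep {P Q : ℕ} (hQ : ∀ p, p.Prime → 47 < p → p.Coprime Q)
    (hP : ∀ p, p.Prime → 1030 < p → p.Coprime P)
    (h : countStep (countLoop (countOne 1) 2 7 (countLoop (countOne 5040) 2 47
      (countLoop (countOne Q) 2 1031 (countLoop (countOne P) 2 74999 countMid 36984) 492) 20) 3)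
      2 1 0 0 1 0 7 0 = true) :
    CountState 75001 7393 112951768013 74923 16979718 7394 261773879542845865 := by
  have h1 := AcceptsAt.of_countStep countState_two (by norm_num) countsPrimes_two one_pos h
  have h2 := acceptsAt_of_countLoop_countOne (by norm_num) (by norm_num) (by norm_num)
    (fun p _ _ => Nat.coprime_one_right p) h1
  have h3 := acceptsAt_of_countLoop_countOne (by norm_num) (by norm_num) (by norm_num)
    (fun p hp hp' => coprime_factorial_of_lt (M := 7) hp (by omega)) h2
  have h4 := acceptsAt_of_countLoop_countOne (by norm_num) (by norm_num) (by norm_num)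
    (fun p hp hp' => hQ p hp (by omega)) h3
  have h5 := acceptsAt_of_countLoop_countOne (by norm_num) (by norm_num) (by norm_num)
    (fun p hp hp' => hP p hp (by omega)) h4
  obtain ⟨k, t, a, l, B, J, hs, h⟩ := h5
  simp only [countMid, cond_eq_ite, Nat.beq_eq, Bool.if_false_right, Bool.and_eq_true,
    decide_eq_true_eq] at h
  obtain ⟨rfl, rfl, rfl, rfl, rfl, rfl⟩ := h
  exact hs

theorem exists_countState_of_countLoop {P : ℕ} (hP : ∀ p, p.Prime → 1030 < p → p.Coprime P)
    (hs : CountState 75001 7393 112951768013 74923 16979718 7394 261773879542845865)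
    (h : countLoop (countThirty P) 30 1049971 countEnd 32500
      7393 112951768013 74923 16979718 7394 261773879542845865 = true) :
    ∃ k t a l B J, CountState 1050001 k t a l B J ∧ 18446744073709551616 ≤ t * 11629079 ∧
      J ≤ 455500000000000000 := by
  have h1 := AcceptsAt.of_countLoop (n := 75001) 32500 (by norm_num)
    (fun i _ => countsPrimes_countThirty (by omega) (by omega) fun p hp hnp =>
      hP p hp (by omega)) ⟨_, _, _, _, _, _, hs, h⟩
  obtain ⟨k, t, a, l, B, J, hs, h⟩ := h1
  have he : countEnd k t a l B J = cond (Nat.ble 18446744073709551616 (t * 11629079))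
    (Nat.ble J 455500000000000000) false := rfl
  rw [he, Bool.cond_false_right, Bool.and_eq_true, Nat.ble_eq, Nat.ble_eq] at h
  exact ⟨k, t, a, l, B, J, hs, h⟩

theorem exists_countState : ∃ k t a l B J, CountState 1050001 k t a l B J ∧
    18446744073709551616 ≤ t * 11629079 ∧ J ≤ 455500000000000000 := by
  have h := countSmall_eq_true
  have h' := countLarge_eq_true
  rw [countSmall, force_eq, force_eq] at h
  rw [countLarge, force_eq] at h'
  exact exists_countState_of_countLoop (fun p hp => coprime_factorial_of_lt hp)
    (countMid_of_countStep (fun p hp => coprime_factorial_of_lt hp)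
      (fun p hp => coprime_factorial_of_lt hp) h) h'

theorem card_le_robinBound_of_lt {s : Finset ℕ} (hs : ∀ p ∈ s, p.Prime) {z : ℝ} (hz : 1 < z)
    (hz' : z < 2 ^ 20) (h : ∑ p ∈ s, Real.log p ≤ z) : (s.card : ℝ) ≤ robinBound z := by
  obtain ⟨k, t, a, l, B, J, hst, ht, -⟩ := exists_countState
  rcases le_or_gt s.card k with hk | hk
  · exact hst.robinCard _ hk s hs rfl z hz h
  · exfalso
    obtain ⟨C, hC, hn, hc, htC, -⟩ := hst.exists_superset
    have h1 := sum_log_add_le (c := 0) hC hn hs (by omega)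
    have hlog2 := Real.log_two_gt_d9
    have ht' : (18446744073709551616 : ℝ) ≤ t * 11629079 := by exact_mod_cast ht
    have ht0 : (0 : ℝ) ≤ t := Nat.cast_nonneg t
    rw [Nat.cast_zero, zero_mul, add_zero] at h1
    norm_num at htC hz'
    nlinarith

theorem sum_max_sq_le {S : Finset ℕ} (hS : ∀ p ∈ S, p.Prime) :
    ∑ p ∈ S, (max 0 (1 - Real.log p / (20 * Real.log 2))) ^ 2 ≤ 1036 := by
  obtain ⟨k, t, a, l, B, J, hst, -, hJ⟩ := exists_countState
  obtain ⟨C, hC, hn, hc, -, hCJ⟩ := hst.exists_superset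
  have hl2 : 0 < Real.log 2 := Real.log_pos one_lt_two
  have h1 : ∑ p ∈ S, (max 0 (1 - Real.log p / (20 * Real.log 2))) ^ 2 ≤
      ∑ p ∈ C, (max 0 (1 - Real.log p / (20 * Real.log 2))) ^ 2 := by
    rw [← Finset.sum_filter_ne_zero]
    refine Finset.sum_le_sum_of_subset_of_nonneg (fun p hp => ?_) fun _ _ _ => sq_nonneg _
    obtain ⟨hpS, hp0⟩ := Finset.mem_filter.1 hp
    refine hC p (hS p hpS) (lt_of_not_ge fun hge => hp0 ?_)
    have h2 : 20 * Real.log 2 ≤ Real.log p := by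
      have : (20 : ℝ) * Real.log 2 = Real.log (2 ^ 20) := by
        rw [Real.log_pow]
        push_cast
        ring
      rw [this]
      refine Real.log_le_log (by positivity) ?_
      have : ((1050001 : ℕ) : ℝ) ≤ p := by exact_mod_cast hge
      push_cast at this
      linarith
    rw [max_eq_left, zero_pow two_ne_zero]
    rw [sub_nonpos, le_div_iff₀ (by positivity), one_mul]
    exact h2
  refine h1.trans ?_
  have h3 : ∀ x : ℝ, (max 0 (20 * 2 ^ 20 - 2 ^ 20 * (x / Real.log 2))) ^ 2 =
      (20 * 2 ^ 20) ^ 2 * (max 0 (1 - x / (20 * Real.log 2))) ^ 2 := fun x => by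
    rw [← mul_pow, mul_max_of_nonneg _ _ (by positivity), mul_zero]
    congr 2
    field_simp
  rw [Finset.sum_congr rfl fun (p : ℕ) _ => h3 (Real.log p), ← Finset.mul_sum] at hCJ
  have hJ' : (J : ℝ) ≤ 455500000000000000 := by exact_mod_cast hJ
  norm_num at hCJ
  linarith

theorem hasDerivAt_max_zero_sq (x : ℝ) :
    HasDerivAt (fun x : ℝ => (max 0 x) ^ 2) (2 * max 0 x) x := by
  rcases lt_trichotomy x 0 with h | rfl | h
  · rw [max_eq_left h.le, mul_zero]
    refine (hasDerivAt_const x (0 : ℝ)).congr_of_eventuallyEq ?_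
    filter_upwards [Iio_mem_nhds h] with y hy
    rw [max_eq_left (le_of_lt hy), zero_pow two_ne_zero]
  · rw [hasDerivAt_iff_isLittleO_nhds_zero]
    simp only [zero_add, max_self, mul_zero, smul_zero, sub_zero, zero_pow two_ne_zero]
    refine Asymptotics.IsBigO.trans_isLittleO (Asymptotics.IsBigO.of_bound 1 ?_)
      (Asymptotics.isLittleO_pow_id one_lt_two)
    refine Eventually.of_forall fun y => ?_
    rw [one_mul, norm_pow, norm_pow, Real.norm_eq_abs, Real.norm_eq_abs]
    refine pow_le_pow_left₀ (abs_nonneg _) ?_ 2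
    rw [abs_of_nonneg (le_max_left _ _)]
    exact max_le (abs_nonneg _) (le_abs_self _)
  · rw [max_eq_right h.le]
    have h1 := hasDerivAt_pow 2 x
    rw [Nat.cast_ofNat, pow_one] at h1
    refine h1.congr_of_eventuallyEq ?_
    filter_upwards [Ioi_mem_nhds h] with y hy
    rw [max_eq_right (le_of_lt hy)]

/-- The quadratically weighted number of the elements of `s` which are at most `exp y`. -/
noncomputable def sqSum (s : Finset ℕ) (y : ℝ) : ℝ :=
  ∑ p ∈ s, (max 0 (1 - Real.log p / y)) ^ 2

theorem hasDerivAt_sqSum (s : Finset ℕ) {y : ℝ} (hy : 0 < y) : HasDerivAt (sqSum s)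
    (2 / y ^ 3 * ∑ p ∈ s with Real.log (p : ℕ) ≤ y, Real.log p * (y - Real.log p)) y := by
  have h1 : ∀ p ∈ s, HasDerivAt (fun y : ℝ => (max 0 (1 - Real.log p / y)) ^ 2)
      (2 * max 0 (1 - Real.log p / y) * (Real.log p / y ^ 2)) y := fun p _ => by
    have h2 : HasDerivAt (fun y : ℝ => 1 - Real.log p / y) (Real.log p / y ^ 2) y := by
      have := ((hasDerivAt_inv hy.ne').const_mul (Real.log p)).const_sub 1
      simp only [← div_eq_mul_inv] at this
      refine this.congr_deriv ?_
      field_simp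
    exact (hasDerivAt_max_zero_sq _).comp y h2
  refine (HasDerivAt.fun_sum h1).congr_deriv ?_
  rw [Finset.sum_filter, Finset.mul_sum]
  refine Finset.sum_congr rfl fun p _ => ?_
  split_ifs with hp
  · rw [max_eq_right]
    · field_simp
    · rw [sub_nonneg, div_le_one hy]
      exact hp
  · rw [max_eq_left]
    · ring
    · rw [sub_nonpos, one_le_div hy]
      exact (not_le.1 hp).le

/-- The bound for `sqSum` which suffices for Robin's bound if `sum_log_mul_log_le` holds with the
error `α + β / y`. -/
noncomputable def sqMajorant (α β y : ℝ) : ℝ :=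
  Real.exp y * ((2.8973 - β) / y ^ 3 - α / y ^ 2)

theorem hasDerivAt_sqMajorant (α β : ℝ) {y : ℝ} (hy : 0 < y) : HasDerivAt (sqMajorant α β)
    (Real.exp y / y ^ 4 * ((2.8973 - β + 2 * α) * y - α * y ^ 2 - 3 * (2.8973 - β))) y := by
  have h1 := (hasDerivAt_const y (2.8973 - β)).div (hasDerivAt_pow 3 y) (by positivity)
  have h2 := (hasDerivAt_const y α).div (hasDerivAt_pow 2 y) (by positivity)
  refine ((Real.hasDerivAt_exp y).mul (h1.sub h2)).congr_deriv ?_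
  simp only [Pi.sub_apply, Pi.div_apply]
  field_simp
  push_cast
  ring

theorem sqSum_le_sqMajorant {s : Finset ℕ} {α β a b : ℝ} (ha : 0 < a) (hab : a ≤ b)
    (hT : ∀ y ∈ Icc a b, ∑ p ∈ s with Real.log (p : ℕ) ≤ y, Real.log p * (y - Real.log p) ≤
      Real.exp y * (1 + α + β / y))
    (hc : ∀ y ∈ Icc a b, 3 * 2.8973 - β ≤ (0.8973 - β) * y - α * y ^ 2)
    (h : sqSum s a ≤ sqMajorant α β a) : sqSum s b ≤ sqMajorant α β b := by
  have hd : ∀ y ∈ Icc a b, HasDerivAt (fun y => sqMajorant α β y - sqSum s y) _ y := fun y hy =>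
    (hasDerivAt_sqMajorant α β (ha.trans_le hy.1)).sub (hasDerivAt_sqSum s (ha.trans_le hy.1))
  have hm : MonotoneOn (fun y => sqMajorant α β y - sqSum s y) (Icc a b) := by
    refine monotoneOn_of_deriv_nonneg (convex_Icc a b)
      (fun y hy => (hd y hy).continuousAt.continuousWithinAt)
      (fun y hy => (hd y (interior_subset hy)).differentiableAt.differentiableWithinAt)
      fun y hy => ?_
    have hy' := interior_subset hy
    have hy0 : 0 < y := ha.trans_le hy'.1
    rw [(hd y hy').deriv, sub_nonneg]
    refine (mul_le_mul_of_nonneg_left (hT y hy') (by positivity)).trans ?_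
    have e : 2 / y ^ 3 * (Real.exp y * (1 + α + β / y)) =
        Real.exp y / y ^ 4 * (2 * ((1 + α) * y + β)) := by
      field_simp
    rw [e]
    refine mul_le_mul_of_nonneg_left ?_ (by positivity)
    linarith [hc y hy']
  have := hm (left_mem_Icc.2 hab) (right_mem_Icc.2 hab) hab
  simp only at this
  linarith

theorem card_le_of_sqSum_le {s : Finset ℕ} {α β l : ℝ} (hl : 0 < l)
    (hs : ∑ p ∈ s, Real.log p ≤ Real.exp l)
    (hT : ∑ p ∈ s with Real.log (p : ℕ) ≤ l, Real.log p * (l - Real.log p) ≤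
      Real.exp l * (1 + α + β / l))
    (h : sqSum s l ≤ sqMajorant α β l) : (s.card : ℝ) ≤ robinExp l := by
  have h1 : (s.card : ℝ) ≤ (∑ p ∈ s, Real.log p) / l +
      (∑ p ∈ s with Real.log (p : ℕ) ≤ l, Real.log p * (l - Real.log p)) / l ^ 2 + sqSum s l := by
    rw [sqSum, Finset.sum_filter, Finset.sum_div, Finset.sum_div, ← Finset.sum_add_distrib,
      ← Finset.sum_add_distrib, Finset.card_eq_sum_ones, Nat.cast_sum]
    refine Finset.sum_le_sum fun p _ => ?_
    rw [Nat.cast_one]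
    split_ifs with hp
    · rw [max_eq_right]
      · refine le_of_eq ?_
        field_simp
        ring
      · rw [sub_nonneg, div_le_one hl]
        exact hp
    · have : 1 ≤ Real.log p / l := (one_le_div hl).2 (not_le.1 hp).le
      rw [zero_div, add_zero]
      exact this.trans (le_add_of_nonneg_right (sq_nonneg _))
  have h2 : (∑ p ∈ s, Real.log p) / l ≤ Real.exp l / l := by gcongr
  have h3 : (∑ p ∈ s with Real.log (p : ℕ) ≤ l, Real.log p * (l - Real.log p)) / l ^ 2 ≤
      Real.exp l * (1 + α + β / l) / l ^ 2 := by gcongr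
  have h4 : robinExp l = Real.exp l / l + Real.exp l * (1 + α + β / l) / l ^ 2 +
      sqMajorant α β l := by
    rw [robinExp, sqMajorant]
    field_simp
    ring
  linarith

theorem sum_log_filter_le {s : Finset ℕ} (hs : ∀ p ∈ s, p.Prime) {y : ℝ}
    (hy : 20 * Real.log 2 ≤ y) : ∑ p ∈ s with Real.log (p : ℕ) ≤ y, Real.log p * (y - Real.log p) ≤
      Real.exp y * (1 + 0.01134 + 0.06463 / y) := by
  have h := sum_log_mul_log_le_of_two_pow_le (x := Real.exp y)
    (S := s.filter fun p : ℕ => Real.log p ≤ y) ?_ fun p hp => ?_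
  · rwa [Real.log_exp] at h
  · rw [← Real.log_le_iff_le_exp (by positivity), Real.log_pow]
    exact_mod_cast hy
  · obtain ⟨hp, hpy⟩ := Finset.mem_filter.1 hp
    exact ⟨hs p hp, (Real.log_le_iff_le_exp (by exact_mod_cast (hs p hp).pos)).1 hpy⟩

theorem sum_log_filter_le_of_forty_le {s : Finset ℕ} (hs : ∀ p ∈ s, p.Prime) {y : ℝ}
    (hy : 40 ≤ y) : ∑ p ∈ s with Real.log (p : ℕ) ≤ y, Real.log p * (y - Real.log p) ≤
      Real.exp y * (1 + 0 + 0.386 / y) := by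
  have h := sum_log_mul_log_le_of_forty_le_log (x := Real.exp y)
    (S := s.filter fun p : ℕ => Real.log p ≤ y) (Real.exp_pos y) (by rwa [Real.log_exp])
    fun p hp => ?_
  · rw [Real.log_exp] at h
    rwa [add_zero]
  · obtain ⟨hp, hpy⟩ := Finset.mem_filter.1 hp
    exact ⟨hs p hp, (Real.log_le_iff_le_exp (by exact_mod_cast (hs p hp).pos)).1 hpy⟩

theorem sqSum_le_sqMajorant_of_le_forty {s : Finset ℕ} (hs : ∀ p ∈ s, p.Prime) {y : ℝ}
    (hy : 20 * Real.log 2 ≤ y) (hy' : y ≤ 40) : sqSum s y ≤ sqMajorant 0.01134 0.06463 y := by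
  have h1 := Real.log_two_gt_d9
  have h2 := Real.log_two_lt_d9
  refine sqSum_le_sqMajorant (by linarith) hy (fun y hy => sum_log_filter_le hs hy.1)
    (fun w hw => ?_) ((sum_max_sq_le hs).trans ?_)
  · nlinarith [mul_nonneg (show 0 ≤ w - 13.86 by linarith [hw.1]) (sub_nonneg.2 (hw.2.trans hy'))]
  · obtain ⟨w, hw⟩ : ∃ w, w = 20 * Real.log 2 := ⟨_, rfl⟩
    have h0 : 0 < w := by linarith
    have he : Real.exp w = 1048576 := by
      rw [hw, mul_comm, Real.exp_mul, Real.exp_log two_pos]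
      norm_num
    have hw1 : 13.8629 ≤ w := by linarith
    have hw2 : w ≤ 13.863 := by linarith
    have e : sqMajorant 0.01134 0.06463 w =
        1048576 * (2.8973 - 0.06463 - 0.01134 * w) / w ^ 3 := by
      rw [sqMajorant, he]
      field_simp
    rw [← hw, e, le_div_iff₀ (by positivity)]
    have : w ^ 3 ≤ 13.863 ^ 3 := pow_le_pow_left₀ h0.le hw2 3
    linarith

theorem sqSum_le_sqMajorant_of_forty_le {s : Finset ℕ} (hs : ∀ p ∈ s, p.Prime) {y : ℝ}
    (hy : 40 ≤ y) : sqSum s y ≤ sqMajorant 0 0.386 y := by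
  refine sqSum_le_sqMajorant (by norm_num) hy
    (fun y hy => sum_log_filter_le_of_forty_le hs hy.1) (fun w hw => ?_) ?_
  · linarith [hw.1]
  · refine (sqSum_le_sqMajorant_of_le_forty hs (by linarith [Real.log_two_lt_d9]) le_rfl).trans ?_
    rw [sqMajorant, sqMajorant]
    refine mul_le_mul_of_nonneg_left ?_ (Real.exp_pos _).le
    norm_num

theorem card_le_robinBound {s : Finset ℕ} (hs : ∀ p ∈ s, p.Prime) {z : ℝ} (hz : 1 < z)
    (h : ∑ p ∈ s, Real.log p ≤ z) : (s.card : ℝ) ≤ robinBound z := by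
  rcases lt_or_ge z (2 ^ 20) with hz' | hz'
  · exact card_le_robinBound_of_lt hs hz hz' h
  · have hl := Real.log_pos hz
    have hl2 : 20 * Real.log 2 ≤ Real.log z := by
      have := Real.log_le_log (by positivity) hz'
      rw [Real.log_pow] at this
      exact_mod_cast this
    rw [← Real.exp_log (zero_lt_one.trans hz)] at h
    rcases le_total (Real.log z) 40 with h40 | h40
    · exact card_le_of_sqSum_le hl h (sum_log_filter_le hs hl2)
        (sqSum_le_sqMajorant_of_le_forty hs hl2 h40)
    · exact card_le_of_sqSum_le hl h (sum_log_filter_le_of_forty_le hs h40)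
        (sqSum_le_sqMajorant_of_forty_le hs h40)

/-- **Robin's bound.** For all `n ≥ 3`,
`ω(n) ≤ (log n / log log n)(1 + 1/log log n + 2.8973/(log log n)²)`. -/
theorem robin_omega_bound (n : ℕ) (hn : 3 ≤ n) :
    (n.primeFactors.card : ℝ) ≤
      Real.log n / Real.log (Real.log n) *
        (1 + 1 / Real.log (Real.log n) + 2.8973 / (Real.log (Real.log n)) ^ 2) := by
  have hn' : (3 : ℝ) ≤ n := by exact_mod_cast hn
  have hz : 1 < Real.log n := by
    rw [Real.lt_log_iff_exp_lt (by linarith)]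
    linarith [Real.exp_one_lt_d9]
  have hl := Real.log_pos hz
  have hsum : ∑ p ∈ n.primeFactors, Real.log p ≤ Real.log n := by
    rw [← Real.log_prod fun p hp => by exact_mod_cast (Nat.prime_of_mem_primeFactors hp).ne_zero]
    refine Real.log_le_log (Finset.prod_pos fun p hp => ?_) ?_
    · exact_mod_cast (Nat.prime_of_mem_primeFactors hp).pos
    · rw [← Nat.cast_prod]
      exact_mod_cast Nat.le_of_dvd (by omega) (Nat.prod_primeFactors_dvd n)
  refine (card_le_robinBound (fun p => Nat.prime_of_mem_primeFactors) hz hsum).trans (le_of_eq ?_)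
  rw [robinBound, robinExp, Real.exp_log (by linarith)]
  field_simp
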